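/- Let μ ∈ ℂ³ with μ₁+μ₂+μ₃ = 0, Re(μ_i) = 0 for all i, and μ₁ ≠ μ₂, and let y = (y₁,y₂) with y₁ < 0 and y₂ < 0. Then K¹_{w_l}(y,μ)/(8|y₁y₂|) = −𝒥₁⁺(y,μ) − 𝒥₁⁺(y,μ^{w₄}) + 𝒥₁⁺(y,μ^{w₅}). -/

import Mathlib

open MeasureTheory
/-- The GL(3) long-element power-series Bessel function `J_{w_l}(y,μ)`. -/
noncomputable def Jwl (y₁ y₂ : ℝ) (μ₁ μ₂ μ₃ : ℂ) : ℂ :=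
  ((|4 * Real.pi ^ 2 * y₁| : ℝ) : ℂ) ^ (1 - μ₃) *
    ((|4 * Real.pi ^ 2 * y₂| : ℝ) : ℂ) ^ (1 + μ₁) *
    ∑' n : ℕ × ℕ,
      Complex.Gamma ((n.1 : ℂ) + (n.2 : ℂ) + μ₁ - μ₃ + 1) *
          ((4 * Real.pi ^ 2 * y₁ : ℝ) : ℂ) ^ n.1 * ((4 * Real.pi ^ 2 * y₂ : ℝ) : ℂ) ^ n.2 /
        (Complex.Gamma ((n.1 : ℂ) + μ₁ - μ₃ + 1) * Complex.Gamma ((n.2 : ℂ) + μ₁ - μ₁ + 1) *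
          Complex.Gamma ((n.1 : ℂ) + μ₂ - μ₃ + 1) * Complex.Gamma ((n.2 : ℂ) + μ₁ - μ₂ + 1) *
          Complex.Gamma ((n.1 : ℂ) + μ₃ - μ₃ + 1) * Complex.Gamma ((n.2 : ℂ) + μ₁ - μ₃ + 1))

/-- `J^{ε₁,ε₂}_{w_l}(y,μ) = ε₂J_{w_l}(y,μ) + ε₁J_{w_l}(y,μ^{w₄}) + ε₁ε₂J_{w_l}(y,μ^{w₅})`. -/
noncomputable def Jsign (e₁ e₂ : ℂ) (y₁ y₂ : ℝ) (μ₁ μ₂ μ₃ : ℂ) : ℂ :=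
  e₂ * Jwl y₁ y₂ μ₁ μ₂ μ₃ + e₁ * Jwl y₁ y₂ μ₃ μ₁ μ₂ + e₁ * e₂ * Jwl y₁ y₂ μ₂ μ₃ μ₁

/-- The weight-zero GL(3) long-element Bessel function `K⁰_{w_l}(y,μ)`. -/
noncomputable def K0wl (y₁ y₂ : ℝ) (μ₁ μ₂ μ₃ : ℂ) : ℂ :=
  -(1 / (16 * (Real.pi : ℂ))) *
    ((Jsign 1 1 y₁ y₂ μ₁ μ₂ μ₃ - Jsign 1 1 y₁ y₂ μ₂ μ₁ μ₃) /
      (Complex.sin ((Real.pi : ℂ) / 2 * (μ₁ - μ₂)) *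
        Complex.sin ((Real.pi : ℂ) / 2 * (μ₁ - μ₃)) *
        Complex.sin ((Real.pi : ℂ) / 2 * (μ₂ - μ₃))))

/-- The weight-one GL(3) long-element Bessel function `K¹_{w_l}(y,μ)`, with
`(ε₁,ε₂) = (sgn y₁, sgn y₂)`. -/
noncomputable def K1wl (y₁ y₂ : ℝ) (μ₁ μ₂ μ₃ : ℂ) : ℂ :=
  -(1 / (16 * (Real.pi : ℂ))) *
    ((Jsign ((Real.sign y₁ : ℝ) : ℂ) ((Real.sign y₂ : ℝ) : ℂ) y₁ y₂ μ₁ μ₂ μ₃ -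
        Jsign ((Real.sign y₁ : ℝ) : ℂ) ((Real.sign y₂ : ℝ) : ℂ) y₁ y₂ μ₂ μ₁ μ₃) /
      (Complex.cos ((Real.pi : ℂ) / 2 * (μ₁ - μ₃)) *
        Complex.cos ((Real.pi : ℂ) / 2 * (μ₂ - μ₃)) *
        Complex.sin ((Real.pi : ℂ) / 2 * (μ₁ - μ₂))))
/-- The classical Bessel function `J_ν(x) = Σ_{k≥0} (−1)^k (x/2)^{ν+2k}/(k! Γ(ν+k+1))`. -/
noncomputable def besselJ (ν : ℂ) (x : ℝ) : ℂ :=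
  ∑' k : ℕ, (-1 : ℂ) ^ k * ((x / 2 : ℝ) : ℂ) ^ (ν + 2 * (k : ℂ)) /
    ((Nat.factorial k : ℂ) * Complex.Gamma (ν + (k : ℂ) + 1))

/-- `J⁺_ν(x) = (π/2)(J_ν(2x)+J_{−ν}(2x))/cos(πν/2)`. -/
noncomputable def Jplus (ν : ℂ) (x : ℝ) : ℂ :=
  ((Real.pi : ℂ) / 2) * (besselJ ν (2 * x) + besselJ (-ν) (2 * x)) /
    Complex.cos ((Real.pi : ℂ) * ν / 2)

/-- `J⁻_ν(x) = (π/2)(J_{−ν}(2x)−J_ν(2x))/sin(πν/2)`. -/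
noncomputable def Jminus (ν : ℂ) (x : ℝ) : ℂ :=
  ((Real.pi : ℂ) / 2) * (besselJ (-ν) (2 * x) - besselJ ν (2 * x)) /
    Complex.sin ((Real.pi : ℂ) * ν / 2)

/-- `K̃_ν(x) = 2cos(πν/2)·K_ν(2x)`, with `K_ν(2x) = ∫_0^∞ e^{−2x cosh t} cosh(νt) dt`. -/
noncomputable def Ktilde (ν : ℂ) (x : ℝ) : ℂ :=
  2 * Complex.cos ((Real.pi : ℂ) * ν / 2) *
    ∫ t in Set.Ioi (0 : ℝ),
      ((Real.exp (-2 * x * Real.cosh t) : ℝ) : ℂ) * Complex.cosh (ν * (t : ℂ))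

/-- `𝒥₁⁺(y,μ)`. -/
noncomputable def calJ1plus (y₁ y₂ : ℝ) (μ₁ μ₂ μ₃ : ℂ) : ℂ :=
  ((|y₁ / y₂| : ℝ) : ℂ) ^ (μ₂ / 2) *
    ∫ u in Set.Ioi (0 : ℝ),
      Jplus (μ₃ - μ₁) (2 * Real.pi * Real.sqrt |y₁| * Real.sqrt (1 + u ^ 2)) *
        Jplus (μ₃ - μ₁) (2 * Real.pi * Real.sqrt |y₂| * Real.sqrt (1 + (1 / u) ^ 2)) *
        ((u : ℂ) ^ (3 * μ₂) / (u : ℂ))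

/-- `𝒥₂⁻(y,μ)`. -/
noncomputable def calJ2minus (y₁ y₂ : ℝ) (μ₁ μ₂ μ₃ : ℂ) : ℂ :=
  ((|y₁ / y₂| : ℝ) : ℂ) ^ (μ₂ / 2) *
    ∫ u in Set.Ioi (1 : ℝ),
      Jminus (μ₃ - μ₁) (2 * Real.pi * Real.sqrt |y₁| * Real.sqrt (u ^ 2 - 1)) *
        Jminus (μ₃ - μ₁) (2 * Real.pi * Real.sqrt |y₂| * Real.sqrt (1 - (1 / u) ^ 2)) *
        ((u : ℂ) ^ (3 * μ₂) / (u : ℂ))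

/-- `𝒥₃(y,μ)`. -/
noncomputable def calJ3 (y₁ y₂ : ℝ) (μ₁ μ₂ μ₃ : ℂ) : ℂ :=
  ((|y₁ / y₂| : ℝ) : ℂ) ^ (μ₂ / 2) *
    ∫ u in Set.Ioi (0 : ℝ),
      Ktilde (μ₃ - μ₁) (2 * Real.pi * Real.sqrt |y₁| * Real.sqrt (1 + u ^ 2)) *
        Jminus (μ₃ - μ₁) (2 * Real.pi * Real.sqrt |y₂| * Real.sqrt (1 + (1 / u) ^ 2)) *
        ((u : ℂ) ^ (3 * μ₂) / (u : ℂ))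

/-- `𝒥₄(y,μ)`. -/
noncomputable def calJ4 (y₁ y₂ : ℝ) (μ₁ μ₂ μ₃ : ℂ) : ℂ :=
  ((|y₁ / y₂| : ℝ) : ℂ) ^ (μ₂ / 2) *
    ∫ u in Set.Ioo (0 : ℝ) 1,
      Ktilde (μ₃ - μ₁) (2 * Real.pi * Real.sqrt |y₁| * Real.sqrt (1 - u ^ 2)) *
        Ktilde (μ₃ - μ₁) (2 * Real.pi * Real.sqrt |y₂| * Real.sqrt ((1 / u) ^ 2 - 1)) *
        ((u : ℂ) ^ (3 * μ₂) / (u : ℂ))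

/-- Holomorphic dependence of a dominated integral on a parameter. -/
theorem differentiableOn_integral_of_dominated {X : Type*} [MeasurableSpace X] {m : Measure X}
    {φ : ℂ → X → ℂ} {U : Set ℂ} (hU : IsOpen U) {bound : X → ℝ} (hb : Integrable bound m)
    (hmeas : ∀ ζ ∈ U, AEStronglyMeasurable (φ ζ) m)
    (hdiff : ∀ᵐ p ∂m, DifferentiableOn ℂ (fun ζ => φ ζ p) U)
    (hle : ∀ᵐ p ∂m, ∀ ζ ∈ U, ‖φ ζ p‖ ≤ bound p) :
    DifferentiableOn ℂ (fun ζ => ∫ p, φ ζ p ∂m) U := by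
  intro ζ₀ hζ₀
  obtain ⟨r, hr, hrU⟩ := Metric.isOpen_iff.1 hU ζ₀ hζ₀
  set ε := r / 2 with hε
  have hε0 : 0 < ε := by positivity
  have hsub : ∀ x ∈ Metric.ball ζ₀ ε, Metric.closedBall x (ε / 2) ⊆ U := by
    intro x hx y hy
    apply hrU
    rw [Metric.mem_ball] at *
    rw [Metric.mem_closedBall] at hy
    have := dist_triangle y x ζ₀
    linarith
  have hball : Metric.ball ζ₀ ε ⊆ U := fun x hx =>
    hsub x hx (Metric.mem_closedBall_self (by positivity))
  have hF' : AEStronglyMeasurable (fun p => deriv (fun ζ => φ ζ p) ζ₀) m := by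
    have hlim : Filter.Tendsto (fun n : ℕ => ζ₀ + ((n : ℂ) + 1)⁻¹) Filter.atTop (nhds ζ₀) := by
      have h : Filter.Tendsto (fun n : ℕ => ((n : ℂ) + 1)⁻¹) Filter.atTop (nhds 0) := by
        simpa using tendsto_one_div_add_atTop_nhds_zero_nat (𝕜 := ℂ)
      simpa using h.const_add ζ₀
    have hev : ∀ᶠ n : ℕ in Filter.atTop, ζ₀ + ((n : ℂ) + 1)⁻¹ ∈ U :=
      hlim.eventually (hU.mem_nhds hζ₀)
    obtain ⟨N, hN⟩ := Filter.eventually_atTop.1 hev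
    refine aestronglyMeasurable_of_tendsto_ae Filter.atTop
      (f := fun n p => slope (fun ζ => φ ζ p) ζ₀ (ζ₀ + (((n + N : ℕ) : ℂ) + 1)⁻¹)) ?_ ?_
    · intro n
      simp only [slope_def_field, div_eq_mul_inv]
      exact ((hmeas _ (hN _ (Nat.le_add_left N n))).sub (hmeas _ hζ₀)).mul_const _
    · filter_upwards [hdiff] with p hp
      have hd : HasDerivAt (fun ζ => φ ζ p) (deriv (fun ζ => φ ζ p) ζ₀) ζ₀ :=
        ((hp ζ₀ hζ₀).differentiableAt (hU.mem_nhds hζ₀)).hasDerivAt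
      refine (hasDerivAt_iff_tendsto_slope.1 hd).comp ?_
      rw [tendsto_nhdsWithin_iff]
      refine ⟨hlim.comp (Filter.tendsto_add_atTop_nat N), Filter.Eventually.of_forall fun n => ?_⟩
      have h1 : (((n + N : ℕ) : ℂ) + 1) ≠ 0 := Nat.cast_add_one_ne_zero _
      have h2 := inv_ne_zero h1
      simpa using h2
  have key := hasDerivAt_integral_of_dominated_loc_of_deriv_le (μ := m) (F := φ) (x₀ := ζ₀)
    (F' := fun ζ p => deriv (fun ζ => φ ζ p) ζ) (s := Metric.ball ζ₀ ε)
    (bound := fun p => bound p / (ε / 2)) (Metric.ball_mem_nhds _ hε0)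
    (by filter_upwards [hU.mem_nhds hζ₀] with ζ hζ using hmeas ζ hζ)
    (hb.mono' (hmeas _ hζ₀) (by filter_upwards [hle] with p hp using hp _ hζ₀))
    hF'
    (by
      filter_upwards [hdiff, hle] with p hp hlp x hx
      refine Complex.norm_deriv_le_of_forall_mem_sphere_norm_le (by positivity) ?_ ?_
      · refine DifferentiableOn.diffContOnCl (hp.mono ?_)
        exact Metric.closure_ball_subset_closedBall.trans (hsub x hx)
      · intro z hz
        exact hlp z (hsub x hx (Metric.sphere_subset_closedBall hz)))
    (hb.div_const _)
    (by
      filter_upwards [hdiff] with p hp x hx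
      exact ((hp x (hball hx)).differentiableAt (hU.mem_nhds (hball hx))).hasDerivAt)
  exact key.2.differentiableAt.differentiableWithinAt

theorem norm_Gamma_le {z : ℂ} (hz : 0 < z.re) : ‖Complex.Gamma z‖ ≤ Real.Gamma z.re := by
  rw [Complex.Gamma_eq_integral hz, Real.Gamma_eq_integral hz, Complex.GammaIntegral]
  refine (norm_integral_le_integral_norm _).trans_eq ?_
  refine setIntegral_congr_fun measurableSet_Ioi fun x hx => ?_
  have hx : 0 < x := hx
  simp only [norm_mul, Complex.norm_cpow_eq_rpow_re_of_pos hx, Complex.norm_real,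
    Real.norm_eq_abs, abs_of_pos (Real.exp_pos _), Complex.sub_re, Complex.one_re]

theorem norm_Gamma_add_nat_le {s : ℂ} (hs : s.re = 0) (n : ℕ) :
    ‖Complex.Gamma (s + n + 1)‖ ≤ n.factorial := by
  have h : (s + n + 1).re = n + 1 := by simp [hs]
  have := norm_Gamma_le (z := s + n + 1) (by rw [h]; positivity)
  rwa [h, Real.Gamma_nat_eq_factorial] at this

theorem norm_inv_Gamma_add_nat_le {s : ℂ} (hs : s.re = 0) (n : ℕ) :
    ‖(Complex.Gamma (s + n + 1))⁻¹‖ ≤ ‖(Complex.Gamma (s + 1))⁻¹‖ / n.factorial := by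
  induction n with
  | zero => simp
  | succ k ih =>
    have hre : (s + k + 1).re = k + 1 := by simp [hs]
    have h0 : s + k + 1 ≠ 0 := by
      intro h
      rw [h] at hre
      have : (0:ℝ) < k + 1 := by positivity
      simp at hre; linarith
    have h1 : ((k : ℝ) + 1) ≤ ‖s + k + 1‖ := by
      rw [← hre]; exact Complex.re_le_norm _
    have e : s + ((k + 1 : ℕ) : ℂ) + 1 = (s + k + 1) + 1 := by push_cast; ring
    rw [e, Complex.Gamma_add_one _ h0, mul_inv, norm_mul, Nat.factorial_succ, Nat.cast_mul,
      norm_inv,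
      div_mul_eq_div_div_swap, div_eq_mul_inv _ (((k + 1 : ℕ) : ℝ)), mul_comm]
    gcongr
    push_cast; exact h1

theorem inv_Gamma_eq_sin (z : ℂ) (hz : Complex.sin (Real.pi * z) ≠ 0) :
    (Complex.Gamma (1 - z))⁻¹ = Complex.Gamma z * Complex.sin (Real.pi * z) / Real.pi := by
  have h := Complex.Gamma_mul_Gamma_one_sub z
  have hpi : (Real.pi : ℂ) ≠ 0 := by exact_mod_cast Real.pi_ne_zero
  have h2 : Complex.Gamma z * Complex.Gamma (1 - z) ≠ 0 := by
    rw [h]; exact div_ne_zero hpi hz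
  have h3 := right_ne_zero_of_mul h2
  rw [eq_div_iff hz] at h
  rw [inv_eq_one_div, div_eq_div_iff h3 hpi, one_mul]
  linear_combination -h

theorem sin_pi_mul_add_int (b : ℂ) (k : ℤ) :
    Complex.sin (Real.pi * (b + k)) = (-1) ^ k * Complex.sin (Real.pi * b) := by
  rw [mul_add, mul_comm (Real.pi : ℂ) (k : ℂ), Complex.sin_antiperiodic.add_int_mul_eq k,
    Int.cast_negOnePow]

/-- `1/Γ(m+1-b-l)` grows at most like `(l-1)!`. -/
theorem exists_norm_inv_Gamma_sub_le {b : ℂ} (hb : b.re = 0)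
    (hsin : Complex.sin (Real.pi * b) ≠ 0) :
    ∃ C : ℝ, 0 < C ∧ ∀ l m : ℕ, ‖(Complex.Gamma (m + 1 - b - l))⁻¹‖ ≤ C * (l - 1).factorial := by
  refine ⟨‖(Complex.Gamma (-b + 1))⁻¹‖ + ‖Complex.sin (Real.pi * b)‖ / Real.pi, by positivity, ?_⟩
  intro l m
  have hf : (1 : ℝ) ≤ (l - 1).factorial := by exact_mod_cast Nat.factorial_pos _
  rcases le_or_gt l m with h | h
  · obtain ⟨k, rfl⟩ := Nat.exists_eq_add_of_le h
    have h1 := norm_inv_Gamma_add_nat_le (s := -b) (by simp [hb]) k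
    have e : ((l + k : ℕ) : ℂ) + 1 - b - l = -b + k + 1 := by push_cast; ring
    rw [e]
    refine h1.trans ?_
    have hk : (1 : ℝ) ≤ k.factorial := by exact_mod_cast Nat.factorial_pos _
    calc _ ≤ ‖(Complex.Gamma (-b + 1))⁻¹‖ := div_le_self (norm_nonneg _) hk
      _ ≤ (‖(Complex.Gamma (-b + 1))⁻¹‖ + ‖Complex.sin (Real.pi * b)‖ / Real.pi) * 1 := by
        rw [mul_one]; exact le_add_of_nonneg_right (by positivity)
      _ ≤ _ := by gcongr
  · obtain ⟨k, rfl⟩ := Nat.exists_eq_add_of_lt h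
    have e : (m : ℂ) + 1 - b - ((m + k + 1 : ℕ) : ℂ) = 1 - (b + ((k + 1 : ℤ) : ℂ)) := by
      push_cast; ring
    have hs : Complex.sin (Real.pi * (b + ((k + 1 : ℤ) : ℂ))) ≠ 0 := by
      rw [sin_pi_mul_add_int]
      exact mul_ne_zero (zpow_ne_zero _ (by norm_num)) hsin
    rw [e, inv_Gamma_eq_sin _ hs, sin_pi_mul_add_int, norm_div, norm_mul, norm_mul, norm_zpow]
    have h1 := norm_Gamma_add_nat_le hb k
    have e2 : b + ((k + 1 : ℤ) : ℂ) = b + k + 1 := by push_cast; ring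
    rw [e2]
    have hpi : ‖(Real.pi : ℂ)‖ = Real.pi := by
      rw [Complex.norm_real, Real.norm_of_nonneg Real.pi_pos.le]
    simp only [norm_neg, norm_one, one_zpow, one_mul, hpi]
    have hkf : (k.factorial : ℝ) ≤ (m + k + 1 - 1).factorial := by
      exact_mod_cast Nat.factorial_le (by lia)
    calc _ = (‖Complex.sin (Real.pi * b)‖ / Real.pi) * ‖Complex.Gamma (b + k + 1)‖ := by ring
      _ ≤ (‖(Complex.Gamma (-b + 1))⁻¹‖ + ‖Complex.sin (Real.pi * b)‖ / Real.pi) *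
          (m + k + 1 - 1).factorial := by
        gcongr
        · exact le_add_of_nonneg_left (norm_nonneg _)
        · exact h1.trans hkf

/-- Vandermonde's convolution in terms of reciprocal Gamma values. -/
theorem sum_choose_mul_inv_Gamma (N : ℕ) : ∀ (P Q : ℂ), (∀ k : ℕ, P + Q + k - 1 ≠ 0) →
    ∑ l ∈ Finset.range (N + 1), (N.choose l : ℂ) *
      ((Complex.Gamma (P + l))⁻¹ * (Complex.Gamma (Q - l))⁻¹) =
    Complex.Gamma (P + Q + N - 1) *
      ((Complex.Gamma (P + N))⁻¹ * (Complex.Gamma Q)⁻¹ * (Complex.Gamma (P + Q - 1))⁻¹) := by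
  have hrec : ∀ s : ℂ, (Complex.Gamma s)⁻¹ = s * (Complex.Gamma (s + 1))⁻¹ := fun s => by
    simpa using Complex.one_div_Gamma_eq_self_mul_one_div_Gamma_add_one s
  induction N with
  | zero =>
    intro P Q h
    have h0 : Complex.Gamma (P + Q - 1) ≠ 0 := by
      refine Complex.Gamma_ne_zero fun k hk => h k ?_
      linear_combination hk
    simp only [zero_add, Finset.range_one, Finset.sum_singleton, Nat.choose_self, Nat.cast_one,
      Nat.cast_zero, add_zero, sub_zero, one_mul]
    field_simp
  | succ N ih =>
    intro P Q h
    have hs := Finset.sum_choose_succ_mul (R := ℂ)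
      (fun l _ => (Complex.Gamma (P + l))⁻¹ * (Complex.Gamma (Q - l))⁻¹) N
    have h1 := ih P Q h
    have h2 := ih (P + 1) (Q - 1) (fun k => by convert h k using 1; ring)
    have e1 : ∑ l ∈ Finset.range (N + 1), (N.choose l : ℂ) *
        ((Complex.Gamma (P + ((l + 1 : ℕ) : ℂ)))⁻¹ * (Complex.Gamma (Q - ((l + 1 : ℕ) : ℂ)))⁻¹) =
        ∑ l ∈ Finset.range (N + 1), (N.choose l : ℂ) *
        ((Complex.Gamma (P + 1 + l))⁻¹ * (Complex.Gamma (Q - 1 - l))⁻¹) := by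
      refine Finset.sum_congr rfl fun l _ => ?_
      congr 4 <;> push_cast <;> ring
    rw [hs, e1, h1, h2]
    have e2 : P + Q + ((N + 1 : ℕ) : ℂ) - 1 = (P + Q + N - 1) + 1 := by push_cast; ring
    have e3 : P + ((N + 1 : ℕ) : ℂ) = P + N + 1 := by push_cast; ring
    have e4 : P + 1 + (Q - 1) + (N : ℂ) - 1 = P + Q + N - 1 := by ring
    have e5 : P + 1 + (Q - 1) - 1 = P + Q - 1 := by ring
    have e6 : P + 1 + (N : ℂ) = P + N + 1 := by ring
    have e7 := hrec (Q - 1)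
    rw [sub_add_cancel] at e7
    rw [e2, e3, e4, e5, e6, e7, hrec (P + N), Complex.Gamma_add_one _ (h N)]
    ring

/-- The entire function `∑ zᵐ / (m! Γ(ν+m+1))`. -/
noncomputable def besselSeries (ν z : ℂ) : ℂ :=
  ∑' m : ℕ, z ^ m * ((m.factorial : ℂ)⁻¹ * (Complex.Gamma (ν + m + 1))⁻¹)

/-- The integral `∫₀^∞ t^(w-1) exp(-(P t + Q / t)) dt`. -/
noncomputable def expKernel (P Q w : ℂ) : ℂ :=
  ∫ t in Set.Ioi (0 : ℝ), (t : ℂ) ^ (w - 1) * Complex.exp (-(P * t + Q / t))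

theorem exists_norm_inv_Gamma_le (ν : ℂ) :
    ∃ C : ℝ, ∀ m : ℕ, ‖(Complex.Gamma (ν + m + 1))⁻¹‖ ≤ C := by
  obtain ⟨N, hN⟩ := exists_nat_ge ‖ν‖
  have hmono : ∀ k : ℕ, ‖(Complex.Gamma (ν + ((N + k : ℕ) : ℂ) + 1))⁻¹‖ ≤
      ‖(Complex.Gamma (ν + N + 1))⁻¹‖ := by
    intro k
    induction k with
    | zero => simp
    | succ k ih =>
      refine le_trans ?_ ih
      rw [Complex.one_div_Gamma_eq_self_mul_one_div_Gamma_add_one (ν + ((N + k : ℕ) : ℂ) + 1)]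
      have e : ν + ((N + (k + 1) : ℕ) : ℂ) + 1 = ν + ((N + k : ℕ) : ℂ) + 1 + 1 := by
        push_cast; ring
      rw [e, norm_mul]
      refine le_mul_of_one_le_left (norm_nonneg _) ?_
      have h1 : ‖(((N + k : ℕ) : ℂ) + 1)‖ - ‖-ν‖ ≤ ‖(((N + k : ℕ) : ℂ) + 1) - (-ν)‖ :=
        norm_sub_norm_le _ _
      have h2 : ‖(((N + k : ℕ) : ℂ) + 1)‖ = N + k + 1 := by
        rw [← Nat.cast_succ, Complex.norm_natCast]; push_cast; ring
      rw [h2, norm_neg] at h1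
      have h3 : ν + ((N + k : ℕ) : ℂ) + 1 = (((N + k : ℕ) : ℂ) + 1) - (-ν) := by ring
      rw [h3]
      have : (0 : ℝ) ≤ k := by positivity
      linarith
  refine ⟨∑ m ∈ Finset.range (N + 1), ‖(Complex.Gamma (ν + m + 1))⁻¹‖, fun m => ?_⟩
  have hN' : ∀ m ∈ Finset.range (N + 1), ‖(Complex.Gamma (ν + m + 1))⁻¹‖ ≤
      ∑ m ∈ Finset.range (N + 1), ‖(Complex.Gamma (ν + m + 1))⁻¹‖ := fun m hm =>
    Finset.single_le_sum (f := fun m : ℕ => ‖(Complex.Gamma (ν + m + 1))⁻¹‖)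
      (fun _ _ => norm_nonneg _) hm
  rcases le_or_gt m N with h | h
  · exact hN' m (by simp; lia)
  · obtain ⟨k, rfl⟩ := Nat.exists_eq_add_of_le h.le
    exact (hmono k).trans (hN' N (by simp))

theorem exists_norm_besselSeries_term_le (ν : ℂ) : ∃ C : ℝ, ∀ (z : ℂ) (m : ℕ),
    ‖z ^ m * ((m.factorial : ℂ)⁻¹ * (Complex.Gamma (ν + m + 1))⁻¹)‖ ≤
      C * (‖z‖ ^ m / m.factorial) := by
  obtain ⟨C, hC⟩ := exists_norm_inv_Gamma_le ν
  refine ⟨C, fun z m => ?_⟩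
  rw [norm_mul, norm_mul, norm_pow, norm_inv, Complex.norm_natCast]
  calc _ = ‖(Complex.Gamma (ν + m + 1))⁻¹‖ * (‖z‖ ^ m / m.factorial) := by ring
    _ ≤ _ := by gcongr; exact hC m

theorem summable_besselSeries (ν z : ℂ) :
    Summable fun m : ℕ => z ^ m * ((m.factorial : ℂ)⁻¹ * (Complex.Gamma (ν + m + 1))⁻¹) := by
  obtain ⟨C, hC⟩ := exists_norm_besselSeries_term_le ν
  exact Summable.of_norm_bounded ((Real.summable_pow_div_factorial _).mul_left C) (hC z)

theorem differentiable_besselSeries (ν : ℂ) : Differentiable ℂ (besselSeries ν) := by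
  obtain ⟨C, hC⟩ := exists_norm_inv_Gamma_le ν
  intro z
  have hC0 : 0 ≤ C := (norm_nonneg _).trans (hC 0)
  have h : DifferentiableOn ℂ (fun z : ℂ => ∑' m : ℕ,
      z ^ m * ((m.factorial : ℂ)⁻¹ * (Complex.Gamma (ν + m + 1))⁻¹)) (Metric.ball 0 (‖z‖ + 1)) := by
    refine Complex.differentiableOn_tsum_of_summable_norm
      (u := fun m => C * ((‖z‖ + 1) ^ m / m.factorial))
      ((Real.summable_pow_div_factorial _).mul_left C) (fun m => by fun_prop)
      Metric.isOpen_ball ?_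
    intro m x hx
    rw [mem_ball_zero_iff] at hx
    rw [norm_mul, norm_mul, norm_pow, norm_inv, Complex.norm_natCast]
    calc _ = ‖(Complex.Gamma (ν + m + 1))⁻¹‖ * (‖x‖ ^ m / m.factorial) := by ring
      _ ≤ _ := by gcongr; exact hC m
  exact h.differentiableAt (Metric.isOpen_ball.mem_nhds (by simp))

theorem exp_neg_le_factorial_div_pow {x : ℝ} (hx : 0 < x) (n : ℕ) :
    Real.exp (-x) ≤ n.factorial / x ^ n := by
  have h := Real.pow_div_factorial_le_exp x hx.le n
  rw [Real.exp_neg, inv_le_comm₀ (Real.exp_pos _) (by positivity), inv_div]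
  exact h

theorem norm_expKernel_integrand {t : ℝ} (ht : 0 < t) (P Q w : ℂ) :
    ‖(t : ℂ) ^ (w - 1) * Complex.exp (-(P * t + Q / t))‖ =
      t ^ (w.re - 1) * Real.exp (-(P.re * t + Q.re / t)) := by
  rw [norm_mul, Complex.norm_cpow_eq_rpow_re_of_pos ht, Complex.norm_exp]
  congr 2
  rw [Complex.neg_re, Complex.add_re, Complex.re_mul_ofReal, Complex.div_ofReal_re]

theorem integrableOn_expKernel_real {P Q : ℝ} (hP : 0 < P) (hQ : 0 < Q) (r : ℝ) :
    IntegrableOn (fun t : ℝ => t ^ (r - 1) * Real.exp (-(P * t + Q / t))) (Set.Ioi 0) := by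
  obtain ⟨N, hN⟩ := exists_nat_gt (-r)
  have h := integrableOn_rpow_mul_exp_neg_mul_rpow (p := 1) (s := r + N - 1) (b := P)
    (by linarith) one_pos hP
  refine Integrable.mono' (h.const_mul (N.factorial / Q ^ N)) ?_ ?_
  · refine ContinuousOn.aestronglyMeasurable (fun t ht => ?_) measurableSet_Ioi
    have ht : 0 < t := ht
    refine ContinuousAt.continuousWithinAt ?_
    refine ContinuousAt.mul ?_ ?_
    · exact Real.continuousAt_rpow_const _ _ (Or.inl ht.ne')
    · refine Real.continuous_exp.continuousAt.comp ?_
      exact ((continuousAt_const.mul continuousAt_id).add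
        (continuousAt_const.div continuousAt_id ht.ne')).neg
  · refine (ae_restrict_iff' measurableSet_Ioi).2 (Filter.Eventually.of_forall fun t ht => ?_)
    have ht : 0 < t := ht
    rw [Real.norm_of_nonneg (by positivity), neg_add, Real.exp_add, Real.rpow_one]
    have h1 := exp_neg_le_factorial_div_pow (div_pos hQ ht) N
    have e : t ^ (r + N - 1) = t ^ (r - 1) * t ^ N := by
      rw [← Real.rpow_natCast, ← Real.rpow_add ht]; congr 1; ring
    calc _ ≤ t ^ (r - 1) * (Real.exp (-(P * t)) * (N.factorial / (Q / t) ^ N)) := by gcongr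
      _ = _ := by
        rw [e, neg_mul, div_pow]
        field_simp

theorem continuousOn_expKernel_integrand (P Q w : ℂ) :
    ContinuousOn (fun t : ℝ => (t : ℂ) ^ (w - 1) * Complex.exp (-(P * t + Q / t))) (Set.Ioi 0) := by
  intro t ht
  have ht : 0 < t := ht
  refine ContinuousAt.continuousWithinAt ?_
  refine ContinuousAt.mul ?_ ?_
  · exact (Complex.continuousAt_ofReal_cpow_const _ _ (Or.inr ht.ne'))
  · refine Complex.continuous_exp.continuousAt.comp ?_
    exact ((continuousAt_const.mul Complex.continuous_ofReal.continuousAt).add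
      (continuousAt_const.div Complex.continuous_ofReal.continuousAt
        (Complex.ofReal_ne_zero.2 ht.ne'))).neg

theorem integrableOn_expKernel {P Q : ℂ} (hP : 0 < P.re) (hQ : 0 < Q.re) (w : ℂ) :
    IntegrableOn (fun t : ℝ => (t : ℂ) ^ (w - 1) * Complex.exp (-(P * t + Q / t))) (Set.Ioi 0) := by
  refine Integrable.mono' (integrableOn_expKernel_real hP hQ w.re)
    ((continuousOn_expKernel_integrand P Q w).aestronglyMeasurable measurableSet_Ioi) ?_
  refine (ae_restrict_iff' measurableSet_Ioi).2 (Filter.Eventually.of_forall fun t ht => ?_)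
  exact (norm_expKernel_integrand ht P Q w).le

theorem add_natCast_ne_zero_of_im_ne_zero {w : ℂ} (hw : w.im ≠ 0) (n : ℕ) : w + n ≠ 0 := by
  intro h
  apply hw
  have := congrArg Complex.im h
  simpa using this

theorem norm_inv_add_natCast_le {w : ℂ} (hw : w.im ≠ 0) (n : ℕ) : ‖(w + n)⁻¹‖ ≤ |w.im|⁻¹ := by
  rw [norm_inv]
  gcongr
  simpa using Complex.abs_im_le_norm (w + n)

theorem summable_pow_div_factorial_mul_inv (P : ℝ) {w : ℂ} (hw : w.im ≠ 0) :
    Summable fun n : ℕ => (-P : ℂ) ^ n / n.factorial * (w + n)⁻¹ := by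
  refine Summable.of_norm_bounded ((Real.summable_pow_div_factorial |P|).mul_right |w.im|⁻¹)
    fun n => ?_
  rw [norm_mul, norm_div, norm_pow, norm_neg, Complex.norm_real, Complex.norm_natCast,
    Real.norm_eq_abs]
  gcongr
  exact norm_inv_add_natCast_le hw n

theorem integrableOn_Ioi_one_cpow_mul_exp {P : ℝ} (hP : 0 < P) (w : ℂ) :
    IntegrableOn (fun t : ℝ => (t : ℂ) ^ (w - 1) * Complex.exp (-(P * t))) (Set.Ioi 1) := by
  have h := (integrableOn_expKernel (P := P) (Q := 1) (by simpa) (by simp) w).mono_set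
    (Set.Ioi_subset_Ioi zero_le_one)
  refine Integrable.mono (h.norm.const_mul (Real.exp 1)) ?_ ?_
  · refine ContinuousOn.aestronglyMeasurable (fun t ht => ?_) measurableSet_Ioi
    have ht : 0 < t := zero_lt_one.trans ht
    refine ContinuousAt.continuousWithinAt ?_
    exact (Complex.continuousAt_ofReal_cpow_const _ _ (Or.inr ht.ne')).mul (by fun_prop)
  · refine (ae_restrict_iff' measurableSet_Ioi).2 (Filter.Eventually.of_forall fun t ht => ?_)
    have ht1 : 1 < t := ht
    have ht : 0 < t := zero_lt_one.trans ht
    rw [norm_mul, norm_mul, norm_norm, norm_expKernel_integrand ht,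
      Complex.norm_cpow_eq_rpow_re_of_pos ht, Complex.norm_exp]
    simp only [Complex.sub_re, Complex.one_re, Complex.ofReal_re, Complex.neg_re,
      Complex.re_mul_ofReal, Real.norm_eq_abs, Real.abs_exp]
    rw [mul_left_comm, ← Real.exp_add]
    gcongr
    have : 1 / t ≤ 1 := by rw [div_le_one ht]; exact ht1.le
    linarith

theorem integral_Ioi_one_recurrence {P : ℝ} (hP : 0 < P) (w : ℂ) :
    (P : ℂ) * ∫ t in Set.Ioi (1 : ℝ), (t : ℂ) ^ (w + 1 - 1) * Complex.exp (-(P * t)) =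
      Complex.exp (-P) +
        w * ∫ t in Set.Ioi (1 : ℝ), (t : ℂ) ^ (w - 1) * Complex.exp (-(P * t)) := by
  have hi1 := (integrableOn_Ioi_one_cpow_mul_exp hP (w + 1)).const_mul (P : ℂ)
  have hi2 := (integrableOn_Ioi_one_cpow_mul_exp hP w).const_mul w
  have hd : ∀ t ∈ Set.Ici (1 : ℝ), HasDerivAt
      (fun t : ℝ => -((t : ℂ) ^ w * Complex.exp (-(P * t))))
      ((P : ℂ) * ((t : ℂ) ^ (w + 1 - 1) * Complex.exp (-(P * t))) -
        w * ((t : ℂ) ^ (w - 1) * Complex.exp (-(P * t)))) t := by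
    intro t ht
    have ht : (0 : ℝ) < t := lt_of_lt_of_le zero_lt_one ht
    have h1 : HasDerivAt (fun z : ℂ => z ^ w) (w * (t : ℂ) ^ (w - 1)) t := by
      simpa using (hasDerivAt_id (t : ℂ)).cpow_const (c := w) (Or.inl (by simpa using ht))
    have h2 : HasDerivAt (fun z : ℂ => Complex.exp (-(P * z)))
        (Complex.exp (-(P * t)) * (-(P * 1))) t :=
      (((hasDerivAt_id (t : ℂ)).const_mul (P : ℂ)).neg).cexp
    have h3 := ((h1.mul h2).neg).comp_ofReal
    refine h3.congr_deriv ?_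
    rw [add_sub_cancel_right]; ring
  have hlim : Filter.Tendsto (fun t : ℝ => -((t : ℂ) ^ w * Complex.exp (-(P * t))))
      Filter.atTop (nhds 0) := by
    rw [← neg_zero]
    refine Filter.Tendsto.neg ?_
    rw [tendsto_zero_iff_norm_tendsto_zero]
    refine (tendsto_rpow_mul_exp_neg_mul_atTop_nhds_zero w.re P hP).congr' ?_
    filter_upwards [Filter.eventually_gt_atTop 0] with t ht
    rw [norm_mul, Complex.norm_cpow_eq_rpow_re_of_pos ht, Complex.norm_exp]
    simp
  have key := integral_Ioi_of_hasDerivAt_of_tendsto' hd (hi1.sub hi2) hlim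
  rw [integral_sub hi1 hi2, integral_const_mul, integral_const_mul] at key
  simp only [Complex.ofReal_one, Complex.one_cpow, mul_one, one_mul] at key
  linear_combination key

theorem hasSum_exp_complex (z : ℂ) : HasSum (fun n : ℕ => z ^ n / n.factorial) (Complex.exp z) := by
  rw [Complex.exp_eq_exp_ℂ]
  exact NormedSpace.expSeries_div_hasSum_exp z

theorem integral_Ioc_cpow_mul_exp (P : ℝ) {w : ℂ} (hw : 0 < w.re) :
    ∫ t in Set.Ioc (0 : ℝ) 1, (t : ℂ) ^ (w - 1) * Complex.exp (-(P * t)) =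
      ∑' n : ℕ, (-P : ℂ) ^ n / n.factorial * (w + n)⁻¹ := by
  have hre : ∀ n : ℕ, -1 < (w + n - 1).re := fun n => by
    have : (0 : ℝ) ≤ n := by positivity
    simp; linarith
  have hnorm : ∀ n : ℕ, ∀ t ∈ Set.Ioc (0 : ℝ) 1,
      ‖(-P : ℂ) ^ n / n.factorial * (t : ℂ) ^ (w + n - 1)‖ =
        |P| ^ n / n.factorial * t ^ (w.re + n - 1) := by
    intro n t ht
    rw [norm_mul, norm_div, norm_pow, norm_neg, Complex.norm_real, Complex.norm_natCast,
      Real.norm_eq_abs, Complex.norm_cpow_eq_rpow_re_of_pos ht.1]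
    simp
  have h := integral_tsum_of_summable_integral_norm
    (μ := volume.restrict (Set.Ioc (0 : ℝ) 1))
    (F := fun (n : ℕ) (t : ℝ) => (-P : ℂ) ^ n / n.factorial * (t : ℂ) ^ (w + n - 1)) ?_ ?_
  · rw [show (∫ t in Set.Ioc (0 : ℝ) 1, (t : ℂ) ^ (w - 1) * Complex.exp (-(P * t))) =
      ∫ t in Set.Ioc (0 : ℝ) 1, ∑' n : ℕ,
        (-P : ℂ) ^ n / n.factorial * (t : ℂ) ^ (w + n - 1) from ?_, ← h]
    · refine tsum_congr fun n => ?_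
      rw [integral_const_mul, ← intervalIntegral.integral_of_le zero_le_one,
        integral_cpow (Or.inl (hre n))]
      have h0 : w + n - 1 + 1 = w + n := by ring
      have h1 : w + (n : ℂ) ≠ 0 := by
        intro h
        have h2 := congrArg Complex.re h
        have : (0 : ℝ) ≤ n := by positivity
        simp at h2; linarith
      rw [h0, Complex.ofReal_zero, Complex.zero_cpow h1]
      simp
    · refine setIntegral_congr_fun measurableSet_Ioc fun t ht => ?_
      have ht0 : (t : ℂ) ≠ 0 := Complex.ofReal_ne_zero.2 ht.1.ne'
      have hs := (hasSum_exp_complex (-(P * t))).mul_left ((t : ℂ) ^ (w - 1))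
      rw [← hs.tsum_eq]
      refine tsum_congr fun n => ?_
      rw [show w + (n : ℂ) - 1 = (w - 1) + n by ring, Complex.cpow_add _ _ ht0,
        Complex.cpow_natCast, ← neg_mul, mul_pow]
      ring
  · intro n
    refine Integrable.const_mul ?_ _
    exact (intervalIntegrable_iff_integrableOn_Ioc_of_le zero_le_one).1
      (intervalIntegral.intervalIntegrable_cpow' (hre n))
  · refine Summable.of_nonneg_of_le (fun n => integral_nonneg fun _ => norm_nonneg _) (fun n => ?_)
      ((Real.summable_pow_div_factorial |P|).mul_right w.re⁻¹)
    rw [setIntegral_congr_fun measurableSet_Ioc (hnorm n), integral_const_mul,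
      ← intervalIntegral.integral_of_le zero_le_one]
    have hn : (0 : ℝ) ≤ n := by positivity
    rw [integral_rpow (Or.inl (by linarith))]
    gcongr
    rw [Real.one_rpow, Real.zero_rpow (by linarith), sub_zero, one_div, sub_add_cancel]
    gcongr
    linarith

/-- The incomplete Gamma function as a series. -/
theorem integral_Ioi_one_cpow_mul_exp {P : ℝ} (hP : 0 < P) {w : ℂ} (hw : w.im ≠ 0) :
    ∫ t in Set.Ioi (1 : ℝ), (t : ℂ) ^ (w - 1) * Complex.exp (-(P * t)) =
      Complex.Gamma w * (P : ℂ) ^ (-w) - ∑' n : ℕ, (-P : ℂ) ^ n / n.factorial * (w + n)⁻¹ := by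
  have hP0 : (P : ℂ) ≠ 0 := Complex.ofReal_ne_zero.2 hP.ne'
  have hpos : ∀ w : ℂ, 0 < w.re →
      ∫ t in Set.Ioi (1 : ℝ), (t : ℂ) ^ (w - 1) * Complex.exp (-(P * t)) =
      Complex.Gamma w * (P : ℂ) ^ (-w) - ∑' n : ℕ, (-P : ℂ) ^ n / n.factorial * (w + n)⁻¹ := by
    intro w hw
    rw [← integral_Ioc_cpow_mul_exp P hw]
    have h := Complex.integral_cpow_mul_exp_neg_mul_Ioi hw hP
    have hP' : (1 / (P : ℂ)) ^ w = (P : ℂ) ^ (-w) := by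
      rw [one_div, Complex.inv_cpow, Complex.cpow_neg]
      rw [Complex.arg_ofReal_of_nonneg hP.le]; exact Real.pi_ne_zero.symm
    rw [hP', mul_comm] at h
    rw [← h, eq_sub_iff_add_eq, add_comm, ← setIntegral_union (Set.Ioc_disjoint_Ioi le_rfl)
      measurableSet_Ioi,
      Set.Ioc_union_Ioi_eq_Ioi zero_le_one]
    · refine (intervalIntegrable_iff_integrableOn_Ioc_of_le zero_le_one).1 ?_
      exact (intervalIntegral.intervalIntegrable_cpow' (by simpa using hw)).mul_continuousOn
        (by fun_prop)
    · exact integrableOn_Ioi_one_cpow_mul_exp hP w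
  have hind : ∀ k : ℕ, ∀ w : ℂ, w.im ≠ 0 → -(k : ℝ) < w.re →
      ∫ t in Set.Ioi (1 : ℝ), (t : ℂ) ^ (w - 1) * Complex.exp (-(P * t)) =
      Complex.Gamma w * (P : ℂ) ^ (-w) - ∑' n : ℕ, (-P : ℂ) ^ n / n.factorial * (w + n)⁻¹ := by
    intro k
    induction k with
    | zero => intro w _ h; exact hpos w (by simpa using h)
    | succ k ih =>
      intro w hw h
      have h1 := ih (w + 1) (by simpa using hw) (by push_cast at h; simp; linarith)
      have hw0 : w ≠ 0 := by simpa using add_natCast_ne_zero_of_im_ne_zero hw 0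
      have hrec := integral_Ioi_one_recurrence hP w
      rw [h1, Complex.Gamma_add_one w hw0, neg_add, Complex.cpow_add _ _ hP0,
        Complex.cpow_neg_one, mul_sub] at hrec
      have hs := summable_pow_div_factorial_mul_inv P hw
      have hsum : -((P : ℂ) * ∑' n : ℕ, (-P : ℂ) ^ n / n.factorial * (w + 1 + n)⁻¹) =
          Complex.exp (-P) - w * ∑' n : ℕ, (-P : ℂ) ^ n / n.factorial * (w + n)⁻¹ := by
        rw [← (hasSum_exp_complex (-P)).tsum_eq, ← tsum_mul_left, ← tsum_mul_left,
          ← (hasSum_exp_complex (-P)).summable.tsum_sub (hs.mul_left w), ← tsum_neg,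
          Summable.tsum_eq_zero_add ((hasSum_exp_complex (-P)).summable.sub (hs.mul_left w))]
        refine (fun a b c hb hc => by rw [hb, hc, zero_add] :
          ∀ a b c : ℂ, b = 0 → a = c → a = b + c) _ _ _ ?_ ?_
        · simp [hw0]
        · refine tsum_congr fun n => ?_
          have h2 := add_natCast_ne_zero_of_im_ne_zero hw (n + 1)
          have h3 : w + 1 + n = w + ((n + 1 : ℕ) : ℂ) := by push_cast; ring
          rw [h3, Nat.factorial_succ]
          have h4 : ((n.factorial : ℕ) : ℂ) ≠ 0 := by exact_mod_cast n.factorial_ne_zero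
          have h5 : ((n : ℂ) + 1) ≠ 0 := Nat.cast_add_one_ne_zero n
          push_cast at h2 ⊢
          field_simp
          ring
      have hP1 : (P : ℂ) * (w * Complex.Gamma w * ((P : ℂ) ^ (-w) * (P : ℂ)⁻¹)) =
          w * (Complex.Gamma w * (P : ℂ) ^ (-w)) := by
        field_simp
      rw [hP1] at hrec
      apply mul_left_cancel₀ hw0
      linear_combination -hrec + hsum
  obtain ⟨k, hk⟩ := exists_nat_gt (-w.re)
  exact hind k w hw (by linarith)

theorem sin_pi_mul_ne_zero_of_im_ne_zero {w : ℂ} (hw : w.im ≠ 0) :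
    Complex.sin (Real.pi * w) ≠ 0 := by
  rw [Complex.sin_ne_zero_iff]
  intro k hk
  have h := congrArg Complex.im hk
  simp [Real.pi_ne_zero, hw] at h

theorem summable_double_inv (P Q : ℝ) {w : ℂ} (hw : w.im ≠ 0) :
    Summable fun p : ℕ × ℕ => (-Q : ℂ) ^ p.1 / p.1.factorial *
      ((-P : ℂ) ^ p.2 / p.2.factorial * (w - p.1 + p.2)⁻¹) := by
  have h := (Real.summable_pow_div_factorial |Q|).mul_of_nonneg
    ((Real.summable_pow_div_factorial |P|).mul_right |w.im|⁻¹) (fun n => by positivity)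
    (fun n => by positivity)
  refine Summable.of_norm_bounded h fun p => ?_
  rw [norm_mul, norm_mul, norm_div, norm_div, norm_pow, norm_pow, norm_neg, norm_neg,
    Complex.norm_real, Complex.norm_real, Complex.norm_natCast, Complex.norm_natCast,
    Real.norm_eq_abs, Real.norm_eq_abs]
  gcongr
  have := norm_inv_add_natCast_le (w := w - p.1) (by simpa using hw) p.2
  simpa using this

theorem tsum_double_inv_antisymm (P Q : ℝ) {w : ℂ} (hw : w.im ≠ 0) :
    (∑' m : ℕ, (-Q : ℂ) ^ m / m.factorial *
      ∑' n : ℕ, (-P : ℂ) ^ n / n.factorial * (w - m + n)⁻¹) =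
    -∑' m : ℕ, (-P : ℂ) ^ m / m.factorial *
      ∑' n : ℕ, (-Q : ℂ) ^ n / n.factorial * (-w - m + n)⁻¹ := by
  simp_rw [← tsum_mul_left]
  rw [← Summable.tsum_comm (f := fun m n : ℕ => (-Q : ℂ) ^ m / m.factorial *
    ((-P : ℂ) ^ n / n.factorial * (w - m + n)⁻¹)) (summable_double_inv P Q hw), ← tsum_neg]
  refine tsum_congr fun m => ?_
  rw [← tsum_neg]
  refine tsum_congr fun n => ?_
  have : (-w - m + n) = -(w - n + m) := by ring
  rw [this, inv_neg]
  ring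

theorem integral_Ioi_one_expKernel {P Q : ℝ} (hP : 0 < P) (hQ : 0 < Q) {w : ℂ} (hw : w.im ≠ 0) :
    ∫ t in Set.Ioi (1 : ℝ), (t : ℂ) ^ (w - 1) * Complex.exp (-(P * t + Q / t)) =
      Real.pi / Complex.sin (Real.pi * w) * ((P : ℂ) ^ (-w) * besselSeries (-w) (P * Q)) -
      ∑' m : ℕ, (-Q : ℂ) ^ m / m.factorial *
        ∑' n : ℕ, (-P : ℂ) ^ n / n.factorial * (w - m + n)⁻¹ := by
  have hP0 : (P : ℂ) ≠ 0 := Complex.ofReal_ne_zero.2 hP.ne'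
  have hpi : (Real.pi : ℂ) ≠ 0 := by exact_mod_cast Real.pi_ne_zero
  have hsin := sin_pi_mul_ne_zero_of_im_ne_zero hw
  have hwm : ∀ m : ℕ, (w - m).im ≠ 0 := fun m => by simpa using hw
  have h_int : ∀ m : ℕ, IntegrableOn (fun t : ℝ => (-Q : ℂ) ^ m / m.factorial *
      ((t : ℂ) ^ (w - m - 1) * Complex.exp (-(P * t)))) (Set.Ioi 1) := fun m =>
    (integrableOn_Ioi_one_cpow_mul_exp hP (w - m)).const_mul _
  have h := integral_tsum_of_summable_integral_norm
    (μ := volume.restrict (Set.Ioi (1 : ℝ))) h_int ?_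
  · have e : ∫ t in Set.Ioi (1 : ℝ), (t : ℂ) ^ (w - 1) * Complex.exp (-(P * t + Q / t)) =
        ∫ t in Set.Ioi (1 : ℝ), ∑' m : ℕ, (-Q : ℂ) ^ m / m.factorial *
          ((t : ℂ) ^ (w - m - 1) * Complex.exp (-(P * t))) := by
      refine setIntegral_congr_fun measurableSet_Ioi fun t ht => ?_
      have ht0 : (t : ℂ) ≠ 0 := Complex.ofReal_ne_zero.2 (zero_lt_one.trans ht).ne'
      have hs := (hasSum_exp_complex (-(Q / t))).mul_left
        ((t : ℂ) ^ (w - 1) * Complex.exp (-(P * t)))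
      rw [neg_add, Complex.exp_add, ← mul_assoc, ← hs.tsum_eq]
      refine tsum_congr fun m => ?_
      rw [show w - (m : ℂ) - 1 = (w - 1) - m by ring, Complex.cpow_sub (w - 1) m ht0,
        Complex.cpow_natCast, ← neg_div, div_pow]
      ring
    rw [e, ← h]
    have hterm : ∀ m : ℕ, ∫ t in Set.Ioi (1 : ℝ), (-Q : ℂ) ^ m / m.factorial *
          ((t : ℂ) ^ (w - m - 1) * Complex.exp (-(P * t))) =
        Real.pi / Complex.sin (Real.pi * w) * ((P : ℂ) ^ (-w) *
          (((P : ℂ) * Q) ^ m * ((m.factorial : ℂ)⁻¹ * (Complex.Gamma (-w + m + 1))⁻¹))) -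
        (-Q : ℂ) ^ m / m.factorial *
          ∑' n : ℕ, (-P : ℂ) ^ n / n.factorial * (w - m + n)⁻¹ := by
      intro m
      rw [integral_const_mul, integral_Ioi_one_cpow_mul_exp hP (hwm m), mul_sub]
      congr 1
      have h1 := inv_Gamma_eq_sin (w - m) (sin_pi_mul_ne_zero_of_im_ne_zero (hwm m))
      have h2 := sin_pi_mul_add_int w (-m : ℤ)
      rw [show w + ((-m : ℤ) : ℂ) = w - m by push_cast; ring] at h2
      have h3 : ((-1 : ℂ) ^ (-m : ℤ)) = (-1) ^ m := by
        rw [zpow_neg, zpow_natCast, ← inv_pow]; norm_num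
      rw [show -w + (m : ℂ) + 1 = 1 - (w - m) by ring, h1, h2, h3, neg_pow (Q : ℂ),
        show -(w - (m : ℂ)) = -w + m by ring, Complex.cpow_add _ _ hP0, Complex.cpow_natCast,
        mul_pow]
      have hsin' := hsin
      rw [mul_comm] at hsin'
      field_simp
    simp_rw [hterm]
    rw [Summable.tsum_sub, tsum_mul_left, tsum_mul_left, besselSeries]
    · exact ((summable_besselSeries (-w) _).mul_left _).mul_left _
    · have := (summable_double_inv P Q hw).prod
      simpa only [tsum_mul_left] using this
  · have hi := (integrableOn_Ioi_one_cpow_mul_exp hP w).norm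
    refine Summable.of_nonneg_of_le (fun n => integral_nonneg fun _ => norm_nonneg _) (fun m => ?_)
      ((Real.summable_pow_div_factorial |Q|).mul_right
        (∫ t in Set.Ioi (1 : ℝ), ‖(t : ℂ) ^ (w - 1) * Complex.exp (-(P * t))‖))
    rw [← integral_const_mul]
    refine setIntegral_mono_on (h_int m).norm (hi.const_mul _) measurableSet_Ioi fun t ht => ?_
    have ht1 : 1 < t := ht
    have ht0 := zero_lt_one.trans ht1
    rw [norm_mul, norm_div, norm_pow, norm_neg, Complex.norm_real, Complex.norm_natCast,
      Real.norm_eq_abs, norm_mul, norm_mul, Complex.norm_cpow_eq_rpow_re_of_pos ht0,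
      Complex.norm_cpow_eq_rpow_re_of_pos ht0]
    gcongr 2
    refine Real.rpow_le_rpow_of_exponent_le ht1.le ?_
    simp

theorem integral_Ioc_inv {f : ℝ → ℂ} :
    ∫ t in Set.Ioc (0 : ℝ) 1, f t = ∫ t in Set.Ioi (1 : ℝ), ((t ^ (-2 : ℝ) : ℝ) : ℂ) * f t⁻¹ := by
  have h := integral_comp_rpow_Ioi ((Set.Ioo (0 : ℝ) 1).indicator f) (p := -1) (by norm_num)
  rw [setIntegral_indicator measurableSet_Ioo] at h
  rw [integral_Ioc_eq_integral_Ioo, show Set.Ioo (0 : ℝ) 1 = Set.Ioi 0 ∩ Set.Ioo 0 1 by ext; simp,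
    ← h, ← Set.inter_eq_right.2 (Set.Ioi_subset_Ioi (zero_le_one' ℝ)),
    ← setIntegral_indicator measurableSet_Ioi]
  refine setIntegral_congr_fun measurableSet_Ioi fun t ht => ?_
  have ht : 0 < t := ht
  simp only [Real.rpow_neg_one, abs_neg, abs_one, one_mul]
  norm_num
  by_cases h1 : 1 < t
  · rw [Set.indicator_of_mem, Set.indicator_of_mem (Set.mem_Ioi.2 h1)]
    exact ⟨inv_pos.2 ht, inv_lt_one_of_one_lt₀ h1⟩
  · rw [Set.indicator_of_notMem, Set.indicator_of_notMem (by simpa using h1)]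
    · simp
    · intro h2
      exact h1 ((inv_lt_one₀ ht).1 h2.2)

/-- The series expansion of `expKernel` (Macdonald's formula for the `K`-Bessel function). -/
theorem expKernel_eq {P Q : ℝ} (hP : 0 < P) (hQ : 0 < Q) {w : ℂ} (hw : w.im ≠ 0) :
    expKernel P Q w = Real.pi / Complex.sin (Real.pi * w) *
      ((P : ℂ) ^ (-w) * besselSeries (-w) (P * Q) - (Q : ℂ) ^ w * besselSeries w (P * Q)) := by
  have hi := integrableOn_expKernel (P := P) (Q := Q) (by simpa) (by simpa) w
  rw [expKernel, ← Set.Ioc_union_Ioi_eq_Ioi (zero_le_one' ℝ),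
    setIntegral_union (Set.Ioc_disjoint_Ioi le_rfl) measurableSet_Ioi
      (hi.mono_set Set.Ioc_subset_Ioi_self) (hi.mono_set (Set.Ioi_subset_Ioi zero_le_one)),
    integral_Ioc_inv, integral_Ioi_one_expKernel hP hQ hw]
  have e : ∫ t in Set.Ioi (1 : ℝ), ((t ^ (-2 : ℝ) : ℝ) : ℂ) *
      (((t⁻¹ : ℝ) : ℂ) ^ (w - 1) * Complex.exp (-(P * ((t⁻¹ : ℝ) : ℂ) + Q / ((t⁻¹ : ℝ) : ℂ)))) =
      ∫ t in Set.Ioi (1 : ℝ), (t : ℂ) ^ (-w - 1) * Complex.exp (-(Q * t + P / t)) := by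
    refine setIntegral_congr_fun measurableSet_Ioi fun t ht => ?_
    have ht0 : 0 < t := zero_lt_one.trans ht
    have ht' : (t : ℂ) ≠ 0 := Complex.ofReal_ne_zero.2 ht0.ne'
    rw [Complex.ofReal_cpow ht0.le, Complex.ofReal_inv, Complex.inv_cpow, ← Complex.cpow_neg,
      ← mul_assoc, ← Complex.cpow_add _ _ ht']
    · congr 2
      · push_cast; ring
      · rw [div_inv_eq_mul, div_eq_mul_inv]; ring
    · rw [Complex.arg_ofReal_of_nonneg ht0.le]; exact Real.pi_ne_zero.symm
  rw [e, integral_Ioi_one_expKernel hQ hP (w := -w) (by simpa using hw),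
    tsum_double_inv_antisymm P Q hw, neg_neg, mul_neg, Complex.sin_neg, div_neg, mul_comm (Q : ℂ) P]
  ring

theorem exists_integral_pow_mul_exp_le {z : ℝ} (hz : 0 < z) :
    ∃ K : ℝ, 0 ≤ K ∧ ∀ l : ℕ, ∫ t in Set.Ioi (0 : ℝ), t ^ ((l : ℝ) - 1) *
      Real.exp (-(z * t + z / t)) ≤ K * (l.factorial / ((l + 1) * z ^ l)) := by
  set K₀ := ∫ t in Set.Ioi (0 : ℝ), t ^ (((0 : ℕ) : ℝ) - 1) * Real.exp (-(z * t + z / t)) with hK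
  have h0 : 0 ≤ K₀ := setIntegral_nonneg measurableSet_Ioi fun t ht => by
    have : (0 : ℝ) < t := ht
    positivity
  refine ⟨K₀ + 2, by positivity, fun l => ?_⟩
  rcases Nat.eq_zero_or_pos l with rfl | hl
  · rw [← hK]; simp
  · have hl' : (0 : ℝ) < l := by exact_mod_cast hl
    have h1 : ∫ t in Set.Ioi (0 : ℝ), t ^ ((l : ℝ) - 1) * Real.exp (-(z * t + z / t)) ≤
        ∫ t in Set.Ioi (0 : ℝ), t ^ ((l : ℝ) - 1) * Real.exp (-(z * t)) := by
      have hi := integrableOn_rpow_mul_exp_neg_mul_rpow (p := 1) (s := (l : ℝ) - 1) (b := z)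
        (by linarith) one_pos hz
      simp only [Real.rpow_one] at hi
      refine setIntegral_mono_on (integrableOn_expKernel_real hz hz l)
        (by simpa only [neg_mul] using hi) measurableSet_Ioi fun t ht => ?_
      have ht : (0 : ℝ) < t := ht
      gcongr
      have : 0 < z / t := by positivity
      linarith
    rw [Real.integral_rpow_mul_exp_neg_mul_Ioi hl' hz] at h1
    obtain ⟨k, rfl⟩ : ∃ k, l = k + 1 := ⟨l - 1, by omega⟩
    refine h1.trans ?_
    rw [show (((k + 1 : ℕ) : ℝ)) = (k : ℝ) + 1 by push_cast; ring, Real.Gamma_nat_eq_factorial,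
      ← Nat.cast_add_one, Real.rpow_natCast, Nat.factorial_succ]
    have hk : (1 : ℝ) ≤ (K₀ + 2) * ((k + 1) / (k + 2)) := by
      have : (1 : ℝ) ≤ 2 * ((k + 1) / (k + 2)) := by
        rw [← mul_div_assoc, le_div_iff₀ (by positivity)]; linarith
      have h2 : 0 ≤ K₀ * (((k : ℝ) + 1) / (k + 2)) := by positivity
      linarith
    calc (1 / z) ^ (k + 1) * (k.factorial : ℝ) ≤
        ((K₀ + 2) * ((k + 1) / (k + 2))) * ((1 / z) ^ (k + 1) * (k.factorial : ℝ)) :=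
          le_mul_of_one_le_left (by positivity) hk
      _ = _ := by
        push_cast
        rw [one_div, inv_pow]
        field_simp
        ring

theorem expKernel_symm {P Q : ℝ} (hP : 0 < P) (hQ : 0 < Q) {w : ℂ} (hw : w.im ≠ 0) :
    expKernel P Q w = expKernel Q P (-w) := by
  rw [expKernel_eq hP hQ hw, expKernel_eq hQ hP (w := -w) (by simpa using hw), neg_neg,
    mul_neg, Complex.sin_neg, mul_comm (Q : ℂ) P, div_neg]
  ring

theorem expKernel_mul_sqrt {z p : ℝ} (hz : 0 < z) (hp : 0 < p) {w : ℂ} (hw : w.im ≠ 0) :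
    expKernel ((z * √p : ℝ) : ℂ) ((z * √p : ℝ) : ℂ) w =
      (p : ℂ) ^ (w / 2) * expKernel ((z * p : ℝ) : ℂ) z w := by
  have hs : 0 < √p := Real.sqrt_pos.2 hp
  have hp0 : (p : ℂ) ≠ 0 := Complex.ofReal_ne_zero.2 hp.ne'
  have hsp : ∀ s : ℂ, ((√p : ℝ) : ℂ) ^ s = (p : ℂ) ^ (s / 2) := fun s => by
    rw [Complex.cpow_def_of_ne_zero (Complex.ofReal_ne_zero.2 hs.ne'),
      Complex.cpow_def_of_ne_zero hp0, ← Complex.ofReal_log hs.le, ← Complex.ofReal_log hp.le,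
      Real.log_sqrt hp.le]
    push_cast
    congr 1; ring
  rw [expKernel_eq (by positivity) (by positivity) hw, expKernel_eq (by positivity) hz hw]
  have e : ((z * √p : ℝ) : ℂ) * ((z * √p : ℝ) : ℂ) = ((z * p : ℝ) : ℂ) * z := by
    norm_cast
    rw [mul_mul_mul_comm, Real.mul_self_sqrt hp.le]; ring
  rw [e]
  have h1 : ((z * √p : ℝ) : ℂ) ^ (-w) = (p : ℂ) ^ (w / 2) * ((z * p : ℝ) : ℂ) ^ (-w) := by
    rw [Complex.ofReal_mul, Complex.mul_cpow_ofReal_nonneg hz.le hs.le, hsp, Complex.ofReal_mul,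
      Complex.mul_cpow_ofReal_nonneg hz.le hp.le, mul_left_comm, ← Complex.cpow_add _ _ hp0]
    congr 2; ring
  have h2 : ((z * √p : ℝ) : ℂ) ^ w = (p : ℂ) ^ (w / 2) * (z : ℂ) ^ w := by
    rw [Complex.ofReal_mul, Complex.mul_cpow_ofReal_nonneg hz.le hs.le, hsp, mul_comm]
  rw [h1, h2]
  ring

/-- The series `∑ l, (z₁ z₂)^l / (l! Γ(w+l+1)) · 2K_{a+l}(2z₁) · 2K_{b+l}(2z₂)`. -/
noncomputable def kernelSum (z₁ z₂ : ℝ) (w a b : ℂ) : ℂ :=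
  ∑' l : ℕ, ((z₁ * z₂ : ℂ) ^ l * ((l.factorial : ℂ)⁻¹ * (Complex.Gamma (w + l + 1))⁻¹)) *
    (expKernel z₁ z₁ (a + l) * expKernel z₂ z₂ (b + l))

/-- The general term of `kernelSum` with the integrals written out. -/
noncomputable def kernelTerm (z₁ z₂ : ℝ) (w a b : ℂ) (l : ℕ) (p : ℝ × ℝ) : ℂ :=
  ((z₁ * z₂ : ℂ) ^ l * ((l.factorial : ℂ)⁻¹ * (Complex.Gamma (w + l + 1))⁻¹)) *
    (((p.1 : ℂ) ^ (a + l - 1) * Complex.exp (-(z₁ * p.1 + z₁ / p.1))) *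
      ((p.2 : ℂ) ^ (b + l - 1) * Complex.exp (-(z₂ * p.2 + z₂ / p.2))))

theorem integrable_kernelTerm {z₁ z₂ : ℝ} (hz₁ : 0 < z₁) (hz₂ : 0 < z₂) (w a b : ℂ) (l : ℕ) :
    Integrable (kernelTerm z₁ z₂ w a b l)
      ((volume.restrict (Set.Ioi (0 : ℝ))).prod (volume.restrict (Set.Ioi (0 : ℝ)))) :=
  (Integrable.mul_prod (integrableOn_expKernel (by simpa) (by simpa) (a + l))
    (integrableOn_expKernel (by simpa) (by simpa) (b + l))).const_mul _

theorem integral_kernelTerm (z₁ z₂ : ℝ) (w a b : ℂ) (l : ℕ) :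
    ∫ p, kernelTerm z₁ z₂ w a b l p ∂((volume.restrict (Set.Ioi (0 : ℝ))).prod
      (volume.restrict (Set.Ioi (0 : ℝ)))) =
    ((z₁ * z₂ : ℂ) ^ l * ((l.factorial : ℂ)⁻¹ * (Complex.Gamma (w + l + 1))⁻¹)) *
      (expKernel z₁ z₁ (a + l) * expKernel z₂ z₂ (b + l)) := by
  simp only [kernelTerm]
  rw [integral_const_mul, integral_prod_mul
    (fun x : ℝ => (x : ℂ) ^ (a + l - 1) * Complex.exp (-(z₁ * x + z₁ / x)))
    (fun x : ℝ => (x : ℂ) ^ (b + l - 1) * Complex.exp (-(z₂ * x + z₂ / x)))]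
  rfl

theorem summable_integral_norm_kernelTerm {z₁ z₂ : ℝ} (hz₁ : 0 < z₁) (hz₂ : 0 < z₂) {w a b : ℂ}
    (hw : w.re = 0) (ha : a.re = 0) (hb : b.re = 0) :
    Summable fun l : ℕ => ∫ p, ‖kernelTerm z₁ z₂ w a b l p‖
      ∂((volume.restrict (Set.Ioi (0 : ℝ))).prod (volume.restrict (Set.Ioi (0 : ℝ)))) := by
  obtain ⟨K₁, hK₁0, hK₁⟩ := exists_integral_pow_mul_exp_le hz₁
  obtain ⟨K₂, hK₂0, hK₂⟩ := exists_integral_pow_mul_exp_le hz₂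
  have hs : Summable fun l : ℕ => K₁ * K₂ * ‖(Complex.Gamma (w + 1))⁻¹‖ *
      (1 / ((l + 1 : ℕ) : ℝ) ^ 2) :=
    ((summable_nat_add_iff 1).2 (Real.summable_one_div_nat_pow.2 one_lt_two)).mul_left _
  refine Summable.of_nonneg_of_le (fun l => integral_nonneg fun _ => norm_nonneg _)
    (fun l => ?_) hs
  simp only [kernelTerm, norm_mul]
  rw [integral_const_mul, integral_prod_mul (L := ℝ)
    (fun x : ℝ => ‖(x : ℂ) ^ (a + l - 1)‖ * ‖Complex.exp (-(z₁ * x + z₁ / x))‖)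
    (fun x : ℝ => ‖(x : ℂ) ^ (b + l - 1)‖ * ‖Complex.exp (-(z₂ * x + z₂ / x))‖)]
  have key : ∀ (z : ℝ) (a : ℂ), a.re = 0 → ∫ x in Set.Ioi (0 : ℝ), ‖(x : ℂ) ^ (a + l - 1)‖ *
      ‖Complex.exp (-(z * x + z / x))‖ =
      ∫ t in Set.Ioi (0 : ℝ), t ^ ((l : ℝ) - 1) * Real.exp (-(z * t + z / t)) := by
    intro z a ha
    refine setIntegral_congr_fun measurableSet_Ioi fun t ht => ?_
    have ht : (0 : ℝ) < t := ht
    rw [← norm_mul, norm_expKernel_integrand ht]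
    simp [ha]
  have hnn : ∀ z : ℝ, 0 < z →
      0 ≤ ∫ t in Set.Ioi (0 : ℝ), t ^ ((l : ℝ) - 1) * Real.exp (-(z * t + z / t)) := fun z hz =>
    setIntegral_nonneg measurableSet_Ioi fun t ht => by
      have : (0 : ℝ) < t := ht
      positivity
  rw [key z₁ a ha, key z₂ b hb]
  have hG := norm_inv_Gamma_add_nat_le hw l
  rw [norm_pow, norm_mul, Complex.norm_real, Complex.norm_real, norm_inv (l.factorial : ℂ),
    Complex.norm_natCast, Real.norm_of_nonneg hz₁.le, Real.norm_of_nonneg hz₂.le]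
  calc _ ≤ ((z₁ * z₂) ^ l * ((l.factorial : ℝ)⁻¹ * (‖(Complex.Gamma (w + 1))⁻¹‖ / l.factorial))) *
        ((K₁ * (l.factorial / ((l + 1) * z₁ ^ l))) *
          (K₂ * (l.factorial / ((l + 1) * z₂ ^ l)))) := by
        gcongr
        · exact mul_nonneg (hnn z₁ hz₁) (hnn z₂ hz₂)
        · exact hnn z₂ hz₂
        · exact hK₁ l
        · exact hK₂ l
    _ = _ := by
      have := Nat.factorial_ne_zero l
      rw [mul_pow]
      push_cast
      field_simp

theorem tsum_kernelTerm {z₁ z₂ : ℝ} (w a b : ℂ) {p : ℝ × ℝ} (hp₁ : 0 < p.1) (hp₂ : 0 < p.2) :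
    HasSum (fun l => kernelTerm z₁ z₂ w a b l p)
      ((((p.1 : ℂ) ^ (a - 1) * Complex.exp (-(z₁ * p.1 + z₁ / p.1))) *
        ((p.2 : ℂ) ^ (b - 1) * Complex.exp (-(z₂ * p.2 + z₂ / p.2)))) *
        besselSeries w ((z₁ * p.1) * (z₂ * p.2))) := by
  have h1 : (p.1 : ℂ) ≠ 0 := Complex.ofReal_ne_zero.2 hp₁.ne'
  have h2 : (p.2 : ℂ) ≠ 0 := Complex.ofReal_ne_zero.2 hp₂.ne'
  refine ((summable_besselSeries w _).hasSum.mul_left _).congr_fun fun l => ?_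
  rw [kernelTerm, show a + l - 1 = (a - 1) + l by ring, show b + l - 1 = (b - 1) + l by ring,
    Complex.cpow_add _ _ h1, Complex.cpow_add _ _ h2, Complex.cpow_natCast, Complex.cpow_natCast]
  simp only [mul_pow]
  ring

theorem exp_neg_le_max_div {a v : ℝ} (ha : 0 < a) (hv : 0 < v) :
    Real.exp (-(a * v)) ≤ (1 + 1 / a) / (1 + v) := by
  have h : a * v + 1 ≤ Real.exp (a * v) := Real.add_one_le_exp _
  rw [Real.exp_neg, inv_le_comm₀ (Real.exp_pos _) (by positivity), inv_div]
  refine le_trans ?_ h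
  rw [div_le_iff₀ (by positivity)]
  have : (a * v + 1) * (1 + 1 / a) = a * v + 1 + v + 1 / a := by field_simp; ring
  rw [this]
  have : 0 < 1 / a := by positivity
  have : 0 < a * v := by positivity
  linarith

/-- The triple integrand whose two iterated integrals are compared. -/
noncomputable def tripleIntegrand (z₁ z₂ : ℝ) (w ν : ℂ) (v : ℝ) (p : ℝ × ℝ) : ℂ :=
  (v : ℂ) ^ (w - 1) *
    (((p.1 : ℂ) ^ (ν - 1) * Complex.exp (-((z₁ * (1 + v) : ℝ) * p.1 + z₁ / p.1))) *
      ((p.2 : ℂ) ^ (-ν - 1) * Complex.exp (-((z₂ * (1 + 1 / v) : ℝ) * p.2 + z₂ / p.2))))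

theorem integrable_tripleIntegrand {z₁ z₂ : ℝ} (hz₁ : 0 < z₁) (hz₂ : 0 < z₂) {w ν : ℂ}
    (hw : w.re = 0) (hν : ν.re = 0) :
    Integrable (Function.uncurry (tripleIntegrand z₁ z₂ w ν))
      ((volume.restrict (Set.Ioi (0 : ℝ))).prod
        ((volume.restrict (Set.Ioi (0 : ℝ))).prod (volume.restrict (Set.Ioi (0 : ℝ))))) := by
  have hg : Integrable (fun v : ℝ => (v + 1) ^ (-2 : ℝ)) (volume.restrict (Set.Ioi (0 : ℝ))) :=
    integrableOn_add_rpow_Ioi_of_lt (m := 1) (c := 0) (by norm_num) (by norm_num)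
  have hh : ∀ z : ℝ, 0 < z → Integrable (fun t : ℝ => (1 + 1 / (z * t)) *
      (t ^ ((0 : ℝ) - 1) * Real.exp (-(z * t + z / t)))) (volume.restrict (Set.Ioi (0 : ℝ))) := by
    intro z hz
    have := (integrableOn_expKernel_real hz hz 0).add
      ((integrableOn_expKernel_real hz hz (-1)).const_mul (1 / z))
    refine this.congr_fun (fun t ht => ?_) measurableSet_Ioi
    have ht : (0 : ℝ) < t := ht
    have e : t ^ ((-1 : ℝ) - 1) = t ^ ((0 : ℝ) - 1) / t := by
      rw [Real.rpow_sub_one ht.ne', zero_sub]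
    simp only [Pi.add_apply, e]
    field_simp
  refine Integrable.mono' (hg.mul_prod ((hh z₁ hz₁).mul_prod (hh z₂ hz₂))) ?_ ?_
  · refine Measurable.aestronglyMeasurable ?_
    unfold tripleIntegrand Function.uncurry
    fun_prop
  · rw [Measure.prod_restrict, Measure.prod_restrict]
    refine (ae_restrict_iff' (measurableSet_Ioi.prod
      (measurableSet_Ioi.prod measurableSet_Ioi))).2 (Filter.Eventually.of_forall ?_)
    rintro ⟨v, σ, ρ⟩ ⟨hv, hσ, hρ⟩
    have hv : 0 < v := hv
    have hσ : 0 < σ := hσ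
    have hρ : 0 < ρ := hρ
    simp only [Function.uncurry, tripleIntegrand]
    rw [norm_mul, norm_mul, norm_expKernel_integrand hσ, norm_expKernel_integrand hρ,
      Complex.norm_cpow_eq_rpow_re_of_pos hv]
    have e₁ := exp_neg_le_max_div (a := z₁ * σ) (by positivity) hv
    have e₂ := exp_neg_le_max_div (a := z₂ * ρ) (by positivity) (inv_pos.2 hv)
    have s₁ : Real.exp (-((((z₁ * (1 + v) : ℝ) : ℂ)).re * σ + (z₁ : ℂ).re / σ)) =
        Real.exp (-(z₁ * σ + z₁ / σ)) * Real.exp (-(z₁ * σ * v)) := by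
      rw [← Real.exp_add, Complex.ofReal_re, Complex.ofReal_re]
      congr 1; ring
    have s₂ : Real.exp (-((((z₂ * (1 + 1 / v) : ℝ) : ℂ)).re * ρ + (z₂ : ℂ).re / ρ)) =
        Real.exp (-(z₂ * ρ + z₂ / ρ)) * Real.exp (-(z₂ * ρ * v⁻¹)) := by
      rw [← Real.exp_add, Complex.ofReal_re, Complex.ofReal_re]
      congr 1; ring
    have r0 : ∀ s : ℂ, s.re = 0 → (s - 1).re = 0 - 1 := fun s hs => by simp [hs]
    rw [s₁, s₂]
    simp only [Complex.sub_re, Complex.neg_re, Complex.one_re, hw, hν, neg_zero]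
    calc v ^ ((0 : ℝ) - 1) *
          (σ ^ ((0 : ℝ) - 1) * (Real.exp (-(z₁ * σ + z₁ / σ)) * Real.exp (-(z₁ * σ * v))) *
          (ρ ^ ((0 : ℝ) - 1) * (Real.exp (-(z₂ * ρ + z₂ / ρ)) * Real.exp (-(z₂ * ρ * v⁻¹))))) ≤
        v ^ ((0 : ℝ) - 1) *
          (σ ^ ((0 : ℝ) - 1) * (Real.exp (-(z₁ * σ + z₁ / σ)) *
            ((1 + 1 / (z₁ * σ)) / (1 + v))) *
          (ρ ^ ((0 : ℝ) - 1) * (Real.exp (-(z₂ * ρ + z₂ / ρ)) *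
            ((1 + 1 / (z₂ * ρ)) / (1 + v⁻¹))))) := by gcongr
      _ = (v ^ ((0 : ℝ) - 1) * (1 / ((1 + v) * (1 + v⁻¹)))) *
        ((1 + 1 / (z₁ * σ)) * (σ ^ ((0 : ℝ) - 1) * Real.exp (-(z₁ * σ + z₁ / σ))) *
        ((1 + 1 / (z₂ * ρ)) * (ρ ^ ((0 : ℝ) - 1) * Real.exp (-(z₂ * ρ + z₂ / ρ))))) := by
          simp only [div_eq_mul_inv, mul_inv]; ring
      _ = _ := by
        congr 1
        rw [zero_sub, Real.rpow_neg_one, Real.rpow_neg (by positivity), Real.rpow_two]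
        field_simp
        ring

/-- Fubini for `tripleIntegrand`. -/
theorem integral_cpow_mul_expKernel_mul_expKernel {z₁ z₂ : ℝ} (hz₁ : 0 < z₁) (hz₂ : 0 < z₂)
    {w ν : ℂ} (hw : w.re = 0) (hw' : w.im ≠ 0) (hν : ν.re = 0) :
    ∫ v in Set.Ioi (0 : ℝ), (v : ℂ) ^ (w - 1) *
      (expKernel ((z₁ * (1 + v) : ℝ) : ℂ) z₁ ν * expKernel ((z₂ * (1 + 1 / v) : ℝ) : ℂ) z₂ (-ν)) =
    Real.pi / Complex.sin (Real.pi * w) *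
      ((z₁ : ℂ) ^ (-w) * kernelSum z₁ z₂ (-w) (ν - w) (-ν) -
        (z₂ : ℂ) ^ w * kernelSum z₁ z₂ w ν (w - ν)) := by
  set m := volume.restrict (Set.Ioi (0 : ℝ)) with hm
  have hF := integrable_tripleIntegrand hz₁ hz₂ hw hν
  have hmm : ∀ {Q : ℝ × ℝ → Prop}, (∀ p : ℝ × ℝ, 0 < p.1 → 0 < p.2 → Q p) →
      ∀ᵐ p ∂m.prod m, Q p := by
    intro Q hQ
    rw [hm, Measure.prod_restrict]
    exact (ae_restrict_iff' (measurableSet_Ioi.prod measurableSet_Ioi)).2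
      (Filter.Eventually.of_forall fun p hp => hQ p hp.1 hp.2)
  have h := integral_integral_swap hF
  have e1 : ∀ v : ℝ, ∫ p, tripleIntegrand z₁ z₂ w ν v p ∂m.prod m = (v : ℂ) ^ (w - 1) *
      (expKernel ((z₁ * (1 + v) : ℝ) : ℂ) z₁ ν *
        expKernel ((z₂ * (1 + 1 / v) : ℝ) : ℂ) z₂ (-ν)) := by
    intro v
    simp only [tripleIntegrand]
    rw [integral_const_mul, integral_prod_mul
      (fun x : ℝ => (x : ℂ) ^ (ν - 1) * Complex.exp (-((z₁ * (1 + v) : ℝ) * x + z₁ / x)))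
      (fun x : ℝ => (x : ℂ) ^ (-ν - 1) * Complex.exp (-((z₂ * (1 + 1 / v) : ℝ) * x + z₂ / x)))]
    rfl
  rw [← hm] at h
  simp only [e1] at h
  rw [h]
  set c : ℂ := Real.pi / Complex.sin (Real.pi * w)
  have hs₁ := summable_integral_norm_kernelTerm hz₁ hz₂ (w := -w) (a := ν - w) (b := -ν)
    (by simp [hw]) (by simp [hw, hν]) (by simp [hν])
  have hs₂ := summable_integral_norm_kernelTerm hz₁ hz₂ (w := w) (a := ν) (b := w - ν)
    hw hν (by simp [hw, hν])
  have hi₁ := integrable_kernelTerm hz₁ hz₂ (-w) (ν - w) (-ν)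
  have hi₂ := integrable_kernelTerm hz₁ hz₂ w ν (w - ν)
  have e2 : ∀ᵐ p ∂m.prod m, ∫ v in Set.Ioi (0 : ℝ), tripleIntegrand z₁ z₂ w ν v p =
      ∑' l, c * ((z₁ : ℂ) ^ (-w) * kernelTerm z₁ z₂ (-w) (ν - w) (-ν) l p -
        (z₂ : ℂ) ^ w * kernelTerm z₁ z₂ w ν (w - ν) l p) := by
    refine hmm fun p hp₁ hp₂ => ?_
    have h1 : (p.1 : ℂ) ≠ 0 := Complex.ofReal_ne_zero.2 hp₁.ne'
    have h2 : (p.2 : ℂ) ≠ 0 := Complex.ofReal_ne_zero.2 hp₂.ne'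
    have hk := expKernel_eq (P := z₁ * p.1) (Q := z₂ * p.2) (by positivity) (by positivity) hw'
    have t1 := tsum_kernelTerm (z₁ := z₁) (z₂ := z₂) (-w) (ν - w) (-ν) hp₁ hp₂
    have t2 := tsum_kernelTerm (z₁ := z₁) (z₂ := z₂) w ν (w - ν) hp₁ hp₂
    rw [(((t1.mul_left _).sub (t2.mul_left _)).mul_left c).tsum_eq]
    have e3 : ∫ v in Set.Ioi (0 : ℝ), tripleIntegrand z₁ z₂ w ν v p =
        (((p.1 : ℂ) ^ (ν - 1) * Complex.exp (-(z₁ * p.1 + z₁ / p.1))) *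
        ((p.2 : ℂ) ^ (-ν - 1) * Complex.exp (-(z₂ * p.2 + z₂ / p.2)))) *
        expKernel ((z₁ * p.1 : ℝ) : ℂ) ((z₂ * p.2 : ℝ) : ℂ) w := by
      rw [expKernel, ← integral_const_mul]
      refine setIntegral_congr_fun measurableSet_Ioi fun v hv => ?_
      have hE : Complex.exp (-((z₁ * (1 + v) : ℝ) * p.1 + z₁ / p.1)) *
          Complex.exp (-((z₂ * (1 + 1 / v) : ℝ) * p.2 + z₂ / p.2)) =
          Complex.exp (-(z₁ * p.1 + z₁ / p.1)) * Complex.exp (-(z₂ * p.2 + z₂ / p.2)) *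
          Complex.exp (-((z₁ * p.1 : ℝ) * v + (z₂ * p.2 : ℝ) / v)) := by
        rw [← Complex.exp_add, ← Complex.exp_add, ← Complex.exp_add]
        congr 1
        push_cast
        ring
      rw [tripleIntegrand]
      linear_combination (v : ℂ) ^ (w - 1) * (p.1 : ℂ) ^ (ν - 1) * (p.2 : ℂ) ^ (-ν - 1) * hE
    rw [e3, hk]
    push_cast
    rw [Complex.mul_cpow_ofReal_nonneg hz₁.le hp₁.le, Complex.mul_cpow_ofReal_nonneg hz₂.le hp₂.le,
      show ν - w - 1 = (ν - 1) + -w by ring, show w - ν - 1 = (-ν - 1) + w by ring,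
      Complex.cpow_add _ _ h1, Complex.cpow_add _ _ h2]
    ring
  have hi : ∀ l, Integrable (fun p =>
      c * ((z₁ : ℂ) ^ (-w) * kernelTerm z₁ z₂ (-w) (ν - w) (-ν) l p -
      (z₂ : ℂ) ^ w * kernelTerm z₁ z₂ w ν (w - ν) l p)) (m.prod m) := fun l =>
    (((hi₁ l).const_mul _).sub ((hi₂ l).const_mul _)).const_mul c
  rw [integral_congr_ae e2, ← (hasSum_integral_of_summable_integral_norm hi ?_).tsum_eq]
  · simp_rw [integral_const_mul]
    rw [tsum_mul_left]
    congr 1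
    have e4 : ∀ l, ∫ p, ((z₁ : ℂ) ^ (-w) * kernelTerm z₁ z₂ (-w) (ν - w) (-ν) l p -
        (z₂ : ℂ) ^ w * kernelTerm z₁ z₂ w ν (w - ν) l p) ∂m.prod m =
        (z₁ : ℂ) ^ (-w) * (∫ p, kernelTerm z₁ z₂ (-w) (ν - w) (-ν) l p ∂m.prod m) -
        (z₂ : ℂ) ^ w * ∫ p, kernelTerm z₁ z₂ w ν (w - ν) l p ∂m.prod m := fun l => by
      rw [integral_sub ((hi₁ l).const_mul _) ((hi₂ l).const_mul _), integral_const_mul,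
        integral_const_mul]
    simp_rw [e4]
    have g₁ : Summable fun l => ∫ p, kernelTerm z₁ z₂ (-w) (ν - w) (-ν) l p ∂m.prod m :=
      Summable.of_norm_bounded hs₁ fun l => norm_integral_le_integral_norm _
    have g₂ : Summable fun l => ∫ p, kernelTerm z₁ z₂ w ν (w - ν) l p ∂m.prod m :=
      Summable.of_norm_bounded hs₂ fun l => norm_integral_le_integral_norm _
    rw [(g₁.mul_left _).tsum_sub (g₂.mul_left _), tsum_mul_left, tsum_mul_left]
    simp only [kernelSum, hm, integral_kernelTerm]
  · refine Summable.of_nonneg_of_le (fun l => integral_nonneg fun _ => norm_nonneg _) (fun l => ?_)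
      (((hs₁.mul_left ‖(z₁ : ℂ) ^ (-w)‖).add (hs₂.mul_left ‖(z₂ : ℂ) ^ w‖)).mul_left ‖c‖)
    rw [← integral_const_mul, ← integral_const_mul, ← integral_add, ← integral_const_mul]
    · refine integral_mono (hi l).norm
        ((((hi₁ l).norm.const_mul _).add ((hi₂ l).norm.const_mul _)).const_mul ‖c‖) fun p => ?_
      simp only [norm_mul]
      gcongr
      refine (norm_sub_le _ _).trans ?_
      rw [norm_mul, norm_mul]
    · exact (hi₁ l).norm.const_mul _
    · exact (hi₂ l).norm.const_mul _

/-- The double hypergeometric series underlying `Jwl`. -/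
noncomputable def dblSeries (p q A B : ℂ) : ℂ :=
  ∑' n : ℕ × ℕ, Complex.Gamma (n.1 + n.2 + p + q + 1) * A ^ n.1 * B ^ n.2 *
    ((n.1.factorial : ℂ)⁻¹ * (Complex.Gamma (q + n.1 + 1))⁻¹ *
      (Complex.Gamma (p + q + n.1 + 1))⁻¹) *
    ((n.2.factorial : ℂ)⁻¹ * (Complex.Gamma (p + n.2 + 1))⁻¹ * (Complex.Gamma (p + q + n.2 + 1))⁻¹)

theorem dblSeries_swap (p q A B : ℂ) : dblSeries p q A B = dblSeries q p B A := by
  rw [dblSeries, dblSeries, ← (Equiv.prodComm ℕ ℕ).tsum_eq]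
  refine tsum_congr fun n => ?_
  simp only [Equiv.prodComm_apply, Prod.fst_swap, Prod.snd_swap]
  rw [add_comm q p, show (n.2 + n.1 + p + q + 1 : ℂ) = n.1 + n.2 + q + p + 1 by ring]
  ring

theorem norm_inv_natCast_Gamma_sub_le (N l : ℕ) :
    ‖(Complex.Gamma (N - l + 1))⁻¹‖ ≤ 1 := by
  rcases le_or_gt l N with h | h
  · obtain ⟨k, rfl⟩ := Nat.exists_eq_add_of_le h
    rw [show ((l + k : ℕ) : ℂ) - l + 1 = k + 1 by push_cast; ring, Complex.Gamma_nat_eq_factorial,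
      norm_inv, Complex.norm_natCast]
    exact inv_le_one_of_one_le₀ (by exact_mod_cast Nat.factorial_pos k)
  · obtain ⟨k, rfl⟩ := Nat.exists_eq_add_of_lt h
    rw [show (N : ℂ) - ((N + k + 1 : ℕ) : ℂ) + 1 = -(k : ℂ) by push_cast; ring,
      Complex.Gamma_neg_nat_eq_zero]
    simp

theorem pow_mul_besselSeries_add_natCast (a A : ℂ) (l : ℕ) :
    HasSum (fun N : ℕ => A ^ N * ((Complex.Gamma (N - l + 1))⁻¹ * (Complex.Gamma (a + N + 1))⁻¹))
      (A ^ l * besselSeries (a + l) A) := by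
  rw [← hasSum_nat_add_iff' l]
  have h0 : ∑ N ∈ Finset.range l, A ^ N * ((Complex.Gamma (N - l + 1))⁻¹ *
      (Complex.Gamma (a + N + 1))⁻¹) = 0 := by
    refine Finset.sum_eq_zero fun N hN => ?_
    obtain ⟨k, rfl⟩ := Nat.exists_eq_add_of_lt (Finset.mem_range.1 hN)
    rw [show (N : ℂ) - ((N + k + 1 : ℕ) : ℂ) + 1 = -(k : ℂ) by push_cast; ring,
      Complex.Gamma_neg_nat_eq_zero]
    simp
  rw [h0, sub_zero]
  refine ((summable_besselSeries (a + l) A).hasSum.mul_left (A ^ l)).congr_fun fun k => ?_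
  rw [show ((k + l : ℕ) : ℂ) - l + 1 = k + 1 by push_cast; ring, Complex.Gamma_nat_eq_factorial,
    show a + l + k + 1 = a + ((k + l : ℕ) : ℂ) + 1 by push_cast; ring]
  ring

theorem factorial_pred_div_le (l : ℕ) :
    ((l - 1).factorial : ℝ) / (l.factorial * l.factorial) ≤ 1 / l.factorial := by
  have : ((l - 1).factorial : ℝ) ≤ l.factorial := by
    exact_mod_cast Nat.factorial_le (Nat.sub_le l 1)
  rw [div_le_div_iff₀ (by positivity) (by positivity), one_mul]
  gcongr

theorem hasSum_mul_besselSeries_mul_tsum {w a c : ℂ} (hw : w.re = 0) (ha : a.re = 0) (hc : c.re = 0)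
    {g : ℕ → ℂ} {G K : ℝ} (hg : ∀ m : ℕ, ‖g m‖ ≤ G / m.factorial) (hK0 : 0 ≤ K)
    (hK : ∀ l m : ℕ, ‖(Complex.Gamma (m + 1 - c - l))⁻¹‖ ≤ K * (l - 1).factorial) (A B : ℂ) :
    HasSum (fun l : ℕ => ((l.factorial : ℂ)⁻¹ * (Complex.Gamma (w + l + 1))⁻¹) *
      ((A ^ l * besselSeries (a + l) A) *
        ∑' m : ℕ, B ^ m * (g m * (Complex.Gamma (m + 1 - c - l))⁻¹)))
    (∑' n : ℕ × ℕ, Complex.Gamma (w - c + n.1 + n.2 + 1) * A ^ n.1 * B ^ n.2 *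
      ((n.1.factorial : ℂ)⁻¹ * (Complex.Gamma (a + n.1 + 1))⁻¹ * (Complex.Gamma (w + n.1 + 1))⁻¹) *
      (g n.2 * (Complex.Gamma (n.2 + 1 - c))⁻¹ * (Complex.Gamma (w - c + n.2 + 1))⁻¹)) := by
  have hG0 : 0 ≤ G := by simpa using (norm_nonneg _).trans (hg 0)
  set t : ℕ → ℕ × ℕ → ℂ := fun l n => ((l.factorial : ℂ)⁻¹ * (Complex.Gamma (w + l + 1))⁻¹) *
    ((A ^ n.1 * ((Complex.Gamma (n.1 - l + 1))⁻¹ * (Complex.Gamma (a + n.1 + 1))⁻¹)) *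
      (B ^ n.2 * (g n.2 * (Complex.Gamma (n.2 + 1 - c - l))⁻¹))) with ht
  set Kw := ‖(Complex.Gamma (w + 1))⁻¹‖
  set Ka := ‖(Complex.Gamma (a + 1))⁻¹‖
  have hbd : Summable fun q : ℕ × (ℕ × ℕ) => ((1 : ℝ) ^ q.1 / q.1.factorial) *
      ((‖A‖ ^ q.2.1 / q.2.1.factorial) * (‖B‖ ^ q.2.2 / q.2.2.factorial)) :=
    (Real.summable_pow_div_factorial 1).mul_of_nonneg
      ((Real.summable_pow_div_factorial ‖A‖).mul_of_nonneg (Real.summable_pow_div_factorial ‖B‖)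
        (fun n => by positivity) (fun n => by positivity)) (fun n => by positivity)
      (fun n => by positivity)
  have hsum : Summable (Function.uncurry t) := by
    refine Summable.of_norm_bounded (hbd.mul_left (Kw * Ka * G * K)) ?_
    rintro ⟨l, N, M⟩
    simp only [Function.uncurry, ht, norm_mul, norm_pow]
    rw [norm_inv (l.factorial : ℂ), Complex.norm_natCast]
    calc _ ≤ ((l.factorial : ℝ)⁻¹ * (Kw / l.factorial)) * ((‖A‖ ^ N * (1 * (Ka / N.factorial))) *
          (‖B‖ ^ M * (G / M.factorial * (K * (l - 1).factorial)))) := by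
          gcongr
          · exact norm_inv_Gamma_add_nat_le hw l
          · exact norm_inv_natCast_Gamma_sub_le N l
          · exact norm_inv_Gamma_add_nat_le ha N
          · exact hg M
          · exact hK l M
      _ = Kw * Ka * G * K * (((l - 1).factorial : ℝ) / (l.factorial * l.factorial) *
          ((‖A‖ ^ N / N.factorial) * (‖B‖ ^ M / M.factorial))) := by
          field_simp
      _ ≤ _ := by
          rw [one_pow]
          exact mul_le_mul_of_nonneg_left (mul_le_mul_of_nonneg_right (factorial_pred_div_le l)
            (by positivity)) (by positivity)
  have hleft : ∀ l : ℕ, ((l.factorial : ℂ)⁻¹ * (Complex.Gamma (w + l + 1))⁻¹) *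
      ((A ^ l * besselSeries (a + l) A) *
        ∑' m : ℕ, B ^ m * (g m * (Complex.Gamma (m + 1 - c - l))⁻¹)) = ∑' n, t l n := by
    intro l
    simp only [ht]
    have h1 := pow_mul_besselSeries_add_natCast a A l
    rw [tsum_mul_left, ← h1.tsum_eq]
    congr 1
    refine tsum_mul_tsum_of_summable_norm h1.summable.norm ?_
    refine Summable.of_nonneg_of_le (fun m => norm_nonneg _) (fun m => ?_)
      ((Real.summable_pow_div_factorial ‖B‖).mul_left (G * (K * (l - 1).factorial)))
    rw [norm_mul, norm_mul, norm_pow]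
    calc _ ≤ ‖B‖ ^ m * (G / m.factorial * (K * (l - 1).factorial)) := by
          gcongr
          · exact hg m
          · exact hK l m
      _ = _ := by ring
  simp_rw [hleft]
  have hs' : Summable fun l => ∑' n, t l n := hsum.prod
  refine (Summable.hasSum_iff hs').2 ?_
  rw [← Summable.tsum_comm hsum]
  refine tsum_congr ?_
  rintro ⟨N, M⟩
  have hchoose := sum_choose_mul_inv_Gamma N (w + 1) (M + 1 - c) fun k h => by
    have := congrArg Complex.re h
    simp [hw, hc] at this
    have h1 : (0 : ℝ) ≤ k := by positivity
    have h2 : (0 : ℝ) ≤ M := by positivity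
    linarith
  rw [tsum_eq_sum (s := Finset.range (N + 1))]
  · have : ∀ l ∈ Finset.range (N + 1), t l (N, M) = (A ^ N * (Complex.Gamma (a + N + 1))⁻¹ *
        (N.factorial : ℂ)⁻¹ * B ^ M * g M) * ((N.choose l : ℂ) *
          ((Complex.Gamma (w + 1 + l))⁻¹ * (Complex.Gamma (M + 1 - c - l))⁻¹)) := by
      intro l hl
      obtain ⟨k, rfl⟩ := Nat.exists_eq_add_of_le (Nat.lt_succ_iff.1 (Finset.mem_range.1 hl))
      simp only [ht]
      rw [show ((l + k : ℕ) : ℂ) - l + 1 = k + 1 by push_cast; ring,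
        Complex.Gamma_nat_eq_factorial, Nat.cast_add_choose,
        show w + 1 + (l : ℂ) = w + l + 1 by ring]
      have h1 : ((l + k).factorial : ℂ) ≠ 0 := by exact_mod_cast Nat.factorial_ne_zero _
      field_simp
    rw [Finset.sum_congr rfl this, ← Finset.mul_sum, hchoose]
    simp only
    rw [show w + 1 + (M + 1 - c) + (N : ℂ) - 1 = w - c + N + M + 1 by ring,
      show w + 1 + (N : ℂ) = w + N + 1 by ring,
      show w + 1 + ((M : ℂ) + 1 - c) - 1 = w - c + M + 1 by ring]
    ring
  · intro l hl
    have hl : N + 1 ≤ l := by simpa using hl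
    obtain ⟨k, rfl⟩ := Nat.exists_eq_add_of_le hl
    simp only [ht]
    rw [show (N : ℂ) - ((N + 1 + k : ℕ) : ℂ) + 1 = -(k : ℂ) by push_cast; ring,
      Complex.Gamma_neg_nat_eq_zero]
    simp

theorem hasSum_mul_besselSeries_neg {w a b : ℂ} (hw : w.re = 0) (ha : a.re = 0) (hb : b.re = 0)
    (hb' : b.im ≠ 0) (hab : a + b = w) (A B : ℂ) :
    HasSum (fun l : ℕ => ((l.factorial : ℂ)⁻¹ * (Complex.Gamma (w + l + 1))⁻¹) *
      ((A ^ l * besselSeries (a + l) A) * besselSeries (-b - l) B)) (dblSeries (-b) w A B) := by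
  obtain ⟨K, hK0, hK⟩ := exists_norm_inv_Gamma_sub_le hb (sin_pi_mul_ne_zero_of_im_ne_zero hb')
  have h := hasSum_mul_besselSeries_mul_tsum hw ha hb (g := fun m => (m.factorial : ℂ)⁻¹) (G := 1)
    (fun m => by simp) hK0.le hK A B
  obtain rfl : w = a + b := hab.symm
  convert h using 1
  · funext l
    simp only [besselSeries]
    congr 2
    refine tsum_congr fun m => ?_
    rw [show -b - (l : ℂ) + m + 1 = m + 1 - b - l by ring]
  · rw [dblSeries]
    refine tsum_congr fun n => ?_
    rw [show (n.1 : ℂ) + n.2 + -b + (a + b) + 1 = a + b - b + n.1 + n.2 + 1 by ring,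
      show -b + (a + b) = a by ring, show -b + (n.2 : ℂ) + 1 = n.2 + 1 - b by ring,
      show a + b - b + (n.2 : ℂ) + 1 = a + n.2 + 1 by ring]
    ring

theorem hasSum_mul_besselSeries {w a b : ℂ} (hw : w.re = 0) (ha : a.re = 0) (hb : b.re = 0)
    (hab : a + b = w) (A B : ℂ) :
    HasSum (fun l : ℕ => ((l.factorial : ℂ)⁻¹ * (Complex.Gamma (w + l + 1))⁻¹) *
      ((A ^ l * besselSeries (a + l) A) * (B ^ l * besselSeries (b + l) B)))
      (dblSeries b a A B) := by
  have h := hasSum_mul_besselSeries_mul_tsum hw ha (c := 0) (by simp)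
    (g := fun m => (Complex.Gamma (b + m + 1))⁻¹) (G := ‖(Complex.Gamma (b + 1))⁻¹‖)
    (fun m => norm_inv_Gamma_add_nat_le hb m) zero_le_one (fun l m => ?_) A B
  · convert h using 1
    · funext l
      rw [← (pow_mul_besselSeries_add_natCast b B l).tsum_eq]
      congr 2
      refine tsum_congr fun m => ?_
      rw [show (m : ℂ) + 1 - 0 - l = m - l + 1 by ring]
      ring
    · rw [dblSeries]
      refine tsum_congr fun n => ?_
      rw [← hab, show (n.1 : ℂ) + n.2 + b + a + 1 = a + b - 0 + n.1 + n.2 + 1 by ring,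
        add_comm b a, sub_zero, sub_zero, Complex.Gamma_nat_eq_factorial]
      ring
  · have := norm_inv_natCast_Gamma_sub_le m l
    rw [show (m : ℂ) + 1 - 0 - l = m - l + 1 by ring, one_mul]
    exact this.trans (by exact_mod_cast Nat.factorial_pos _)

theorem exists_norm_besselSeries_neg_sub_le {a : ℂ} (ha : a.re = 0) (ha' : a.im ≠ 0) :
    ∃ K : ℝ, 0 < K ∧ ∀ (l : ℕ) (A : ℂ),
      ‖besselSeries (-a - l) A‖ ≤ K * (l - 1).factorial * Real.exp ‖A‖ := by
  obtain ⟨K, hK0, hK⟩ := exists_norm_inv_Gamma_sub_le ha (sin_pi_mul_ne_zero_of_im_ne_zero ha')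
  refine ⟨K, hK0, fun l A => ?_⟩
  have hs := (NormedSpace.expSeries_div_hasSum_exp ‖A‖).mul_left (K * (l - 1).factorial)
  rw [← Real.exp_eq_exp_ℝ] at hs
  refine tsum_of_norm_bounded hs fun m => ?_
  rw [norm_mul, norm_mul, norm_pow, norm_inv (m.factorial : ℂ), Complex.norm_natCast,
    show -a - (l : ℂ) + m + 1 = m + 1 - a - l by ring]
  calc _ ≤ ‖A‖ ^ m * ((m.factorial : ℝ)⁻¹ * (K * (l - 1).factorial)) := by
        gcongr
        exact hK l m
    _ = _ := by ring

/-- The contribution of the singular parts of both factors to `kernelSum`. -/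
noncomputable def crossSum (w a b A B : ℂ) : ℂ :=
  ∑' l : ℕ, ((l.factorial : ℂ)⁻¹ * (Complex.Gamma (w + l + 1))⁻¹) *
    (besselSeries (-a - l) A * besselSeries (-b - l) B)

theorem exists_norm_crossSum_term_le {w a b : ℂ} (hw : w.re = 0) (ha : a.re = 0) (hb : b.re = 0)
    (ha' : a.im ≠ 0) (hb' : b.im ≠ 0) : ∃ K : ℝ, ∀ (l : ℕ) (A B : ℂ),
    ‖((l.factorial : ℂ)⁻¹ * (Complex.Gamma (w + l + 1))⁻¹) *
      (besselSeries (-a - l) A * besselSeries (-b - l) B)‖ ≤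
      K * Real.exp (‖A‖ + ‖B‖) * (1 / ((l + 1 : ℕ) : ℝ) ^ 2) := by
  obtain ⟨Ka, hKa0, hKa⟩ := exists_norm_besselSeries_neg_sub_le ha ha'
  obtain ⟨Kb, hKb0, hKb⟩ := exists_norm_besselSeries_neg_sub_le hb hb'
  refine ⟨4 * ‖(Complex.Gamma (w + 1))⁻¹‖ * Ka * Kb, fun l A B => ?_⟩
  have hf : ((l - 1).factorial : ℝ) * (l + 1) ≤ 2 * l.factorial := by
    rcases l with _ | k
    · norm_num
    · rw [Nat.add_sub_cancel, Nat.factorial_succ]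
      push_cast
      have : (0 : ℝ) ≤ k.factorial * k := by positivity
      linarith
  rw [norm_mul, norm_mul, norm_mul, norm_inv (l.factorial : ℂ), Complex.norm_natCast, Real.exp_add]
  calc _ ≤ ((l.factorial : ℝ)⁻¹ * (‖(Complex.Gamma (w + 1))⁻¹‖ / l.factorial)) *
        ((Ka * (l - 1).factorial * Real.exp ‖A‖) * (Kb * (l - 1).factorial * Real.exp ‖B‖)) := by
        gcongr
        · exact norm_inv_Gamma_add_nat_le hw l
        · exact hKa l A
        · exact hKb l B
    _ = ‖(Complex.Gamma (w + 1))⁻¹‖ * Ka * Kb * (Real.exp ‖A‖ * Real.exp ‖B‖) *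
        ((((l - 1).factorial : ℝ) * (l + 1)) ^ 2 / (l.factorial * (l + 1)) ^ 2) := by
        field_simp
    _ ≤ ‖(Complex.Gamma (w + 1))⁻¹‖ * Ka * Kb * (Real.exp ‖A‖ * Real.exp ‖B‖) *
        ((2 * l.factorial) ^ 2 / (l.factorial * (l + 1)) ^ 2) := by gcongr
    _ = _ := by
        push_cast
        field_simp
        ring

theorem summable_crossSum {w a b : ℂ} (hw : w.re = 0) (ha : a.re = 0) (hb : b.re = 0)
    (ha' : a.im ≠ 0) (hb' : b.im ≠ 0) (A B : ℂ) :
    Summable fun l : ℕ => ((l.factorial : ℂ)⁻¹ * (Complex.Gamma (w + l + 1))⁻¹) *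
      (besselSeries (-a - l) A * besselSeries (-b - l) B) := by
  obtain ⟨K, hK⟩ := exists_norm_crossSum_term_le hw ha hb ha' hb'
  exact Summable.of_norm_bounded
    (((summable_nat_add_iff 1).2 (Real.summable_one_div_nat_pow.2 one_lt_two)).mul_left _)
    fun l => hK l A B

theorem differentiable_crossSum {w a b : ℂ} (hw : w.re = 0) (ha : a.re = 0) (hb : b.re = 0)
    (ha' : a.im ≠ 0) (hb' : b.im ≠ 0) (B : ℂ) :
    Differentiable ℂ fun A => crossSum w a b A B := by
  obtain ⟨K, hK⟩ := exists_norm_crossSum_term_le hw ha hb ha' hb'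
  have hK0 : 0 ≤ K := by
    have := (norm_nonneg _).trans (hK 0 0 0)
    simpa using this
  intro z
  have h : DifferentiableOn ℂ (fun A => crossSum w a b A B) (Metric.ball 0 (‖z‖ + 1)) := by
    refine Complex.differentiableOn_tsum_of_summable_norm
      (u := fun l : ℕ => K * Real.exp ((‖z‖ + 1) + ‖B‖) * (1 / ((l + 1 : ℕ) : ℝ) ^ 2))
      (((summable_nat_add_iff 1).2 (Real.summable_one_div_nat_pow.2 one_lt_two)).mul_left _)
      (fun l => ?_) Metric.isOpen_ball fun l A hA => (hK l A B).trans ?_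
    · exact (((differentiable_besselSeries (-a - l)).mul_const _).const_mul _).differentiableOn
    · have : ‖A‖ ≤ ‖z‖ + 1 := (mem_ball_zero_iff.1 hA).le
      gcongr
  exact h.differentiableAt (Metric.isOpen_ball.mem_nhds (by simp))

theorem kernelSum_eq {z₁ z₂ : ℝ} (hz₁ : 0 < z₁) (hz₂ : 0 < z₂) {w a b : ℂ} (hw : w.re = 0)
    (ha : a.re = 0) (hb : b.re = 0) (ha' : a.im ≠ 0) (hb' : b.im ≠ 0) (hab : a + b = w) :
    kernelSum z₁ z₂ w a b = Real.pi ^ 2 / (Complex.sin (Real.pi * a) * Complex.sin (Real.pi * b)) *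
      ((z₁ : ℂ) ^ (-a) * (z₂ : ℂ) ^ (-b) * crossSum w a b (z₁ * z₁) (z₂ * z₂) -
        (z₁ : ℂ) ^ a * (z₂ : ℂ) ^ (-b) * dblSeries (-b) w (z₁ * z₁) (z₂ * z₂) -
        (z₁ : ℂ) ^ (-a) * (z₂ : ℂ) ^ b * dblSeries w (-a) (z₁ * z₁) (z₂ * z₂) +
        (z₁ : ℂ) ^ a * (z₂ : ℂ) ^ b * dblSeries b a (z₁ * z₁) (z₂ * z₂)) := by
  have h0 := (summable_crossSum hw ha hb ha' hb' (z₁ * z₁ : ℂ) (z₂ * z₂)).hasSum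
  have h1 := hasSum_mul_besselSeries_neg hw ha hb hb' hab (z₁ * z₁) (z₂ * z₂)
  have h2 := hasSum_mul_besselSeries_neg hw hb ha ha' (by rw [← hab, add_comm]) (z₂ * z₂) (z₁ * z₁)
  rw [dblSeries_swap] at h2
  have h3 := hasSum_mul_besselSeries hw ha hb hab (z₁ * z₁) (z₂ * z₂)
  have h := ((((h0.mul_left ((z₁ : ℂ) ^ (-a) * (z₂ : ℂ) ^ (-b))).sub
    (h1.mul_left ((z₁ : ℂ) ^ a * (z₂ : ℂ) ^ (-b)))).sub
    (h2.mul_left ((z₁ : ℂ) ^ (-a) * (z₂ : ℂ) ^ b))).add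
    (h3.mul_left ((z₁ : ℂ) ^ a * (z₂ : ℂ) ^ b))).mul_left
    (Real.pi ^ 2 / (Complex.sin (Real.pi * a) * Complex.sin (Real.pi * b)))
  rw [crossSum, ← h.tsum_eq, kernelSum]
  refine tsum_congr fun l => ?_
  have hz₁' : (z₁ : ℂ) ≠ 0 := Complex.ofReal_ne_zero.2 hz₁.ne'
  have hz₂' : (z₂ : ℂ) ≠ 0 := Complex.ofReal_ne_zero.2 hz₂.ne'
  have sa := sin_pi_mul_add_int a l
  have sb := sin_pi_mul_add_int b l
  have sa0 := sin_pi_mul_ne_zero_of_im_ne_zero ha'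
  have sb0 := sin_pi_mul_ne_zero_of_im_ne_zero hb'
  rw [expKernel_eq hz₁ hz₁ (w := a + l) (by simpa using ha'),
    expKernel_eq hz₂ hz₂ (w := b + l) (by simpa using hb')]
  simp only [Int.cast_natCast, zpow_natCast] at sa sb
  rw [sa, sb, show -(a + (l : ℂ)) = -a - l by ring, show -(b + (l : ℂ)) = -b - l by ring,
    Complex.cpow_sub _ _ hz₁', Complex.cpow_sub _ _ hz₂', Complex.cpow_add _ _ hz₁',
    Complex.cpow_add _ _ hz₂']
  simp only [Complex.cpow_natCast, mul_pow]
  have e1 : ((-1 : ℂ) ^ l) * (-1) ^ l = 1 := by rw [← mul_pow]; simp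
  have e2 : ((-1 : ℂ) ^ l) ≠ 0 := by simp
  generalize ((-1 : ℂ) ^ l) = s at e1 e2 ⊢
  generalize Complex.sin (Real.pi * a) = u at *
  generalize Complex.sin (Real.pi * b) = v at *
  have e3 : (Real.pi : ℂ) / (s * u) * (Real.pi / (s * v)) = Real.pi ^ 2 / (u * v) := by
    rw [div_mul_div_comm, show s * u * (s * v) = (s * s) * (u * v) by ring, e1, one_mul, sq]
  rw [mul_mul_mul_comm (Real.pi / (s * u) : ℂ), e3]
  have f1 : (z₁ : ℂ) ^ l ≠ 0 := pow_ne_zero _ hz₁'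
  have f2 : (z₂ : ℂ) ^ l ≠ 0 := pow_ne_zero _ hz₂'
  field_simp
  ring

theorem eqOn_of_eq_ofReal {U : Set ℂ} (hU : IsOpen U) (hc : IsPreconnected U) {f g : ℂ → ℂ}
    (hf : DifferentiableOn ℂ f U) (hg : DifferentiableOn ℂ g U) {x₀ : ℝ} (hx₀ : (x₀ : ℂ) ∈ U)
    (h : ∀ x : ℝ, (x : ℂ) ∈ U → f x = g x) : Set.EqOn f g U := by
  refine (hf.analyticOnNhd hU).eqOn_of_preconnected_of_frequently_eq (hg.analyticOnNhd hU) hc hx₀ ?_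
  have h1 : Filter.Tendsto (fun x : ℝ => (x : ℂ)) (nhdsWithin x₀ {x₀}ᶜ)
      (nhdsWithin (x₀ : ℂ) {(x₀ : ℂ)}ᶜ) := by
    refine tendsto_nhdsWithin_iff.2 ⟨?_, ?_⟩
    · exact Complex.continuous_ofReal.continuousAt.mono_left nhdsWithin_le_nhds
    · filter_upwards [self_mem_nhdsWithin] with x hx
      simpa using hx
  refine h1.frequently (Filter.Eventually.frequently ?_)
  have h2 : ∀ᶠ x : ℝ in nhds x₀, (x : ℂ) ∈ U :=
    Complex.continuous_ofReal.continuousAt.eventually_mem (hU.mem_nhds hx₀)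
  filter_upwards [nhdsWithin_le_nhds h2] with x hx using h x hx

theorem eq_zero_of_mul_cpow_eq {ν : ℂ} (hν : ν.im ≠ 0) {f g : ℂ → ℂ} (hf : Differentiable ℂ f)
    (hg : Differentiable ℂ g) (h : ∀ x : ℝ, 0 < x → f x * (x : ℂ) ^ (-ν) = g x) {x : ℝ}
    (hx : 0 < x) : f x = 0 := by
  have key : Set.EqOn (fun s => f (Complex.exp s) * Complex.exp (s * -ν))
      (fun s => g (Complex.exp s)) Set.univ := by
    refine eqOn_of_eq_ofReal isOpen_univ isPreconnected_univ (x₀ := 0)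
      ((hf.comp Complex.differentiable_exp).mul
        (differentiable_id.mul_const _).cexp).differentiableOn
      (hg.comp Complex.differentiable_exp).differentiableOn (Set.mem_univ _) fun s _ => ?_
    have h1 := h (Real.exp s) (Real.exp_pos s)
    rw [Complex.cpow_def_of_ne_zero (by exact_mod_cast (Real.exp_pos s).ne'),
      ← Complex.ofReal_log (Real.exp_pos s).le, Real.log_exp] at h1
    simpa using h1
  have h1 := key (Set.mem_univ (Real.log x : ℂ))
  have h2 := key (Set.mem_univ ((Real.log x : ℂ) + 2 * Real.pi * Complex.I))
  have h3 : Complex.exp (Real.log x : ℂ) = x := by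
    rw [← Complex.ofReal_exp, Real.exp_log hx]
  have h5 : Complex.exp (Real.log x + 2 * Real.pi * Complex.I) = x := by
    rw [← h3]
    exact Complex.exp_periodic _
  simp only [h3, h5] at h1 h2
  rw [← h1, add_mul, Complex.exp_add] at h2
  by_contra hne
  have h4 : Complex.exp (2 * Real.pi * Complex.I * -ν) = 1 :=
    mul_left_cancel₀ (mul_ne_zero hne (Complex.exp_ne_zero (Real.log x * -ν)))
      (by rw [mul_assoc, h2, mul_one])
  obtain ⟨n, hn⟩ := Complex.exp_eq_one_iff.1 h4
  have := congrArg Complex.re hn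
  simp at this
  exact hν this

/-- Mellin transform of a product of two `K`-Bessel kernels with ellipsoidal arguments. -/
noncomputable def kernelMellin (ν α z₁ z₂ : ℂ) : ℂ :=
  ∫ v in Set.Ioi (0 : ℝ), (v : ℂ) ^ (α - 1) *
    (expKernel (z₁ * (√(1 + v) : ℝ)) (z₁ * (√(1 + v) : ℝ)) ν *
      expKernel (z₂ * (√(1 + 1 / v) : ℝ)) (z₂ * (√(1 + 1 / v) : ℝ)) ν)

/-- The combination of six double series evaluating `kernelMellin`; `P s` and `Q s` stand for the
`s`-th powers of the two arguments. -/
noncomputable def sixTerm (α β : ℂ) (P Q : ℂ → ℂ) (A B : ℂ) : ℂ :=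
  P (2 * β) * Q (2 * β) * dblSeries (β - α) (α + β) A B -
    P (-(2 * β)) * Q (-(2 * β)) * dblSeries (-β - α) (α - β) A B -
    P (-(2 * α)) * Q (2 * β) * dblSeries (2 * β) (-α - β) A B +
    P (-(2 * α)) * Q (-(2 * β)) * dblSeries (-(2 * β)) (β - α) A B -
    P (2 * β) * Q (2 * α) * dblSeries (α - β) (2 * β) A B +
    P (-(2 * β)) * Q (2 * α) * dblSeries (α + β) (-(2 * β)) A B

theorem sixTerm_neg (α β : ℂ) (P Q : ℂ → ℂ) (A B : ℂ) :
    sixTerm α (-β) P Q A B = -sixTerm α β P Q A B := by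
  simp only [sixTerm, mul_neg, neg_neg, sub_neg_eq_add, ← sub_eq_add_neg]
  rw [show -α + β = β - α by ring, show -α - β = -β - α by ring]
  ring

theorem kernelMellin_neg {z₁ z₂ : ℝ} (hz₁ : 0 < z₁) (hz₂ : 0 < z₂) {ν : ℂ} (hν : ν.im ≠ 0)
    (α : ℂ) : kernelMellin (-ν) α z₁ z₂ = kernelMellin ν α z₁ z₂ := by
  refine setIntegral_congr_fun measurableSet_Ioi fun v hv => ?_
  have hv : 0 < v := hv
  have h1 : 0 < z₁ * √(1 + v) := by positivity
  have h2 : 0 < z₂ * √(1 + 1 / v) := by positivity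
  simp only [← Complex.ofReal_mul]
  rw [← expKernel_symm h1 h1 hν, ← expKernel_symm h2 h2 hν]

theorem kernelMellin_eq_kernelSum {z₁ z₂ : ℝ} (hz₁ : 0 < z₁) (hz₂ : 0 < z₂) {α β : ℂ}
    (hα : α.re = 0) (hβ : β.re = 0) (hβ' : β.im ≠ 0) (hs : (α + β).im ≠ 0) :
    kernelMellin (2 * β) α z₁ z₂ = Real.pi / Complex.sin (Real.pi * (α + β)) *
      ((z₁ : ℂ) ^ (-(α + β)) * kernelSum z₁ z₂ (-(α + β)) (β - α) (-(2 * β)) -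
        (z₂ : ℂ) ^ (α + β) * kernelSum z₁ z₂ (α + β) (2 * β) (α - β)) := by
  have h := integral_cpow_mul_expKernel_mul_expKernel hz₁ hz₂ (w := α + β) (ν := 2 * β)
    (by simp [hα, hβ]) hs (by simp [hβ])
  rw [show 2 * β - (α + β) = β - α by ring, show α + β - 2 * β = α - β by ring] at h
  rw [← h]
  refine setIntegral_congr_fun measurableSet_Ioi fun v hv => ?_
  have hv : 0 < v := hv
  have h1 : 0 < z₁ * √(1 + v) := by positivity
  have h2 : 0 < z₂ * √(1 + 1 / v) := by positivity
  have h2β : (2 * β).im ≠ 0 := by simpa using hβ'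
  simp only [← Complex.ofReal_mul]
  rw [expKernel_symm h2 h2 h2β, expKernel_mul_sqrt hz₁ (by positivity) h2β,
    expKernel_mul_sqrt hz₂ (by positivity) (by simpa using hβ')]
  have hv0 : (v : ℂ) ≠ 0 := Complex.ofReal_ne_zero.2 hv.ne'
  have e : (v : ℂ) ^ (α - 1) * (((1 + v : ℝ) : ℂ) ^ (2 * β / 2) *
      ((1 + 1 / v : ℝ) : ℂ) ^ (-(2 * β) / 2)) = (v : ℂ) ^ (α + β - 1) := by
    have e1 : ((1 + v : ℝ) : ℂ) = ((1 + 1 / v : ℝ) : ℂ) * (v : ℂ) := by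
      rw [← Complex.ofReal_mul]
      congr 1
      field_simp
      ring
    have e2 : ((1 + 1 / v : ℝ) : ℂ) ≠ 0 := Complex.ofReal_ne_zero.2 (by positivity)
    rw [e1, Complex.mul_cpow_ofReal_nonneg (by positivity) hv.le,
      show -(2 * β) / 2 = -(2 * β / 2) by ring, Complex.cpow_neg,
      mul_right_comm, mul_inv_cancel₀ ((Complex.cpow_ne_zero_iff).2 (Or.inl e2)), one_mul,
      ← Complex.cpow_add _ _ hv0]
    congr 1
    ring
  rw [← e]
  ring

theorem kernelMellin_eq_crossSum_add_sixTerm {z₁ z₂ : ℝ} (hz₁ : 0 < z₁) (hz₂ : 0 < z₂) {α β : ℂ}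
    (hα : α.re = 0) (hβ : β.re = 0) (hβ' : β.im ≠ 0) (hs : (α + β).im ≠ 0) (hd : (α - β).im ≠ 0) :
    kernelMellin (2 * β) α z₁ z₂ = Real.pi ^ 3 / (Complex.sin (Real.pi * (α + β)) *
        Complex.sin (Real.pi * (α - β)) * Complex.sin (Real.pi * (2 * β))) *
      ((z₁ : ℂ) ^ (-(2 * β)) * (z₂ : ℂ) ^ (2 * β) *
        (crossSum (-(α + β)) (β - α) (-(2 * β)) (z₁ * z₁) (z₂ * z₂) -
          crossSum (α + β) (2 * β) (α - β) (z₁ * z₁) (z₂ * z₂)) +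
        sixTerm α β (fun s => (z₁ : ℂ) ^ s) (fun s => (z₂ : ℂ) ^ s) (z₁ * z₁) (z₂ * z₂)) := by
  have hd' : (β - α).im ≠ 0 := by
    simp only [Complex.sub_im] at hd ⊢
    exact fun h => hd (by linarith)
  have hz₁' : (z₁ : ℂ) ≠ 0 := Complex.ofReal_ne_zero.2 hz₁.ne'
  have hz₂' : (z₂ : ℂ) ≠ 0 := Complex.ofReal_ne_zero.2 hz₂.ne'
  rw [kernelMellin_eq_kernelSum hz₁ hz₂ hα hβ hβ' hs,
    kernelSum_eq hz₁ hz₂ (by simp [hα, hβ]) (by simp [hα, hβ]) (by simp [hβ]) hd'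
      (by simpa using hβ') (by ring),
    kernelSum_eq hz₁ hz₂ (by simp [hα, hβ]) (by simp [hβ]) (by simp [hα, hβ])
      (by simpa using hβ') hd (by ring), sixTerm]
  have s1 := sin_pi_mul_ne_zero_of_im_ne_zero hs
  have s2 := sin_pi_mul_ne_zero_of_im_ne_zero hd
  have s3 : Complex.sin (Real.pi * (2 * β)) ≠ 0 :=
    sin_pi_mul_ne_zero_of_im_ne_zero (by simpa using hβ')
  rw [show (Real.pi : ℂ) * (β - α) = -(Real.pi * (α - β)) by ring, mul_neg (Real.pi : ℂ) (2 * β),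
    Complex.sin_neg, Complex.sin_neg]
  have p1 : ∀ s t u : ℂ, s + t = u → (z₁ : ℂ) ^ u = (z₁ : ℂ) ^ s * (z₁ : ℂ) ^ t := by
    rintro s t u rfl; exact Complex.cpow_add _ _ hz₁'
  have p2 : ∀ s t u : ℂ, s + t = u → (z₂ : ℂ) ^ u = (z₂ : ℂ) ^ s * (z₂ : ℂ) ^ t := by
    rintro s t u rfl; exact Complex.cpow_add _ _ hz₂'
  simp only [neg_neg]
  rw [p1 (-(α + β)) (-(β - α)) (-(2 * β)) (by ring), p1 (-(α + β)) (β - α) (-(2 * α)) (by ring),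
    p2 (α + β) (-(α - β)) (2 * β) (by ring), p2 (α + β) (α - β) (2 * α) (by ring)]
  rw [show -α - β = -(α + β) by ring, show -β - α = -(α + β) by ring,
    show dblSeries (-(α + β)) (-(β - α)) = dblSeries (-(α + β)) (α - β) by rw [neg_sub],
    show dblSeries (-(α - β)) (α + β) = dblSeries (β - α) (α + β) by rw [neg_sub]]
  field_simp
  ring

theorem kernelMellin_eq {z₁ z₂ : ℝ} (hz₁ : 0 < z₁) (hz₂ : 0 < z₂) {α β : ℂ}
    (hα : α.re = 0) (hβ : β.re = 0) (hβ' : β.im ≠ 0) (hs : (α + β).im ≠ 0) (hd : (α - β).im ≠ 0) :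
    kernelMellin (2 * β) α z₁ z₂ = Real.pi ^ 3 / (Complex.sin (Real.pi * (α + β)) *
        Complex.sin (Real.pi * (α - β)) * Complex.sin (Real.pi * (2 * β))) *
      sixTerm α β (fun s => (z₁ : ℂ) ^ s) (fun s => (z₂ : ℂ) ^ s) (z₁ * z₁) (z₂ * z₂) := by
  rw [kernelMellin_eq_crossSum_add_sixTerm hz₁ hz₂ hα hβ hβ' hs hd]
  have hβn : (-β).re = 0 := by simp [hβ]
  have hβn' : (-β).im ≠ 0 := by simpa using hβ'
  have h2β : (2 * β).im ≠ 0 := by simpa using hβ'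
  have hd' : (β - α).im ≠ 0 := by
    simp only [Complex.sub_im] at hd ⊢
    exact fun h => hd (by linarith)
  have hs' : (-β - α).im ≠ 0 := by
    simp only [Complex.sub_im, Complex.add_im, Complex.neg_im] at hs ⊢
    exact fun h => hs (by linarith)
  have hz₂' : (z₂ : ℂ) ≠ 0 := Complex.ofReal_ne_zero.2 hz₂.ne'
  have s1 := sin_pi_mul_ne_zero_of_im_ne_zero hs
  have s2 := sin_pi_mul_ne_zero_of_im_ne_zero hd
  have s3 := sin_pi_mul_ne_zero_of_im_ne_zero h2β
  suffices h : crossSum (-(α + β)) (β - α) (-(2 * β)) (z₁ * z₁) (z₂ * z₂) -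
      crossSum (α + β) (2 * β) (α - β) (z₁ * z₁) (z₂ * z₂) = 0 by rw [h]; simp
  set f : ℂ → ℂ := fun A => crossSum (-(α + β)) (β - α) (-(2 * β)) A (z₂ * z₂) -
    crossSum (α + β) (2 * β) (α - β) A (z₂ * z₂)
  set g : ℂ → ℂ := fun A => crossSum (-(α + -β)) (-β - α) (-(2 * -β)) A (z₂ * z₂) -
    crossSum (α + -β) (2 * -β) (α - -β) A (z₂ * z₂)
  have hf : Differentiable ℂ f :=
    (differentiable_crossSum (by simp [hα, hβ]) (by simp [hα, hβ]) (by simp [hβ]) hd'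
      (by simpa using hβ') _).sub
    (differentiable_crossSum (by simp [hα, hβ]) (by simp [hβ]) (by simp [hα, hβ]) h2β hd _)
  have hg : Differentiable ℂ g :=
    (differentiable_crossSum (by simp [hα, hβ]) (by simp [hα, hβ]) (by simp [hβ]) hs'
      (by simpa using hβ') _).sub
    (differentiable_crossSum (by simp [hα, hβ]) (by simp [hβ]) (by simp [hα, hβ])
      (by simpa using hβ') (by simpa using hs) _)
  have key : ∀ x : ℝ, 0 < x → f x * (x : ℂ) ^ (-(2 * β)) =
      -((z₂ : ℂ) ^ (-(2 * β)) * (z₂ : ℂ) ^ (-(2 * β))) * g x := by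
    intro x hx
    have hr : 0 < √x := Real.sqrt_pos.2 hx
    have hr' : ((√x : ℝ) : ℂ) ≠ 0 := Complex.ofReal_ne_zero.2 hr.ne'
    have hrr : ((√x : ℝ) : ℂ) * ((√x : ℝ) : ℂ) = x := by
      rw [← Complex.ofReal_mul, Real.mul_self_sqrt hx.le]
    have h1 := kernelMellin_eq_crossSum_add_sixTerm hr hz₂ hα hβ hβ' hs hd
    have h2 := kernelMellin_eq_crossSum_add_sixTerm hr hz₂ hα hβn hβn'
      (by rwa [← sub_eq_add_neg]) (by rwa [sub_neg_eq_add])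
    rw [mul_neg 2 β, kernelMellin_neg hr hz₂ h2β, h1, sixTerm_neg, hrr] at h2
    have hxp : (x : ℂ) ^ (-(2 * β)) =
        ((√x : ℝ) : ℂ) ^ (-(2 * β)) * ((√x : ℝ) : ℂ) ^ (-(2 * β)) := by
      rw [← hrr, Complex.mul_cpow_ofReal_nonneg hr.le hr.le]
    have q1 : ((√x : ℝ) : ℂ) ^ (2 * β) ≠ 0 := (Complex.cpow_ne_zero_iff).2 (Or.inl hr')
    have q2 : (z₂ : ℂ) ^ (2 * β) ≠ 0 := (Complex.cpow_ne_zero_iff).2 (Or.inl hz₂')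
    rw [hxp]
    simp only [f, g]
    simp only [mul_neg, Complex.sin_neg, sub_neg_eq_add, ← sub_eq_add_neg, neg_neg,
      Complex.cpow_neg] at h2 ⊢
    generalize crossSum (-(α + β)) (β - α) (-(2 * β)) x (z₂ * z₂) -
      crossSum (α + β) (2 * β) (α - β) x (z₂ * z₂) = F at h2 ⊢
    generalize crossSum (-(α - β)) (-β - α) (2 * β) x (z₂ * z₂) -
      crossSum (α - β) (-(2 * β)) (α + β) x (z₂ * z₂) = G at h2 ⊢
    generalize sixTerm α β _ _ _ _ = S at h2
    generalize ((√x : ℝ) : ℂ) ^ (2 * β) = p at *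
    generalize (z₂ : ℂ) ^ (2 * β) = q at *
    generalize Complex.sin (Real.pi * (α + β)) = t₁ at *
    generalize Complex.sin (Real.pi * (α - β)) = t₂ at *
    generalize Complex.sin (Real.pi * (2 * β)) = t₃ at *
    have hpi : (Real.pi : ℂ) ≠ 0 := Complex.ofReal_ne_zero.2 Real.pi_ne_zero
    have e : p⁻¹ * q * F = -(p * q⁻¹ * G) := by
      have e1 : (Real.pi : ℂ) ^ 3 / (t₁ * t₂ * t₃) ≠ 0 := by positivity
      refine mul_left_cancel₀ e1 ?_
      rw [mul_comm t₂ t₁, div_neg] at h2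
      linear_combination h2
    rw [show F * (p⁻¹ * p⁻¹) = (p⁻¹ * q * F) * (p⁻¹ * q⁻¹) by field_simp, e]
    field_simp
  have := eq_zero_of_mul_cpow_eq h2β hf (hg.const_mul _) key (x := z₁ * z₁) (by positivity)
  simpa [f] using this

theorem differentiableOn_expKernel (ν : ℂ) :
    DifferentiableOn ℂ (fun z => expKernel z z ν) {z | 0 < z.re} := by
  intro z₀ hz₀
  have hz₀ : 0 < z₀.re := hz₀
  have hU : IsOpen {z : ℂ | z₀.re / 2 < z.re} := isOpen_lt continuous_const Complex.continuous_re
  have h : DifferentiableOn ℂ (fun z => expKernel z z ν) {z | z₀.re / 2 < z.re} := by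
    refine differentiableOn_integral_of_dominated hU
      (integrableOn_expKernel_real (half_pos hz₀) (half_pos hz₀) ν.re) (fun z hz => ?_) ?_ ?_
    · exact (continuousOn_expKernel_integrand z z ν).aestronglyMeasurable measurableSet_Ioi
    · refine Filter.Eventually.of_forall fun t => Differentiable.differentiableOn ?_
      fun_prop
    · refine (ae_restrict_iff' measurableSet_Ioi).2
        (Filter.Eventually.of_forall fun t ht z hz => ?_)
      have ht : 0 < t := ht
      have hz : z₀.re / 2 < z.re := hz
      rw [norm_expKernel_integrand ht]
      gcongr
  exact (h.differentiableAt (hU.mem_nhds (by simpa using hz₀))).differentiableWithinAt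

theorem integral_Ioi_inv_sq {T : ℝ} (hT : 1 < T) :
    IntegrableOn (fun t : ℝ => ((t - 1) ^ 2)⁻¹) (Set.Ioi T) ∧
      ∫ t in Set.Ioi T, ((t - 1) ^ 2)⁻¹ = (T - 1)⁻¹ := by
  have hd : ∀ t ∈ Set.Ici T, HasDerivAt (fun t : ℝ => -(t - 1)⁻¹) ((t - 1) ^ 2)⁻¹ t := by
    intro t ht
    have ht : T ≤ t := ht
    have h : t - 1 ≠ 0 := by linarith
    refine (((hasDerivAt_id' t).sub_const 1).inv h).neg.congr_deriv ?_
    rw [neg_div, neg_neg, one_div]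
  have hlim : Filter.Tendsto (fun t : ℝ => -(t - 1)⁻¹) Filter.atTop (nhds 0) := by
    rw [← neg_zero]
    exact (tendsto_inv_atTop_zero.comp (Filter.tendsto_atTop_add_const_right _ (-1)
      Filter.tendsto_id)).neg
  have hi := integrableOn_Ioi_deriv_of_nonneg' hd (fun t _ => by positivity) hlim
  refine ⟨hi, ?_⟩
  rw [integral_Ioi_of_hasDerivAt_of_tendsto' hd hi hlim]
  ring

theorem norm_cpow_of_re_eq_zero {t : ℝ} (ht : 0 < t) {ν : ℂ} (hν : ν.re = 0) :
    ‖(t : ℂ) ^ ν‖ = 1 := by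
  rw [Complex.norm_cpow_eq_rpow_re_of_pos ht, hν, Real.rpow_zero]

theorem norm_exp_neg_le_one {z : ℂ} (hz : 0 ≤ z.re) {t : ℝ} (ht : 0 < t) :
    ‖Complex.exp (-(z * t + z / t))‖ ≤ 1 := by
  rw [Complex.norm_exp, Real.exp_le_one_iff, Complex.neg_re, Complex.add_re, Complex.re_mul_ofReal,
    Complex.div_ofReal_re]
  have : 0 ≤ z.re * t + z.re / t := by positivity
  linarith

theorem norm_integral_Ioi_expKernel_le {z : ℂ} (hz : 0 < z.re) {ν : ℂ} (hν : ν.re = 0) {T : ℝ}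
    (hT : 1 < T) :
    ‖∫ t in Set.Ioi T, (t : ℂ) ^ (ν - 1) * Complex.exp (-(z * t + z / t))‖ ≤
      (‖ν‖ + 4) / (‖z‖ * (T - 1)) := by
  have hz0 : z ≠ 0 := fun h => by simp [h] at hz
  set e : ℝ → ℂ := fun t => Complex.exp (-(z * t + z / t)) with he
  set g : ℝ → ℂ := fun t => (t : ℂ) ^ (ν + 1) / ((t : ℂ) ^ 2 - 1) with hg
  set g' : ℝ → ℂ := fun t => ((ν + 1) * (t : ℂ) ^ ν * ((t : ℂ) ^ 2 - 1) -
    (t : ℂ) ^ (ν + 1) * (2 * t)) / ((t : ℂ) ^ 2 - 1) ^ 2 with hg'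
  have hne : ∀ t : ℝ, 1 < t → ((t : ℂ) ^ 2 - 1) ≠ 0 := fun t ht => by
    have : t ^ 2 - 1 ≠ 0 := by nlinarith
    exact_mod_cast this
  have hnorm : ∀ t : ℝ, 1 < t → ‖(t : ℂ) ^ 2 - 1‖ = t ^ 2 - 1 := fun t ht => by
    rw [show (t : ℂ) ^ 2 - 1 = ((t ^ 2 - 1 : ℝ) : ℂ) by push_cast; ring, Complex.norm_real,
      Real.norm_of_nonneg (by nlinarith)]
  have hpow : ∀ t : ℝ, 0 < t → ‖(t : ℂ) ^ (ν + 1)‖ = t := fun t ht => by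
    rw [Complex.norm_cpow_eq_rpow_re_of_pos ht]; simp [hν]
  have hgb : ∀ t : ℝ, 1 < t → ‖g t‖ ≤ (t - 1)⁻¹ := fun t ht => by
    rw [hg]
    simp only
    rw [norm_div, hpow t (by linarith), hnorm t ht, ← one_div,
      div_le_div_iff₀ (by nlinarith) (by linarith)]
    nlinarith
  have hg'b : ∀ t : ℝ, 1 < t → ‖g' t‖ ≤ (‖ν‖ + 3) * ((t - 1) ^ 2)⁻¹ := fun t ht => by
    have ht0 : 0 < t := by linarith
    have h1 : 0 < t - 1 := by linarith
    have h2 : 0 < t ^ 2 - 1 := by nlinarith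
    rw [hg']
    simp only
    rw [norm_div, norm_pow, hnorm t ht, ← div_eq_mul_inv, div_le_div_iff₀ (by positivity)
      (by positivity)]
    have hn : ‖(ν + 1) * (t : ℂ) ^ ν * ((t : ℂ) ^ 2 - 1) - (t : ℂ) ^ (ν + 1) * (2 * t)‖ ≤
        (‖ν‖ + 1) * (t ^ 2 - 1) + 2 * t ^ 2 := by
      refine (norm_sub_le _ _).trans ?_
      rw [norm_mul, norm_mul, norm_mul, hnorm t ht, hpow t ht0, norm_cpow_of_re_eq_zero ht0 hν,
        norm_mul, Complex.norm_real, Real.norm_of_nonneg ht0.le]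
      have := norm_add_le ν 1
      rw [norm_one] at this
      have h3 := mul_le_mul_of_nonneg_right this h2.le
      simp only [mul_one, Complex.norm_ofNat]
      nlinarith
    refine (mul_le_mul_of_nonneg_right hn (by positivity)).trans ?_
    have hν0 := norm_nonneg ν
    rw [show t ^ 2 - 1 = (t - 1) * (t + 1) by ring, mul_pow]
    have h4 : 0 ≤ (t - 1) ^ 3 := by positivity
    have h5 : 0 ≤ (‖ν‖ + 1) * (t - 1) ^ 2 * ((t + 1) ^ 2 - (t - 1) * (t + 1)) := by
      have : 0 ≤ (t + 1) ^ 2 - (t - 1) * (t + 1) := by nlinarith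
      positivity
    have h6 : 0 ≤ 2 * (t - 1) ^ 2 * ((t + 1) ^ 2 - t ^ 2) := by
      have : 0 ≤ (t + 1) ^ 2 - t ^ 2 := by nlinarith
      positivity
    nlinarith
  have hed : ∀ t : ℝ, 0 < t → HasDerivAt e (e t * (-(z - z / (t : ℂ) ^ 2))) t := fun t ht => by
    have ht' : (t : ℂ) ≠ 0 := Complex.ofReal_ne_zero.2 ht.ne'
    have h1 : HasDerivAt (fun s : ℂ => Complex.exp (-(z * s + z / s)))
        (Complex.exp (-(z * t + z / t)) * (-(z - z / (t : ℂ) ^ 2))) t := by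
      refine HasDerivAt.cexp ?_
      refine (((hasDerivAt_id' (t : ℂ)).const_mul z).add
        ((hasDerivAt_inv ht').const_mul z)).neg.congr_deriv ?_
      field_simp
      ring
    exact h1.comp_ofReal
  have hgd : ∀ t : ℝ, 1 < t → HasDerivAt g (g' t) t := fun t ht => by
    have ht0 : 0 < t := by linarith
    have h1 := hasDerivAt_ofReal_cpow_const (x := t) ht0.ne' (r := ν + 1)
      (fun h => by have := congrArg Complex.re h; simp [hν] at this)
    have h2 : HasDerivAt (fun t : ℝ => (t : ℂ) ^ 2 - 1) (2 * t : ℂ) t :=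
      (((hasDerivAt_pow 2 (t : ℂ)).sub_const 1).comp_ofReal).congr_deriv (by simp)
    refine (h1.div h2 (hne t ht)).congr_deriv ?_
    rw [hg', add_sub_cancel_right]
  have hderiv : ∀ t ∈ Set.Ici T, HasDerivAt (fun t => e t * g t)
      (-z * ((t : ℂ) ^ (ν - 1) * e t) + e t * g' t) t := by
    intro t ht
    have ht : T ≤ t := ht
    have ht1 : 1 < t := by linarith
    have ht0 : 0 < t := by linarith
    have ht' : (t : ℂ) ≠ 0 := Complex.ofReal_ne_zero.2 ht0.ne'
    refine ((hed t ht0).mul (hgd t ht1)).congr_deriv ?_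
    have hn := hne t ht1
    rw [add_left_inj, hg]
    simp only
    rw [Complex.cpow_sub _ _ ht', Complex.cpow_add _ _ ht', Complex.cpow_one]
    field_simp
  have hKi : IntegrableOn (fun t : ℝ => (t : ℂ) ^ (ν - 1) * e t) (Set.Ioi T) :=
    (integrableOn_expKernel hz hz ν).mono_set (Set.Ioi_subset_Ioi (by linarith))
  obtain ⟨hi, hiv⟩ := integral_Ioi_inv_sq hT
  have hb : ∀ t ∈ Set.Ioi T, ‖e t * g' t‖ ≤ (‖ν‖ + 3) * ((t - 1) ^ 2)⁻¹ := by
    intro t ht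
    have ht : T < t := ht
    rw [norm_mul]
    have h1 := norm_exp_neg_le_one hz.le (show 0 < t by linarith)
    exact (mul_le_of_le_one_left (norm_nonneg _) h1).trans (hg'b t (by linarith))
  have hb' := (ae_restrict_iff' (μ := volume) measurableSet_Ioi).2 (Filter.Eventually.of_forall hb)
  have hHi : IntegrableOn (fun t : ℝ => e t * g' t) (Set.Ioi T) := by
    refine Integrable.mono' (hi.const_mul (‖ν‖ + 3)) ?_ hb'
    refine ContinuousOn.aestronglyMeasurable (fun t ht => ?_) measurableSet_Ioi
    have ht : T < t := ht
    have ht0 : 0 < t := by linarith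
    refine ContinuousAt.continuousWithinAt ((hed t ht0).continuousAt.mul ?_)
    have c1 : ∀ s : ℂ, ContinuousAt (fun t : ℝ => (t : ℂ) ^ s) t := fun s =>
      Complex.continuousAt_ofReal_cpow_const _ _ (Or.inr ht0.ne')
    have c2 : ContinuousAt (fun t : ℝ => (t : ℂ)) t := Complex.continuous_ofReal.continuousAt
    exact ((((continuousAt_const.mul (c1 _)).mul ((c2.pow 2).sub continuousAt_const)).sub
      ((c1 _).mul (continuousAt_const.mul c2))).div (((c2.pow 2).sub continuousAt_const).pow 2)
      (pow_ne_zero _ (hne t (by linarith))))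
  have hlim : Filter.Tendsto (fun t => e t * g t) Filter.atTop (nhds 0) := by
    have h0 : Filter.Tendsto (fun t : ℝ => (t - 1)⁻¹) Filter.atTop (nhds 0) :=
      tendsto_inv_atTop_zero.comp (Filter.tendsto_atTop_add_const_right _ (-1) Filter.tendsto_id)
    refine squeeze_zero_norm' ?_ h0
    filter_upwards [Filter.eventually_gt_atTop 1] with t ht
    rw [norm_mul]
    exact (mul_le_of_le_one_left (norm_nonneg _)
      (norm_exp_neg_le_one hz.le (by linarith))).trans (hgb t ht)
  have key := integral_Ioi_of_hasDerivAt_of_tendsto' hderiv ((hKi.const_mul (-z)).add hHi) hlim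
  rw [integral_add (hKi.const_mul (-z)) hHi, integral_const_mul] at key
  have h1 : ‖∫ t in Set.Ioi T, e t * g' t‖ ≤ (‖ν‖ + 3) * (T - 1)⁻¹ := by
    rw [← hiv, ← integral_const_mul]
    exact norm_integral_le_of_norm_le (hi.const_mul _) hb'
  have h2 : ‖e T * g T‖ ≤ (T - 1)⁻¹ := by
    rw [norm_mul]
    exact (mul_le_of_le_one_left (norm_nonneg _)
      (norm_exp_neg_le_one hz.le (by linarith))).trans (hgb T hT)
  have h3 : z * (∫ t in Set.Ioi T, (t : ℂ) ^ (ν - 1) * e t) =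
      e T * g T + ∫ t in Set.Ioi T, e t * g' t := by linear_combination -key
  have h4 := congrArg norm h3
  rw [norm_mul] at h4
  have h5 := h4.le.trans ((norm_add_le _ _).trans (add_le_add h2 h1))
  rw [le_div_iff₀ (mul_pos (norm_pos_iff.2 hz0) (by linarith))]
  have h6 := mul_le_mul_of_nonneg_right h5 (show 0 ≤ T - 1 by linarith)
  have h7 : (T - 1)⁻¹ * (T - 1) = 1 := inv_mul_cancel₀ (by linarith)
  calc _ = ‖z‖ * ‖∫ t in Set.Ioi T, (t : ℂ) ^ (ν - 1) * e t‖ * (T - 1) := by rw [he]; ring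
    _ ≤ _ := h6
    _ = ‖ν‖ + 4 := by rw [add_mul, mul_assoc, h7]; ring

theorem norm_integral_Ioi_one_expKernel_le {z : ℂ} (hz : 0 < z.re) {ν : ℂ} (hν : ν.re = 0) :
    ‖∫ t in Set.Ioi (1 : ℝ), (t : ℂ) ^ (ν - 1) * Complex.exp (-(z * t + z / t))‖ ≤
      (‖ν‖ + 5) / √‖z‖ := by
  have hz0 : 0 < ‖z‖ := norm_pos_iff.2 fun h => by simp [h] at hz
  have hs : 0 < √‖z‖ := Real.sqrt_pos.2 hz0
  have hT : 1 < 1 + (√‖z‖)⁻¹ := by linarith [inv_pos.2 hs]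
  have hi := integrableOn_expKernel hz hz ν
  rw [← Set.Ioc_union_Ioi_eq_Ioi hT.le, setIntegral_union (Set.Ioc_disjoint_Ioi le_rfl)
    measurableSet_Ioi
    (hi.mono_set (Set.Ioc_subset_Ioi_self.trans (Set.Ioi_subset_Ioi zero_le_one)))
    (hi.mono_set (Set.Ioi_subset_Ioi (by linarith)))]
  have h1 := norm_integral_Ioi_expKernel_le hz hν hT
  have h2 : ‖∫ t in Set.Ioc 1 (1 + (√‖z‖)⁻¹),
      (t : ℂ) ^ (ν - 1) * Complex.exp (-(z * t + z / t))‖ ≤ 1 * (√‖z‖)⁻¹ := by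
    refine (norm_setIntegral_le_of_norm_le_const (C := 1) measure_Ioc_lt_top
      fun t ht => ?_).trans (le_of_eq ?_)
    · have ht0 : 0 < t := by linarith [ht.1]
      rw [norm_mul, Complex.norm_cpow_eq_rpow_re_of_pos ht0]
      refine mul_le_one₀ ?_ (norm_nonneg _) (norm_exp_neg_le_one hz.le ht0)
      exact Real.rpow_le_one_of_one_le_of_nonpos ht.1.le (by simp [hν])
    · rw [measureReal_def, Real.volume_Ioc, add_sub_cancel_left,
        ENNReal.toReal_ofReal (by positivity)]
  refine (norm_add_le _ _).trans ((add_le_add h2 h1).trans (le_of_eq ?_))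
  have : ‖z‖ = √‖z‖ * √‖z‖ := (Real.mul_self_sqrt hz0.le).symm
  rw [add_sub_cancel_left]
  nth_rewrite 2 [this]
  field_simp
  ring

theorem norm_expKernel_le {z : ℂ} (hz : 0 < z.re) {ν : ℂ} (hν : ν.re = 0) :
    ‖expKernel z z ν‖ ≤ 2 * (‖ν‖ + 5) / √‖z‖ := by
  have hi := integrableOn_expKernel hz hz ν
  rw [expKernel, ← Set.Ioc_union_Ioi_eq_Ioi (zero_le_one' ℝ),
    setIntegral_union (Set.Ioc_disjoint_Ioi le_rfl) measurableSet_Ioi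
      (hi.mono_set Set.Ioc_subset_Ioi_self) (hi.mono_set (Set.Ioi_subset_Ioi zero_le_one)),
    integral_Ioc_inv]
  have e : ∫ t in Set.Ioi (1 : ℝ), ((t ^ (-2 : ℝ) : ℝ) : ℂ) *
      (((t⁻¹ : ℝ) : ℂ) ^ (ν - 1) * Complex.exp (-(z * ((t⁻¹ : ℝ) : ℂ) + z / ((t⁻¹ : ℝ) : ℂ)))) =
      ∫ t in Set.Ioi (1 : ℝ), (t : ℂ) ^ (-ν - 1) * Complex.exp (-(z * t + z / t)) := by
    refine setIntegral_congr_fun measurableSet_Ioi fun t ht => ?_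
    have ht0 : 0 < t := zero_lt_one.trans ht
    have ht' : (t : ℂ) ≠ 0 := Complex.ofReal_ne_zero.2 ht0.ne'
    rw [Complex.ofReal_cpow ht0.le, Complex.ofReal_inv, Complex.inv_cpow, ← Complex.cpow_neg,
      ← mul_assoc, ← Complex.cpow_add _ _ ht']
    · congr 2
      · push_cast; ring
      · rw [div_inv_eq_mul, div_eq_mul_inv]; ring
    · rw [Complex.arg_ofReal_of_nonneg ht0.le]; exact Real.pi_ne_zero.symm
  rw [e]
  have h1 := norm_integral_Ioi_one_expKernel_le hz hν
  have h2 := norm_integral_Ioi_one_expKernel_le hz (ν := -ν) (by simp [hν])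
  rw [norm_neg] at h2
  refine (norm_add_le _ _).trans ((add_le_add h2 h1).trans (le_of_eq ?_))
  ring

theorem expKernel_self_eq {z : ℂ} (hz : 0 < z.re) {ν : ℂ} (hν : ν.im ≠ 0) :
    expKernel z z ν = Real.pi / Complex.sin (Real.pi * ν) *
      (z ^ (-ν) * besselSeries (-ν) (z * z) - z ^ ν * besselSeries ν (z * z)) := by
  have hU : IsOpen {z : ℂ | 0 < z.re} := isOpen_lt continuous_const Complex.continuous_re
  have hslit : ∀ z ∈ {z : ℂ | 0 < z.re}, z ∈ Complex.slitPlane := fun z hz => Or.inl hz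
  have hd : ∀ s : ℂ, DifferentiableOn ℂ (fun z : ℂ => z ^ s * besselSeries s (z * z))
      {z : ℂ | 0 < z.re} := fun s =>
    (differentiableOn_id.cpow_const hslit).mul
      ((differentiable_besselSeries s).comp
        (differentiable_id.mul differentiable_id)).differentiableOn
  refine eqOn_of_eq_ofReal hU (convex_halfSpace_re_gt 0).isPreconnected
    (differentiableOn_expKernel ν) (((hd (-ν)).sub (hd ν)).const_mul _) (x₀ := 1) (by simp)
    (fun x hx => ?_) hz
  have hx : 0 < x := by simpa using hx
  exact expKernel_eq hx hx hν

theorem norm_dblSeries_term_le {p q : ℂ} (hp : p.re = 0) (hq : q.re = 0) {A B : ℂ} {a b : ℝ}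
    (hA : ‖A‖ ≤ a) (hB : ‖B‖ ≤ b) (n : ℕ × ℕ) :
    ‖Complex.Gamma (n.1 + n.2 + p + q + 1) * A ^ n.1 * B ^ n.2 *
      ((n.1.factorial : ℂ)⁻¹ * (Complex.Gamma (q + n.1 + 1))⁻¹ *
        (Complex.Gamma (p + q + n.1 + 1))⁻¹) *
      ((n.2.factorial : ℂ)⁻¹ * (Complex.Gamma (p + n.2 + 1))⁻¹ *
        (Complex.Gamma (p + q + n.2 + 1))⁻¹)‖ ≤
    ‖(Complex.Gamma (q + 1))⁻¹‖ * ‖(Complex.Gamma (p + 1))⁻¹‖ *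
      ‖(Complex.Gamma (p + q + 1))⁻¹‖ ^ 2 *
        ((2 * a) ^ n.1 / n.1.factorial * ((2 * b) ^ n.2 / n.2.factorial)) := by
  obtain ⟨N, M⟩ := n
  have hpq : (p + q).re = 0 := by simp [hp, hq]
  have ha : 0 ≤ a := (norm_nonneg _).trans hA
  have hb : 0 ≤ b := (norm_nonneg _).trans hB
  have hG := norm_Gamma_add_nat_le hpq (N + M)
  rw [show p + q + ((N + M : ℕ) : ℂ) + 1 = N + M + p + q + 1 by push_cast; ring] at hG
  have hc : ((N + M).factorial : ℝ) ≤ 2 ^ N * 2 ^ M * (N.factorial * M.factorial) := by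
    have h1 := Nat.add_choose_mul_factorial_mul_factorial N M
    have h2 := Nat.choose_le_two_pow (N + M) M
    rw [← h1, ← pow_add]
    push_cast
    rw [mul_assoc]
    gcongr
    exact_mod_cast h2
  have hN : (1 : ℝ) ≤ N.factorial := by exact_mod_cast Nat.factorial_pos N
  have hM : (1 : ℝ) ≤ M.factorial := by exact_mod_cast Nat.factorial_pos M
  simp only
  rw [norm_mul, norm_mul, norm_mul, norm_mul, norm_mul, norm_mul, norm_mul, norm_mul, norm_pow,
    norm_pow, norm_inv (N.factorial : ℂ), norm_inv (M.factorial : ℂ), Complex.norm_natCast,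
    Complex.norm_natCast]
  calc _ ≤ ((N + M).factorial : ℝ) * a ^ N * b ^ M *
        ((N.factorial : ℝ)⁻¹ * (‖(Complex.Gamma (q + 1))⁻¹‖ / N.factorial) *
          (‖(Complex.Gamma (p + q + 1))⁻¹‖ / N.factorial)) *
        ((M.factorial : ℝ)⁻¹ * (‖(Complex.Gamma (p + 1))⁻¹‖ / M.factorial) *
          (‖(Complex.Gamma (p + q + 1))⁻¹‖ / M.factorial)) := by
        gcongr
        · exact norm_inv_Gamma_add_nat_le hq N
        · exact norm_inv_Gamma_add_nat_le hpq N
        · exact norm_inv_Gamma_add_nat_le hp M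
        · exact norm_inv_Gamma_add_nat_le hpq M
    _ ≤ (2 ^ N * 2 ^ M * (N.factorial * M.factorial)) * a ^ N * b ^ M *
        ((N.factorial : ℝ)⁻¹ * (‖(Complex.Gamma (q + 1))⁻¹‖ / N.factorial) *
          (‖(Complex.Gamma (p + q + 1))⁻¹‖ / 1)) *
        ((M.factorial : ℝ)⁻¹ * (‖(Complex.Gamma (p + 1))⁻¹‖ / M.factorial) *
          (‖(Complex.Gamma (p + q + 1))⁻¹‖ / 1)) := by gcongr
    _ = _ := by
        rw [mul_pow, mul_pow]
        field_simp

theorem summable_dblSeries_bound (a b : ℝ) :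
    Summable fun n : ℕ × ℕ => (2 * a) ^ n.1 / n.1.factorial * ((2 * b) ^ n.2 / n.2.factorial) := by
  set f : ℝ → ℕ → ℝ := fun x n => x ^ n / n.factorial with hf
  have h : ∀ x : ℝ, Summable fun n : ℕ => ‖f x n‖ := fun x =>
    (Real.summable_pow_div_factorial x).norm
  exact summable_mul_of_summable_norm (f := f (2 * a)) (g := f (2 * b)) (h (2 * a)) (h (2 * b))

theorem differentiable_dblSeries_comp {p q : ℂ} (hp : p.re = 0) (hq : q.re = 0) {A B : ℂ → ℂ}
    (hA : Differentiable ℂ A) (hB : Differentiable ℂ B) :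
    Differentiable ℂ fun ζ => dblSeries p q (A ζ) (B ζ) := by
  intro z
  set U : Set ℂ := {ζ | ‖A ζ‖ < ‖A z‖ + 1} ∩ {ζ | ‖B ζ‖ < ‖B z‖ + 1}
  have hU : IsOpen U := (isOpen_lt hA.continuous.norm continuous_const).inter
    (isOpen_lt hB.continuous.norm continuous_const)
  have h : DifferentiableOn ℂ (fun ζ => dblSeries p q (A ζ) (B ζ)) U := by
    refine Complex.differentiableOn_tsum_of_summable_norm
      ((summable_dblSeries_bound (‖A z‖ + 1) (‖B z‖ + 1)).mul_left _) (fun n => ?_) hU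
      fun n ζ hζ => norm_dblSeries_term_le hp hq (le_of_lt hζ.1) (le_of_lt hζ.2) n
    exact Differentiable.differentiableOn
      ((((hA.pow _).const_mul _).mul (hB.pow _)).mul_const _ |>.mul_const _)
  exact h.differentiableAt (hU.mem_nhds (by simp [U]))

theorem differentiable_sixTerm {α β : ℂ} (hα : α.re = 0) (hβ : β.re = 0) {P Q : ℂ → ℂ → ℂ}
    {A B : ℂ → ℂ} (hP : ∀ s, Differentiable ℂ fun ζ => P ζ s)
    (hQ : ∀ s, Differentiable ℂ fun ζ => Q ζ s)
    (hA : Differentiable ℂ A) (hB : Differentiable ℂ B) :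
    Differentiable ℂ fun ζ => sixTerm α β (P ζ) (Q ζ) (A ζ) (B ζ) := by
  have hD : ∀ p q : ℂ, p.re = 0 → q.re = 0 → ∀ s t, Differentiable ℂ fun ζ =>
      P ζ s * Q ζ t * dblSeries p q (A ζ) (B ζ) := fun p q hp hq s t =>
    ((hP s).mul (hQ t)).mul (differentiable_dblSeries_comp hp hq hA hB)
  unfold sixTerm
  refine (((((hD _ _ ?_ ?_ _ _).sub (hD _ _ ?_ ?_ _ _)).sub (hD _ _ ?_ ?_ _ _)).add
    (hD _ _ ?_ ?_ _ _)).sub (hD _ _ ?_ ?_ _ _)).add (hD _ _ ?_ ?_ _ _) <;> simp [hα, hβ]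

theorem integrableOn_kernelMellin_bound :
    IntegrableOn (fun v : ℝ => v⁻¹ * ((√(√(1 + v)))⁻¹ * (√(√(1 + 1 / v)))⁻¹)) (Set.Ioi 0) := by
  have hroot : ∀ x : ℝ, 0 < x → √(√x) = x ^ (1 / 4 : ℝ) := fun x hx => by
    rw [Real.sqrt_eq_rpow, Real.sqrt_eq_rpow, ← Real.rpow_mul hx.le]; norm_num
  have hm : AEStronglyMeasurable (fun v : ℝ => v⁻¹ * ((√(√(1 + v)))⁻¹ * (√(√(1 + 1 / v)))⁻¹))
      volume := Measurable.aestronglyMeasurable (by fun_prop)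
  have h1 : ∀ x : ℝ, 0 ≤ x → 1 ≤ √(√(1 + x)) := fun x hx => by
    rw [Real.one_le_sqrt, Real.one_le_sqrt]; linarith
  rw [← Set.Ioc_union_Ioi_eq_Ioi (zero_le_one' ℝ)]
  refine IntegrableOn.union ?_ ?_
  · have hi : IntegrableOn (fun v : ℝ => v ^ (-(3 / 4) : ℝ)) (Set.Ioc 0 1) :=
      (intervalIntegrable_iff_integrableOn_Ioc_of_le zero_le_one).1
        (intervalIntegral.intervalIntegrable_rpow' (by norm_num))
    refine Integrable.mono' hi hm.restrict ((ae_restrict_iff' measurableSet_Ioc).2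
      (Filter.Eventually.of_forall fun v hv => ?_))
    have hv0 : 0 < v := hv.1
    rw [Real.norm_of_nonneg (by positivity)]
    have h2 : (v ^ (1 / 4 : ℝ))⁻¹ ≤ √(√(1 + 1 / v)) := by
      rw [hroot _ (by positivity), ← Real.inv_rpow hv0.le, inv_eq_one_div]
      gcongr
      linarith
    calc _ ≤ v⁻¹ * ((1 : ℝ)⁻¹ * ((v ^ (1 / 4 : ℝ))⁻¹)⁻¹) := by
          gcongr
          exact h1 v hv0.le
      _ = _ := by
          rw [inv_one, one_mul, inv_inv, ← Real.rpow_neg_one, ← Real.rpow_add hv0]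
          norm_num
  · have hi : IntegrableOn (fun v : ℝ => v ^ (-(5 / 4) : ℝ)) (Set.Ioi 1) :=
      integrableOn_Ioi_rpow_of_lt (by norm_num) one_pos
    refine Integrable.mono' hi hm.restrict ((ae_restrict_iff' measurableSet_Ioi).2
      (Filter.Eventually.of_forall fun v hv => ?_))
    have hv0 : 0 < v := zero_lt_one.trans hv
    rw [Real.norm_of_nonneg (by positivity)]
    have h2 : v ^ (1 / 4 : ℝ) ≤ √(√(1 + v)) := by
      rw [hroot _ (by positivity)]
      gcongr
      linarith
    calc _ ≤ v⁻¹ * ((v ^ (1 / 4 : ℝ))⁻¹ * (1 : ℝ)⁻¹) := by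
          gcongr
          exact h1 (1 / v) (by positivity)
      _ = _ := by
          rw [inv_one, mul_one, ← Real.rpow_neg_one, ← Real.rpow_neg hv0.le, ← Real.rpow_add hv0]
          norm_num

/-- The closed form of the `K`-Bessel kernel at `x * exp ζ`, entire in `ζ`. -/
noncomputable def kernelExt (ν : ℂ) (x : ℝ) (ζ : ℂ) : ℂ :=
  Real.pi / Complex.sin (Real.pi * ν) *
    ((x : ℂ) ^ (-ν) * Complex.exp (-ν * ζ) *
        besselSeries (-ν) ((x * Complex.exp ζ) * (x * Complex.exp ζ)) -
      (x : ℂ) ^ ν * Complex.exp (ν * ζ) *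
        besselSeries ν ((x * Complex.exp ζ) * (x * Complex.exp ζ)))

theorem ofReal_mul_exp_cpow {x : ℝ} (hx : 0 < x) {ζ : ℂ} (hζ : |ζ.im| < Real.pi / 2) (s : ℂ) :
    ((x : ℂ) * Complex.exp ζ) ^ s = (x : ℂ) ^ s * Complex.exp (s * ζ) := by
  have hx' : (x : ℂ) ≠ 0 := Complex.ofReal_ne_zero.2 hx.ne'
  have h1 := abs_lt.1 hζ
  have hpi := Real.pi_pos
  rw [Complex.cpow_def_of_ne_zero (mul_ne_zero hx' (Complex.exp_ne_zero _)),
    Complex.cpow_def_of_ne_zero hx', Complex.log_ofReal_mul hx (Complex.exp_ne_zero _),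
    Complex.log_exp (by linarith) (by linarith), ← Complex.exp_add, Complex.ofReal_log hx.le]
  congr 1
  ring

theorem expKernel_mul_exp_eq {x : ℝ} (hx : 0 < x) {ζ : ℂ} (hζ : |ζ.im| < Real.pi / 2) {ν : ℂ}
    (hν : ν.im ≠ 0) :
    expKernel (x * Complex.exp ζ) (x * Complex.exp ζ) ν = kernelExt ν x ζ ∧
      0 < ((x : ℂ) * Complex.exp ζ).re := by
  have h1 := abs_lt.1 hζ
  have hre : 0 < ((x : ℂ) * Complex.exp ζ).re := by
    rw [Complex.re_ofReal_mul, Complex.exp_re]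
    have := Real.cos_pos_of_mem_Ioo ⟨h1.1, h1.2⟩
    positivity
  refine ⟨?_, hre⟩
  rw [expKernel_self_eq hre hν, ofReal_mul_exp_cpow hx hζ, ofReal_mul_exp_cpow hx hζ, kernelExt]

theorem differentiable_kernelExt (ν : ℂ) (x : ℝ) : Differentiable ℂ (kernelExt ν x) := by
  have h : ∀ s : ℂ, Differentiable ℂ fun ζ : ℂ => (x : ℂ) ^ s * Complex.exp (s * ζ) *
      besselSeries s ((x * Complex.exp ζ) * (x * Complex.exp ζ)) := fun s => by
    have h1 := differentiable_besselSeries s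
    fun_prop
  exact ((h (-ν)).sub (h ν)).const_mul _

theorem continuousOn_kernelExt (ν ζ : ℂ) : ContinuousOn (fun x => kernelExt ν x ζ) (Set.Ioi 0) := by
  intro x hx
  have hx : 0 < x := hx
  have h : ∀ s : ℂ, ContinuousAt (fun x : ℝ => (x : ℂ) ^ s * Complex.exp (s * ζ) *
      besselSeries s ((x * Complex.exp ζ) * (x * Complex.exp ζ))) x := fun s => by
    have h1 := (differentiable_besselSeries s).continuous
    refine ((Complex.continuousAt_ofReal_cpow_const _ _ (Or.inr hx.ne')).mul_const _).mul ?_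
    exact Continuous.continuousAt (by fun_prop)
  exact (((h (-ν)).sub (h ν)).const_mul _).continuousWithinAt

theorem norm_kernelExt_le {x : ℝ} (hx : 0 < x) {ζ : ℂ} (hζ : |ζ.im| ≤ Real.pi / 2) {ν : ℂ}
    (hν : ν.re = 0) (hν' : ν.im ≠ 0) :
    ‖kernelExt ν x ζ‖ ≤ 2 * (‖ν‖ + 5) / √(x * Real.exp ζ.re) := by
  set C := 2 * (‖ν‖ + 5) / √(x * Real.exp ζ.re)
  set p : ℝ → ℂ := fun t => (ζ.re : ℂ) + t * ζ.im * Complex.I with hp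
  have hpre : ∀ t, (p t).re = ζ.re := fun t => by simp [hp]
  have hpim : ∀ t, (p t).im = t * ζ.im := fun t => by simp [hp]
  have hcl : IsClosed {t : ℝ | ‖kernelExt ν x (p t)‖ ≤ C} := by
    refine isClosed_le ?_ continuous_const
    exact ((differentiable_kernelExt ν x).continuous.comp (by fun_prop)).norm
  have hsub : Set.Ico (0 : ℝ) 1 ⊆ {t : ℝ | ‖kernelExt ν x (p t)‖ ≤ C} := by
    intro t ht
    have him : |(p t).im| < Real.pi / 2 := by
      rw [hpim, abs_mul, abs_of_nonneg ht.1]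
      have hpi := Real.pi_pos
      nlinarith [abs_nonneg ζ.im, ht.1, ht.2]
    obtain ⟨h1, h2⟩ := expKernel_mul_exp_eq hx him hν'
    have h3 := norm_expKernel_le h2 hν
    rw [h1, norm_mul, Complex.norm_exp, hpre, Complex.norm_real, Real.norm_of_nonneg hx.le] at h3
    exact h3
  have h1 : (1 : ℝ) ∈ closure (Set.Ico (0 : ℝ) 1) := by
    rw [closure_Ico zero_ne_one]; exact ⟨zero_le_one, le_rfl⟩
  have h2 := (hcl.closure_subset_iff.2 hsub) h1
  have h3 : p 1 = ζ := Complex.ext (hpre 1) (by rw [hpim, one_mul])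
  rwa [Set.mem_ofPred_eq, h3] at h2

/-- The integrand of `kernelMellin` after rotating both arguments. -/
noncomputable def rotatedIntegrand (ν α : ℂ) (r₁ r₂ η₁ η₂ : ℝ) (ζ : ℂ) (v : ℝ) : ℂ :=
  (v : ℂ) ^ (α - 1) * (kernelExt ν (r₁ * √(1 + v)) (η₁ * ζ) *
    kernelExt ν (r₂ * √(1 + 1 / v)) (η₂ * ζ))

theorem aestronglyMeasurable_rotatedIntegrand (ν α : ℂ) {r₁ r₂ : ℝ} (hr₁ : 0 < r₁) (hr₂ : 0 < r₂)
    (η₁ η₂ : ℝ) (ζ : ℂ) :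
    AEStronglyMeasurable (rotatedIntegrand ν α r₁ r₂ η₁ η₂ ζ) (volume.restrict (Set.Ioi 0)) := by
  refine ContinuousOn.aestronglyMeasurable (fun v hv => ?_) measurableSet_Ioi
  have hv : 0 < v := hv
  have h1 : ContinuousAt (fun v : ℝ => r₁ * √(1 + v)) v := by fun_prop
  have h2 : ContinuousAt (fun v : ℝ => r₂ * √(1 + 1 / v)) v := by
    have := hv.ne'
    fun_prop (disch := assumption)
  have k1 := ((continuousOn_kernelExt ν (η₁ * ζ)).continuousAt
    (Ioi_mem_nhds (show 0 < r₁ * √(1 + v) by positivity))).comp (f := fun v : ℝ => r₁ * √(1 + v)) h1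
  have k2 := ((continuousOn_kernelExt ν (η₂ * ζ)).continuousAt
    (Ioi_mem_nhds (show 0 < r₂ * √(1 + 1 / v) by positivity))).comp
    (f := fun v : ℝ => r₂ * √(1 + 1 / v)) h2
  exact ((Complex.continuousAt_ofReal_cpow_const _ _ (Or.inr hv.ne')).mul
    (k1.mul k2)).continuousWithinAt

theorem norm_rotatedIntegrand_le {ν α : ℂ} (hν : ν.re = 0) (hν' : ν.im ≠ 0) (hα : α.re = 0)
    {r₁ r₂ : ℝ} (hr₁ : 0 < r₁) (hr₂ : 0 < r₂) {η₁ η₂ : ℝ} (hη₁ : |η₁| ≤ 1) (hη₂ : |η₂| ≤ 1)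
    {ζ : ℂ} (hζ : |ζ.re| ≤ 1) (hζ' : |ζ.im| ≤ Real.pi / 2) {v : ℝ} (hv : 0 < v) :
    ‖rotatedIntegrand ν α r₁ r₂ η₁ η₂ ζ v‖ ≤
      (2 * (‖ν‖ + 5) / √(r₁ * Real.exp (-1))) * (2 * (‖ν‖ + 5) / √(r₂ * Real.exp (-1))) *
        (v⁻¹ * ((√(√(1 + v)))⁻¹ * (√(√(1 + 1 / v)))⁻¹)) := by
  have key : ∀ (η r x : ℝ), |η| ≤ 1 → 0 < r → 0 < x → ‖kernelExt ν (r * √x) (η * ζ)‖ ≤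
      2 * (‖ν‖ + 5) / √(r * Real.exp (-1)) * (√(√x))⁻¹ := by
    intro η r x hη hr hx
    have hsx : 0 < √x := Real.sqrt_pos.2 hx
    have him : |((η : ℂ) * ζ).im| ≤ Real.pi / 2 := by
      rw [Complex.im_ofReal_mul, abs_mul]
      nlinarith [abs_nonneg ζ.im, abs_nonneg η]
    have hre : -1 ≤ ((η : ℂ) * ζ).re := by
      rw [Complex.re_ofReal_mul]
      have : |η * ζ.re| ≤ 1 := by
        rw [abs_mul]; nlinarith [abs_nonneg ζ.re, abs_nonneg η]
      exact (abs_le.1 this).1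
    refine (norm_kernelExt_le (by positivity) him hν hν').trans ?_
    rw [← div_eq_mul_inv, div_div, ← Real.sqrt_mul (by positivity)]
    rw [mul_right_comm r (√x)]
    gcongr
  rw [rotatedIntegrand, norm_mul, norm_mul, Complex.norm_cpow_eq_rpow_re_of_pos hv]
  have h1 := key η₁ r₁ (1 + v) hη₁ hr₁ (by positivity)
  have h2 := key η₂ r₂ (1 + 1 / v) hη₂ hr₂ (by positivity)
  have h3 : v ^ (α - 1).re = v⁻¹ := by
    rw [← Real.rpow_neg_one]; congr 1; simp [hα]
  rw [h3]
  calc _ ≤ v⁻¹ * ((2 * (‖ν‖ + 5) / √(r₁ * Real.exp (-1)) * (√(√(1 + v)))⁻¹) *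
        (2 * (‖ν‖ + 5) / √(r₂ * Real.exp (-1)) * (√(√(1 + 1 / v)))⁻¹)) := by gcongr
    _ = _ := by ring

theorem integrableOn_rotatedIntegrand {ν α : ℂ} (hν : ν.re = 0) (hν' : ν.im ≠ 0) (hα : α.re = 0)
    {r₁ r₂ : ℝ} (hr₁ : 0 < r₁) (hr₂ : 0 < r₂) {η₁ η₂ : ℝ} (hη₁ : |η₁| ≤ 1) (hη₂ : |η₂| ≤ 1)
    {ζ : ℂ} (hζ : |ζ.re| ≤ 1) (hζ' : |ζ.im| ≤ Real.pi / 2) :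
    IntegrableOn (rotatedIntegrand ν α r₁ r₂ η₁ η₂ ζ) (Set.Ioi 0) := by
  refine Integrable.mono' (integrableOn_kernelMellin_bound.const_mul
      ((2 * (‖ν‖ + 5) / √(r₁ * Real.exp (-1))) * (2 * (‖ν‖ + 5) / √(r₂ * Real.exp (-1)))))
    (aestronglyMeasurable_rotatedIntegrand ν α hr₁ hr₂ η₁ η₂ ζ) ?_
  filter_upwards [ae_restrict_mem measurableSet_Ioi] with v hv
  exact norm_rotatedIntegrand_le hν hν' hα hr₁ hr₂ hη₁ hη₂ hζ hζ' hv

/-- `kernelMellin_eq` continued to complex arguments on the boundary of the right half plane. -/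
theorem integral_rotatedIntegrand_eq {α β : ℂ} (hα : α.re = 0) (hβ : β.re = 0) (hβ' : β.im ≠ 0)
    (hs : (α + β).im ≠ 0) (hd : (α - β).im ≠ 0) {r₁ r₂ : ℝ} (hr₁ : 0 < r₁) (hr₂ : 0 < r₂)
    {η₁ η₂ : ℝ} (hη₁ : |η₁| ≤ 1) (hη₂ : |η₂| ≤ 1) :
    ∫ v in Set.Ioi 0, rotatedIntegrand (2 * β) α r₁ r₂ η₁ η₂ ((Real.pi / 2 : ℝ) * Complex.I) v =
      Real.pi ^ 3 / (Complex.sin (Real.pi * (α + β)) * Complex.sin (Real.pi * (α - β)) *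
        Complex.sin (Real.pi * (2 * β))) *
      sixTerm α β
        (fun s => (r₁ : ℂ) ^ s * Complex.exp (s * (η₁ * ((Real.pi / 2 : ℝ) * Complex.I))))
        (fun s => (r₂ : ℂ) ^ s * Complex.exp (s * (η₂ * ((Real.pi / 2 : ℝ) * Complex.I))))
        ((r₁ * Complex.exp (η₁ * ((Real.pi / 2 : ℝ) * Complex.I))) *
          (r₁ * Complex.exp (η₁ * ((Real.pi / 2 : ℝ) * Complex.I))))
        ((r₂ * Complex.exp (η₂ * ((Real.pi / 2 : ℝ) * Complex.I))) *
          (r₂ * Complex.exp (η₂ * ((Real.pi / 2 : ℝ) * Complex.I)))) := by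
  have hν : (2 * β).re = 0 := by simp [hβ]
  have hν' : (2 * β).im ≠ 0 := by simpa using hβ'
  have hpi := Real.pi_pos
  set f : ℂ → ℂ := fun ζ => ∫ v in Set.Ioi 0, rotatedIntegrand (2 * β) α r₁ r₂ η₁ η₂ ζ v with hf
  set g : ℂ → ℂ := fun ζ => Real.pi ^ 3 / (Complex.sin (Real.pi * (α + β)) *
        Complex.sin (Real.pi * (α - β)) * Complex.sin (Real.pi * (2 * β))) *
      sixTerm α β (fun s => (r₁ : ℂ) ^ s * Complex.exp (s * (η₁ * ζ)))
        (fun s => (r₂ : ℂ) ^ s * Complex.exp (s * (η₂ * ζ)))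
        ((r₁ * Complex.exp (η₁ * ζ)) * (r₁ * Complex.exp (η₁ * ζ)))
        ((r₂ * Complex.exp (η₂ * ζ)) * (r₂ * Complex.exp (η₂ * ζ))) with hg
  have hgd : Differentiable ℂ g := by
    refine (differentiable_sixTerm (P := fun ζ s => (r₁ : ℂ) ^ s * Complex.exp (s * (η₁ * ζ)))
      (Q := fun ζ s => (r₂ : ℂ) ^ s * Complex.exp (s * (η₂ * ζ)))
      hα hβ ?_ ?_ ?_ ?_).const_mul _ <;> fun_prop
  set U : Set ℂ := {ζ | |ζ.re| < 1 ∧ |ζ.im| < Real.pi / 2} with hUdef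
  have hUI : U = Complex.re ⁻¹' Set.Ioo (-1) 1 ∩
      Complex.im ⁻¹' Set.Ioo (-(Real.pi / 2)) (Real.pi / 2) := by
    ext ζ
    simp [hUdef, abs_lt]
  have hUo : IsOpen U := hUI ▸ (isOpen_Ioo.preimage Complex.continuous_re).inter
    (isOpen_Ioo.preimage Complex.continuous_im)
  have hUc : IsPreconnected U := hUI ▸
    (((convex_Ioo (-1 : ℝ) 1).linear_preimage Complex.reLm).inter
      ((convex_Ioo (-(Real.pi / 2)) (Real.pi / 2)).linear_preimage Complex.imLm)).isPreconnected
  have hfd : DifferentiableOn ℂ f U := by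
    refine differentiableOn_integral_of_dominated hUo
      (integrableOn_kernelMellin_bound.const_mul
        ((2 * (‖2 * β‖ + 5) / √(r₁ * Real.exp (-1))) * (2 * (‖2 * β‖ + 5) / √(r₂ * Real.exp (-1)))))
      (fun ζ _ => aestronglyMeasurable_rotatedIntegrand _ α hr₁ hr₂ η₁ η₂ ζ) ?_ ?_
    · refine Filter.Eventually.of_forall fun v => Differentiable.differentiableOn ?_
      have h1 := differentiable_kernelExt (2 * β) (r₁ * √(1 + v))
      have h2 := differentiable_kernelExt (2 * β) (r₂ * √(1 + 1 / v))
      unfold rotatedIntegrand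
      fun_prop
    · filter_upwards [ae_restrict_mem measurableSet_Ioi] with v hv ζ hζ
      exact norm_rotatedIntegrand_le hν hν' hα hr₁ hr₂ hη₁ hη₂ hζ.1.le hζ.2.le hv
  have hreal : ∀ x : ℝ, (x : ℂ) ∈ U → f x = g x := by
    intro x _
    have him : ∀ η : ℝ, |((η : ℂ) * x).im| < Real.pi / 2 := fun η => by
      simp; positivity
    have hz : ∀ {r : ℝ} (η : ℝ), 0 < r → 0 < r * Real.exp (η * x) := fun η hr => by positivity
    have h := kernelMellin_eq (hz η₁ hr₁) (hz η₂ hr₂) hα hβ hβ' hs hd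
    have hsix : ∀ {r : ℝ} (η : ℝ), 0 < r → (fun s : ℂ => ((r * Real.exp (η * x) : ℝ) : ℂ) ^ s) =
        fun s => (r : ℂ) ^ s * Complex.exp (s * (η * x)) := fun η hr => by
      funext s
      rw [← ofReal_mul_exp_cpow hr (him η)]
      push_cast; rfl
    have e1 : ∀ (r η : ℝ), ((r * Real.exp (η * x) : ℝ) : ℂ) = r * Complex.exp (η * x) := by
      intro r η; push_cast; rfl
    rw [hsix η₁ hr₁, hsix η₂ hr₂, e1, e1] at h
    rw [hg]
    refine Eq.trans ?_ h
    rw [hf, kernelMellin]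
    refine setIntegral_congr_fun measurableSet_Ioi fun v hv => ?_
    have hv : 0 < v := hv
    simp only [rotatedIntegrand]
    rw [← (expKernel_mul_exp_eq (show 0 < r₁ * √(1 + v) by positivity) (him η₁) hν').1,
      ← (expKernel_mul_exp_eq (show 0 < r₂ * √(1 + 1 / v) by positivity) (him η₂) hν').1]
    have e2 : ∀ r η t : ℝ, ((r * t : ℝ) : ℂ) * Complex.exp (η * x) =
        r * Complex.exp (η * x) * (t : ℝ) := by
      intro r η t; push_cast; ring
    rw [e2, e2]
  have hEq := eqOn_of_eq_ofReal hUo hUc hfd hgd.differentiableOn (x₀ := 0)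
    (by simp [hUdef]; positivity) hreal
  have hcont : ContinuousOn (fun θ : ℝ => f (θ * Complex.I)) (Set.Icc 0 (Real.pi / 2)) := by
    refine continuousOn_of_dominated
      (bound := fun v => (2 * (‖2 * β‖ + 5) / √(r₁ * Real.exp (-1))) *
        (2 * (‖2 * β‖ + 5) / √(r₂ * Real.exp (-1))) *
        (v⁻¹ * ((√(√(1 + v)))⁻¹ * (√(√(1 + 1 / v)))⁻¹)))
      (fun θ _ => aestronglyMeasurable_rotatedIntegrand _ α hr₁ hr₂ η₁ η₂ _) ?_
      (integrableOn_kernelMellin_bound.const_mul _) ?_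
    · intro θ hθ
      filter_upwards [ae_restrict_mem measurableSet_Ioi] with v hv
      refine norm_rotatedIntegrand_le hν hν' hα hr₁ hr₂ hη₁ hη₂ (by simp) ?_ hv
      simpa [abs_of_nonneg hθ.1] using hθ.2
    · refine Filter.Eventually.of_forall fun v => Continuous.continuousOn ?_
      have h1 := (differentiable_kernelExt (2 * β) (r₁ * √(1 + v))).continuous
      have h2 := (differentiable_kernelExt (2 * β) (r₂ * √(1 + 1 / v))).continuous
      unfold rotatedIntegrand
      fun_prop
  have hcg : Continuous fun θ : ℝ => g (θ * Complex.I) := hgd.continuous.comp (by fun_prop)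
  have hsub : Set.EqOn (fun θ : ℝ => f (θ * Complex.I)) (fun θ : ℝ => g (θ * Complex.I))
      (Set.Ico 0 (Real.pi / 2)) := fun θ hθ => hEq (by
    simpa [hUdef, abs_of_nonneg hθ.1] using hθ.2)
  have := hsub.of_subset_closure hcont hcg.continuousOn Set.Ico_subset_Icc_self
    (by rw [closure_Ico (by positivity)]) (Set.right_mem_Icc.2 (by positivity))
  exact this

theorem besselJ_two_mul (ν : ℂ) {x : ℝ} (hx : 0 < x) :
    besselJ ν (2 * x) = (x : ℂ) ^ ν * besselSeries ν (-((x : ℂ) * x)) := by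
  have hx' : (x : ℂ) ≠ 0 := Complex.ofReal_ne_zero.2 hx.ne'
  rw [besselJ, besselSeries, ← tsum_mul_left]
  refine tsum_congr fun k => ?_
  have h1 : (2 * x / 2 : ℝ) = x := by ring
  have h2 : (x : ℂ) ^ (2 * (k : ℂ)) = ((x : ℂ) * x) ^ k := by
    rw [← pow_two, ← pow_mul, ← Complex.cpow_natCast]
    push_cast; rfl
  rw [h1, Complex.cpow_add _ _ hx', h2, neg_pow ((x : ℂ) * x), div_eq_mul_inv, mul_inv]
  ring

theorem exp_mul_pi_div_two_sub (s : ℂ) :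
    Complex.exp (s * ((1 : ℝ) * ((Real.pi / 2 : ℝ) * Complex.I))) -
      Complex.exp (s * ((-1 : ℝ) * ((Real.pi / 2 : ℝ) * Complex.I))) =
      2 * Complex.I * Complex.sin (Real.pi * s / 2) := by
  rw [Complex.sin,
    show s * ((1 : ℝ) * ((Real.pi / 2 : ℝ) * Complex.I)) = Real.pi * s / 2 * Complex.I by
      push_cast; ring,
    show s * ((-1 : ℝ) * ((Real.pi / 2 : ℝ) * Complex.I)) = -(Real.pi * s / 2) * Complex.I by
      push_cast; ring]
  linear_combination (Complex.exp (Real.pi * s / 2 * Complex.I) -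
    Complex.exp (-(Real.pi * s / 2) * Complex.I)) * Complex.I_mul_I

theorem sq_ofReal_mul_exp_pi_div_two (r : ℝ) {η : ℝ} (hη : η = 1 ∨ η = -1) :
    ((r : ℂ) * Complex.exp (η * ((Real.pi / 2 : ℝ) * Complex.I))) *
      (r * Complex.exp (η * ((Real.pi / 2 : ℝ) * Complex.I))) = -((r : ℂ) * r) := by
  have h : Complex.exp (Real.pi / 2 * Complex.I) = Complex.I := Complex.exp_pi_div_two_mul_I
  rcases hη with rfl | rfl
  · push_cast
    rw [one_mul, h]
    linear_combination (r : ℂ) * r * Complex.I_mul_I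
  · push_cast
    rw [neg_one_mul, Complex.exp_neg, h, Complex.inv_I]
    linear_combination (r : ℂ) * r * Complex.I_mul_I

theorem Jplus_eq_kernelExt {ν : ℂ} (hν : ν.im ≠ 0) {x : ℝ} (hx : 0 < x) :
    Jplus ν x = Complex.I / 2 *
      (kernelExt ν x ((1 : ℝ) * ((Real.pi / 2 : ℝ) * Complex.I)) -
        kernelExt ν x ((-1 : ℝ) * ((Real.pi / 2 : ℝ) * Complex.I))) := by
  have hs : Complex.sin (Real.pi * ν) ≠ 0 := sin_pi_mul_ne_zero_of_im_ne_zero hν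
  have h2 : Complex.sin (Real.pi * ν) =
      2 * Complex.sin (Real.pi * ν / 2) * Complex.cos (Real.pi * ν / 2) := by
    rw [← Complex.sin_two_mul]; congr 1; ring
  have hc : Complex.cos (Real.pi * ν / 2) ≠ 0 := fun h => hs (by rw [h2, h, mul_zero])
  have hs' : Complex.sin (Real.pi * ν / 2) ≠ 0 := fun h => hs (by rw [h2, h]; ring)
  have e1 := exp_mul_pi_div_two_sub ν
  have e2 := exp_mul_pi_div_two_sub (-ν)
  have e3 : Complex.sin (Real.pi * -ν / 2) = -Complex.sin (Real.pi * ν / 2) := by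
    rw [← Complex.sin_neg]; congr 1; ring
  rw [e3] at e2
  rw [Jplus, besselJ_two_mul _ hx, besselJ_two_mul _ hx, kernelExt, kernelExt,
    sq_ofReal_mul_exp_pi_div_two x (Or.inl rfl), sq_ofReal_mul_exp_pi_div_two x (Or.inr rfl), h2]
  rw [sub_eq_iff_eq_add] at e1 e2
  rw [e1, e2]
  generalize besselSeries ν _ = S
  generalize besselSeries (-ν) _ = S'
  generalize Complex.sin (Real.pi * ν / 2) = t at *
  field_simp
  linear_combination (2 * t * ((x : ℂ) ^ ν * S + (x : ℂ) ^ (-ν) * S')) * Complex.I_sq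

theorem integral_Jplus_mul_Jplus {α β : ℂ} (hα : α.re = 0) (hβ : β.re = 0) (hβ' : β.im ≠ 0)
    (hs : (α + β).im ≠ 0) (hd : (α - β).im ≠ 0) {r₁ r₂ : ℝ} (hr₁ : 0 < r₁) (hr₂ : 0 < r₂) :
    ∫ v in Set.Ioi (0 : ℝ), (v : ℂ) ^ (α - 1) *
        (Jplus (2 * β) (r₁ * √(1 + v)) * Jplus (2 * β) (r₂ * √(1 + 1 / v))) =
      Real.pi ^ 3 / (Complex.sin (Real.pi * (α + β)) * Complex.sin (Real.pi * (α - β)) *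
        Complex.sin (Real.pi * (2 * β))) *
      sixTerm α β (fun s => (r₁ : ℂ) ^ s * Complex.sin (Real.pi * s / 2))
        (fun s => (r₂ : ℂ) ^ s * Complex.sin (Real.pi * s / 2)) (-((r₁ : ℂ) * r₁))
        (-((r₂ : ℂ) * r₂)) := by
  have hν : (2 * β).re = 0 := by simp [hβ]
  have hν' : (2 * β).im ≠ 0 := by simpa using hβ'
  have hpi := Real.pi_pos
  have hI : ∀ η₁ η₂ : ℝ, |η₁| ≤ 1 → |η₂| ≤ 1 → IntegrableOn
      (rotatedIntegrand (2 * β) α r₁ r₂ η₁ η₂ ((Real.pi / 2 : ℝ) * Complex.I)) (Set.Ioi 0) :=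
    fun η₁ η₂ h1 h2 => integrableOn_rotatedIntegrand hν hν' hα hr₁ hr₂ h1 h2 (by simp)
      (by simp [abs_of_pos (half_pos hpi)])
  have hE : ∀ η₁ η₂ : ℝ, |η₁| ≤ 1 → |η₂| ≤ 1 → _ := fun η₁ η₂ h1 h2 =>
    integral_rotatedIntegrand_eq hα hβ hβ' hs hd hr₁ hr₂ h1 h2
  have n1 : |(1 : ℝ)| ≤ 1 := by simp
  have n2 : |(-1 : ℝ)| ≤ 1 := by simp
  have hsplit : ∫ v in Set.Ioi (0 : ℝ), (v : ℂ) ^ (α - 1) *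
        (Jplus (2 * β) (r₁ * √(1 + v)) * Jplus (2 * β) (r₂ * √(1 + 1 / v))) =
      ∫ v in Set.Ioi (0 : ℝ), (-1 / 4 : ℂ) *
        ((rotatedIntegrand (2 * β) α r₁ r₂ 1 1 ((Real.pi / 2 : ℝ) * Complex.I) v -
          rotatedIntegrand (2 * β) α r₁ r₂ 1 (-1) ((Real.pi / 2 : ℝ) * Complex.I) v) -
        (rotatedIntegrand (2 * β) α r₁ r₂ (-1) 1 ((Real.pi / 2 : ℝ) * Complex.I) v -
          rotatedIntegrand (2 * β) α r₁ r₂ (-1) (-1) ((Real.pi / 2 : ℝ) * Complex.I) v)) := by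
    refine setIntegral_congr_fun measurableSet_Ioi fun v hv => ?_
    have hv : 0 < v := hv
    simp only [rotatedIntegrand]
    rw [Jplus_eq_kernelExt hν' (show 0 < r₁ * √(1 + v) by positivity),
      Jplus_eq_kernelExt hν' (show 0 < r₂ * √(1 + 1 / v) by positivity)]
    ring_nf
    rw [Complex.I_sq]
    ring
  have hsub := integral_sub (f := fun v =>
      rotatedIntegrand (2 * β) α r₁ r₂ 1 1 ((Real.pi / 2 : ℝ) * Complex.I) v -
        rotatedIntegrand (2 * β) α r₁ r₂ 1 (-1) ((Real.pi / 2 : ℝ) * Complex.I) v)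
    (g := fun v => rotatedIntegrand (2 * β) α r₁ r₂ (-1) 1 ((Real.pi / 2 : ℝ) * Complex.I) v -
        rotatedIntegrand (2 * β) α r₁ r₂ (-1) (-1) ((Real.pi / 2 : ℝ) * Complex.I) v)
    ((hI _ _ n1 n1).sub (hI _ _ n1 n2)) ((hI _ _ n2 n1).sub (hI _ _ n2 n2))
  rw [hsplit, integral_const_mul, hsub, integral_sub (hI _ _ n1 n1) (hI _ _ n1 n2),
    integral_sub (hI _ _ n2 n1) (hI _ _ n2 n2), hE _ _ n1 n1, hE _ _ n1 n2, hE _ _ n2 n1,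
    hE _ _ n2 n2, sq_ofReal_mul_exp_pi_div_two r₁ (Or.inl rfl),
    sq_ofReal_mul_exp_pi_div_two r₁ (Or.inr rfl), sq_ofReal_mul_exp_pi_div_two r₂ (Or.inl rfl),
    sq_ofReal_mul_exp_pi_div_two r₂ (Or.inr rfl)]
  have hx : ∀ s, Complex.exp (s * ((1 : ℝ) * ((Real.pi / 2 : ℝ) * Complex.I))) =
      2 * Complex.I * Complex.sin (Real.pi * s / 2) +
        Complex.exp (s * ((-1 : ℝ) * ((Real.pi / 2 : ℝ) * Complex.I))) := fun s =>
    sub_eq_iff_eq_add.1 (exp_mul_pi_div_two_sub s)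
  simp only [sixTerm, hx]
  ring_nf
  simp only [Complex.I_sq]
  ring

/-- The normalised power series attached to an ordering of the spectral parameters. -/
noncomputable def weylSeries (y₁ y₂ : ℝ) (μ₁ μ₂ μ₃ : ℂ) : ℂ :=
  ((|4 * Real.pi ^ 2 * y₁| : ℝ) : ℂ) ^ (-μ₃) * ((|4 * Real.pi ^ 2 * y₂| : ℝ) : ℂ) ^ μ₁ *
    dblSeries (μ₁ - μ₂) (μ₂ - μ₃) ((4 * Real.pi ^ 2 * y₁ : ℝ) : ℂ)
      ((4 * Real.pi ^ 2 * y₂ : ℝ) : ℂ)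

theorem Jwl_eq_weylSeries {y₁ y₂ : ℝ} (hy₁ : y₁ ≠ 0) (hy₂ : y₂ ≠ 0) (μ₁ μ₂ μ₃ : ℂ) :
    Jwl y₁ y₂ μ₁ μ₂ μ₃ =
      ((16 * Real.pi ^ 4 * |y₁ * y₂| : ℝ) : ℂ) * weylSeries y₁ y₂ μ₁ μ₂ μ₃ := by
  have hpi := Real.pi_pos
  have h1 : ((|4 * Real.pi ^ 2 * y₁| : ℝ) : ℂ) ≠ 0 := Complex.ofReal_ne_zero.2 (by positivity)
  have h2 : ((|4 * Real.pi ^ 2 * y₂| : ℝ) : ℂ) ≠ 0 := Complex.ofReal_ne_zero.2 (by positivity)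
  have h3 : ((16 * Real.pi ^ 4 * |y₁ * y₂| : ℝ) : ℂ) =
      ((|4 * Real.pi ^ 2 * y₁| : ℝ) : ℂ) * ((|4 * Real.pi ^ 2 * y₂| : ℝ) : ℂ) := by
    rw [← Complex.ofReal_mul, ← abs_mul]
    congr 1
    rw [show 4 * Real.pi ^ 2 * y₁ * (4 * Real.pi ^ 2 * y₂) = 16 * Real.pi ^ 4 * (y₁ * y₂) by ring,
      abs_mul (16 * Real.pi ^ 4), abs_of_pos (by positivity : 0 < 16 * Real.pi ^ 4)]
  have hS : ∑' n : ℕ × ℕ,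
      Complex.Gamma ((n.1 : ℂ) + (n.2 : ℂ) + μ₁ - μ₃ + 1) *
          ((4 * Real.pi ^ 2 * y₁ : ℝ) : ℂ) ^ n.1 * ((4 * Real.pi ^ 2 * y₂ : ℝ) : ℂ) ^ n.2 /
        (Complex.Gamma ((n.1 : ℂ) + μ₁ - μ₃ + 1) * Complex.Gamma ((n.2 : ℂ) + μ₁ - μ₁ + 1) *
          Complex.Gamma ((n.1 : ℂ) + μ₂ - μ₃ + 1) * Complex.Gamma ((n.2 : ℂ) + μ₁ - μ₂ + 1) *
          Complex.Gamma ((n.1 : ℂ) + μ₃ - μ₃ + 1) * Complex.Gamma ((n.2 : ℂ) + μ₁ - μ₃ + 1)) =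
      dblSeries (μ₁ - μ₂) (μ₂ - μ₃) ((4 * Real.pi ^ 2 * y₁ : ℝ) : ℂ)
        ((4 * Real.pi ^ 2 * y₂ : ℝ) : ℂ) := by
    rw [dblSeries]
    refine tsum_congr fun n => ?_
    rw [add_sub_cancel_right, add_sub_cancel_right, Complex.Gamma_nat_eq_factorial,
      Complex.Gamma_nat_eq_factorial,
      show (n.1 : ℂ) + n.2 + (μ₁ - μ₂) + (μ₂ - μ₃) + 1 = n.1 + n.2 + μ₁ - μ₃ + 1 by ring,
      show μ₂ - μ₃ + n.1 + 1 = n.1 + μ₂ - μ₃ + 1 by ring,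
      show μ₁ - μ₂ + (μ₂ - μ₃) + n.1 + 1 = n.1 + μ₁ - μ₃ + 1 by ring,
      show μ₁ - μ₂ + n.2 + 1 = n.2 + μ₁ - μ₂ + 1 by ring,
      show μ₁ - μ₂ + (μ₂ - μ₃) + n.2 + 1 = n.2 + μ₁ - μ₃ + 1 by ring, div_eq_mul_inv]
    simp only [mul_inv]
    ring
  rw [Jwl, hS, weylSeries, sub_eq_add_neg, Complex.cpow_add _ _ h1, Complex.cpow_add _ _ h2,
    Complex.cpow_one, Complex.cpow_one, h3]
  ring

theorem abs_four_pi_sq_mul_cpow {y : ℝ} (hy : y ≠ 0) (s : ℂ) :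
    ((|4 * Real.pi ^ 2 * y| : ℝ) : ℂ) ^ s =
      ((2 * Real.pi * √|y| : ℝ) : ℂ) ^ (2 * s) := by
  have hr : 0 ≤ 2 * Real.pi * √|y| := by positivity
  have hr' : ((2 * Real.pi * √|y| : ℝ) : ℂ) ≠ 0 := Complex.ofReal_ne_zero.2 (by positivity)
  have h : |4 * Real.pi ^ 2 * y| = 2 * Real.pi * √|y| * (2 * Real.pi * √|y|) := by
    rw [abs_mul, abs_of_nonneg (by positivity : 0 ≤ 4 * Real.pi ^ 2)]
    linear_combination -(4 * Real.pi ^ 2) * Real.mul_self_sqrt (abs_nonneg y)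
  rw [h, Complex.ofReal_mul, Complex.mul_cpow_ofReal_nonneg hr hr, ← Complex.cpow_add _ _ hr',
    two_mul s]

theorem abs_div_cpow {y₁ y₂ : ℝ} (hy₁ : y₁ ≠ 0) (hy₂ : y₂ ≠ 0) (s : ℂ) :
    ((|y₁ / y₂| : ℝ) : ℂ) ^ (s / 2) =
      ((2 * Real.pi * √|y₁| : ℝ) : ℂ) ^ s * ((2 * Real.pi * √|y₂| : ℝ) : ℂ) ^ (-s) := by
  have hpi := Real.pi_pos
  have e1 := abs_four_pi_sq_mul_cpow hy₁ (s / 2)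
  have e2 := abs_four_pi_sq_mul_cpow hy₂ (s / 2)
  have h : |4 * Real.pi ^ 2 * y₁| = |y₁ / y₂| * |4 * Real.pi ^ 2 * y₂| := by
    rw [← abs_mul]; congr 1; field_simp
  rw [mul_div_cancel₀ s two_ne_zero] at e1 e2
  rw [h, Complex.ofReal_mul, Complex.mul_cpow_ofReal_nonneg (abs_nonneg _) (abs_nonneg _), e2] at e1
  have hne : ((2 * Real.pi * √|y₂| : ℝ) : ℂ) ^ s ≠ 0 :=
    Complex.cpow_ne_zero_iff.2 (Or.inl (Complex.ofReal_ne_zero.2 (by positivity)))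
  rw [Complex.cpow_neg, ← e1, mul_assoc, mul_inv_cancel₀ hne, mul_one]

/-- The defining integral of `calJ1plus` in the variable `v = u ^ 2`. -/
theorem calJ1plus_eq_integral (y₁ y₂ : ℝ) (μ₁ μ₂ μ₃ : ℂ) :
    calJ1plus y₁ y₂ μ₁ μ₂ μ₃ = ((|y₁ / y₂| : ℝ) : ℂ) ^ (μ₂ / 2) * (1 / 2 *
      ∫ v in Set.Ioi (0 : ℝ), (v : ℂ) ^ (3 * μ₂ / 2 - 1) *
        (Jplus (μ₃ - μ₁) (2 * Real.pi * √|y₁| * √(1 + v)) *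
          Jplus (μ₃ - μ₁) (2 * Real.pi * √|y₂| * √(1 + 1 / v)))) := by
  have hv := integral_comp_rpow_Ioi_of_pos (p := 2) (g := fun v : ℝ =>
    (v : ℂ) ^ (3 * μ₂ / 2 - 1) * (Jplus (μ₃ - μ₁) (2 * Real.pi * √|y₁| * √(1 + v)) *
      Jplus (μ₃ - μ₁) (2 * Real.pi * √|y₂| * √(1 + 1 / v)))) two_pos
  rw [calJ1plus, ← hv, ← integral_const_mul (1 / 2 : ℂ)]
  congr 1
  refine setIntegral_congr_fun measurableSet_Ioi fun u hu => ?_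
  have hu : 0 < u := hu
  have hu' : (u : ℂ) ≠ 0 := Complex.ofReal_ne_zero.2 hu.ne'
  have e1 : ((u ^ 2 : ℝ) : ℂ) ^ (3 * μ₂ / 2 - 1) = (u : ℂ) ^ (3 * μ₂) / ((u : ℂ) * u) := by
    rw [pow_two, Complex.ofReal_mul, Complex.mul_cpow_ofReal_nonneg hu.le hu.le,
      ← Complex.cpow_add _ _ hu', show 3 * μ₂ / 2 - 1 + (3 * μ₂ / 2 - 1) = 3 * μ₂ - 2 by ring,
      Complex.cpow_sub _ _ hu', Complex.cpow_ofNat, pow_two]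
  have e2 : (2 : ℝ) - 1 = 1 := by norm_num
  simp only [e1, e2, Real.rpow_one, Real.rpow_two, Complex.real_smul, div_pow, one_pow]
  push_cast
  field_simp

/-- The generic evaluation of `calJ1plus` as a sum over the Weyl group. -/
theorem calJ1plus_eq_weylSeries {μ₁ μ₂ μ₃ : ℂ} (hsum : μ₁ + μ₂ + μ₃ = 0)
    (hre₁ : μ₁.re = 0) (hre₂ : μ₂.re = 0) (hre₃ : μ₃.re = 0) (h₁₂ : μ₁ ≠ μ₂) (h₁₃ : μ₁ ≠ μ₃)
    (h₂₃ : μ₂ ≠ μ₃) {y₁ y₂ : ℝ} (hy₁ : y₁ < 0) (hy₂ : y₂ < 0) :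
    calJ1plus y₁ y₂ μ₁ μ₂ μ₃ =
      Real.pi ^ 3 / (2 * (Complex.sin (Real.pi * (μ₂ - μ₁)) * Complex.sin (Real.pi * (μ₂ - μ₃)) *
        Complex.sin (Real.pi * (μ₃ - μ₁)))) *
      (Complex.sin (Real.pi / 2 * (μ₃ - μ₁)) ^ 2 *
          (weylSeries y₁ y₂ μ₃ μ₂ μ₁ - weylSeries y₁ y₂ μ₁ μ₂ μ₃) +
        Complex.sin (Real.pi / 2 * (μ₃ - μ₁)) * Complex.sin (Real.pi / 2 * (3 * μ₂)) *
          (weylSeries y₁ y₂ μ₃ μ₁ μ₂ + weylSeries y₁ y₂ μ₁ μ₃ μ₂ - weylSeries y₁ y₂ μ₂ μ₃ μ₁ -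
            weylSeries y₁ y₂ μ₂ μ₁ μ₃)) := by
  have him : ∀ {a b : ℂ}, a.re = 0 → b.re = 0 → a ≠ b → (a - b).im ≠ 0 := fun ha hb hab h =>
    hab (Complex.ext (ha.trans hb.symm) (by simpa [sub_eq_zero] using h))
  have hpi := Real.pi_pos
  obtain ⟨β, hβ⟩ : ∃ β, β = (μ₃ - μ₁) / 2 := ⟨_, rfl⟩
  obtain ⟨α, hα⟩ : ∃ α, α = 3 * μ₂ / 2 := ⟨_, rfl⟩
  have m2 : μ₂ = 2 * α / 3 := by rw [hα]; ring
  have m1 : μ₁ = -β - α / 3 := by rw [hα, hβ]; linear_combination (1 / 2 : ℂ) * hsum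
  have m3 : μ₃ = β - α / 3 := by rw [hα, hβ]; linear_combination (1 / 2 : ℂ) * hsum
  have hab : α + β = μ₂ - μ₁ := by rw [m1, m2]; ring
  have hab' : α - β = μ₂ - μ₃ := by rw [m3, m2]; ring
  have h2β : 2 * β = μ₃ - μ₁ := by rw [hβ]; ring
  have k1 : α.re = 0 := by rw [hα]; simp [hre₂]
  have k2 : β.re = 0 := by rw [hβ]; simp [hre₁, hre₃]
  have k3 : β.im ≠ 0 := by
    intro h
    apply him hre₃ hre₁ h₁₃.symm
    rw [← h2β]; simp [h]
  have k4 : (α + β).im ≠ 0 := hab ▸ him hre₂ hre₁ h₁₂.symm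
  have k5 : (α - β).im ≠ 0 := hab' ▸ him hre₂ hre₃ h₂₃
  have hr₁ : 0 < 2 * Real.pi * √|y₁| := by have := hy₁.ne; positivity
  have hr₂ : 0 < 2 * Real.pi * √|y₂| := by have := hy₂.ne; positivity
  have hr₁' : ((2 * Real.pi * √|y₁| : ℝ) : ℂ) ≠ 0 := Complex.ofReal_ne_zero.2 hr₁.ne'
  have hr₂' : ((2 * Real.pi * √|y₂| : ℝ) : ℂ) ≠ 0 := Complex.ofReal_ne_zero.2 hr₂.ne'
  have hsq : ∀ {y : ℝ}, y < 0 → -(((2 * Real.pi * √|y| : ℝ) : ℂ) * ((2 * Real.pi * √|y| : ℝ) : ℂ)) =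
      ((4 * Real.pi ^ 2 * y : ℝ) : ℂ) := by
    intro y hy
    rw [← Complex.ofReal_mul, ← Complex.ofReal_neg]
    congr 1
    have := Real.mul_self_sqrt (abs_nonneg y)
    rw [abs_of_neg hy] at this ⊢
    linear_combination -(4 * Real.pi ^ 2) * this
  have hM := integral_Jplus_mul_Jplus k1 k2 k3 k4 k5 hr₁ hr₂
  rw [hsq hy₁, hsq hy₂] at hM
  rw [calJ1plus_eq_integral, ← h2β, ← hα, hM, abs_div_cpow hy₁.ne hy₂.ne]
  simp only [weylSeries, abs_four_pi_sq_mul_cpow hy₁.ne, abs_four_pi_sq_mul_cpow hy₂.ne, sixTerm]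
  generalize ((2 * Real.pi * √|y₁| : ℝ) : ℂ) = r₁ at *
  generalize ((2 * Real.pi * √|y₂| : ℝ) : ℂ) = r₂ at *
  generalize ((4 * Real.pi ^ 2 * y₁ : ℝ) : ℂ) = A at *
  generalize ((4 * Real.pi ^ 2 * y₂ : ℝ) : ℂ) = B at *
  rw [← hab, ← hab']
  have q : ∀ (r s t : ℂ), r ≠ 0 → r ^ (s + t) = r ^ s * r ^ t := fun r s t hr =>
    Complex.cpow_add _ _ hr
  have p1 : r₁ ^ (2 * -μ₁) = r₁ ^ μ₂ * r₁ ^ (2 * β) := by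
    rw [← q _ _ _ hr₁']; congr 1; rw [m1, m2]; ring
  have p3 : r₁ ^ (2 * -μ₃) = r₁ ^ μ₂ * r₁ ^ (-(2 * β)) := by
    rw [← q _ _ _ hr₁']; congr 1; rw [m3, m2]; ring
  have p2 : r₁ ^ (2 * -μ₂) = r₁ ^ μ₂ * r₁ ^ (-(2 * α)) := by
    rw [← q _ _ _ hr₁']; congr 1; rw [m2]; ring
  have t1 : r₂ ^ (2 * μ₁) = r₂ ^ (-μ₂) * r₂ ^ (-(2 * β)) := by
    rw [← q _ _ _ hr₂']; congr 1; rw [m1, m2]; ring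
  have t3 : r₂ ^ (2 * μ₃) = r₂ ^ (-μ₂) * r₂ ^ (2 * β) := by
    rw [← q _ _ _ hr₂']; congr 1; rw [m3, m2]; ring
  have t2 : r₂ ^ (2 * μ₂) = r₂ ^ (-μ₂) * r₂ ^ (2 * α) := by
    rw [← q _ _ _ hr₂']; congr 1; rw [m2]; ring
  rw [p1, p2, p3, t1, t2, t3]
  rw [show μ₃ - μ₂ = β - α by rw [← neg_sub α, hab', neg_sub],
    show μ₁ - μ₂ = -α - β by rw [← neg_sub μ₂, ← hab]; ring,
    show μ₁ - μ₃ = -(2 * β) by rw [h2β]; ring,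
    show Real.pi / 2 * (3 * μ₂) = Real.pi * (2 * α) / 2 by rw [hα]; ring,
    show (Real.pi : ℂ) / 2 * (2 * β) = Real.pi * (2 * β) / 2 by ring,
    show (Real.pi : ℂ) * -(2 * β) / 2 = -(Real.pi * (2 * β) / 2) by ring,
    show (Real.pi : ℂ) * -(2 * α) / 2 = -(Real.pi * (2 * α) / 2) by ring,
    show -β - α = -α - β by ring, Complex.sin_neg, Complex.sin_neg]
  simp only [← h2β]
  generalize Complex.sin (Real.pi * (2 * β) / 2) = s
  generalize Complex.sin (Real.pi * (2 * α) / 2) = t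
  field_simp
  ring

theorem sin_cubic_identities {a b c : ℂ} (h : a + b + c = 0) :
    Complex.sin (c - a) ^ 2 + Complex.sin (b - c) * Complex.sin (3 * a) +
        Complex.sin (a - b) * Complex.sin (3 * c) =
      2 * Complex.sin (a - c) * Complex.sin (b - c) * Complex.cos (a - b) ∧
    Complex.sin (b - c) ^ 2 - Complex.sin (c - a) * Complex.sin (3 * b) -
        Complex.sin (a - b) * Complex.sin (3 * c) =
      2 * Complex.sin (a - c) * Complex.sin (b - c) * Complex.cos (a - b) ∧
    Complex.sin (a - b) ^ 2 - Complex.sin (c - a) * Complex.sin (3 * b) +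
        Complex.sin (b - c) * Complex.sin (3 * a) =
      2 * Complex.sin (a - c) * Complex.sin (b - c) * Complex.cos (a - b) := by
  obtain rfl : c = -a - b := by linear_combination h
  have hx : Complex.exp (a * Complex.I) ≠ 0 := Complex.exp_ne_zero _
  have hy : Complex.exp (b * Complex.I) ≠ 0 := Complex.exp_ne_zero _
  have hE : ∀ k l : ℤ, Complex.exp ((k * a + l * b) * Complex.I) =
      Complex.exp (a * Complex.I) ^ k * Complex.exp (b * Complex.I) ^ l := fun k l => by
    rw [← Complex.exp_int_mul, ← Complex.exp_int_mul, ← Complex.exp_add]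
    congr 1; ring
  have hE' : ∀ k l : ℤ, Complex.exp (-(k * a + l * b) * Complex.I) =
      Complex.exp (a * Complex.I) ^ (-k) * Complex.exp (b * Complex.I) ^ (-l) := fun k l => by
    rw [← hE]; push_cast; congr 1; ring
  have hS : ∀ k l : ℤ, Complex.sin (k * a + l * b) = _ := fun k l => by
    rw [Complex.sin, hE, hE']
  have hC : ∀ k l : ℤ, Complex.cos (k * a + l * b) = _ := fun k l => by
    rw [Complex.cos, hE, hE']
  have s1 := hS (-2) (-1)
  have s2 := hS 1 2
  have s3 := hS 1 (-1)
  have s4 := hS 3 0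
  have s5 := hS 0 3
  have s6 := hS (-3) (-3)
  have s7 := hS 2 1
  have s8 := hC 1 (-1)
  rw [show -a - b - a = ((-2 : ℤ) : ℂ) * a + ((-1 : ℤ) : ℂ) * b by push_cast; ring,
    show b - (-a - b) = ((1 : ℤ) : ℂ) * a + ((2 : ℤ) : ℂ) * b by push_cast; ring,
    show a - b = ((1 : ℤ) : ℂ) * a + ((-1 : ℤ) : ℂ) * b by push_cast; ring,
    show 3 * a = ((3 : ℤ) : ℂ) * a + ((0 : ℤ) : ℂ) * b by push_cast; ring,
    show 3 * b = ((0 : ℤ) : ℂ) * a + ((3 : ℤ) : ℂ) * b by push_cast; ring,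
    show 3 * (-a - b) = ((-3 : ℤ) : ℂ) * a + ((-3 : ℤ) : ℂ) * b by push_cast; ring,
    show a - (-a - b) = ((2 : ℤ) : ℂ) * a + ((1 : ℤ) : ℂ) * b by push_cast; ring,
    s1, s2, s3, s4, s5, s6, s7, s8]
  generalize Complex.exp (a * Complex.I) = x at *
  generalize Complex.exp (b * Complex.I) = y at *
  refine ⟨?_, ?_, ?_⟩ <;>
  · simp only [Int.reduceNeg, neg_neg, neg_zero, zpow_zero, zpow_one]
    field_simp
    ring

/-- The integral representation when the spectral parameters are pairwise distinct. -/
theorem K1wl_div_eq_of_pairwise_ne {μ₁ μ₂ μ₃ : ℂ} (hsum : μ₁ + μ₂ + μ₃ = 0)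
    (hre₁ : μ₁.re = 0) (hre₂ : μ₂.re = 0) (hre₃ : μ₃.re = 0) (h₁₂ : μ₁ ≠ μ₂) (h₁₃ : μ₁ ≠ μ₃)
    (h₂₃ : μ₂ ≠ μ₃) {y₁ y₂ : ℝ} (hy₁ : y₁ < 0) (hy₂ : y₂ < 0) :
    K1wl y₁ y₂ μ₁ μ₂ μ₃ / ((8 * |y₁ * y₂| : ℝ) : ℂ) =
      -calJ1plus y₁ y₂ μ₁ μ₂ μ₃ - calJ1plus y₁ y₂ μ₃ μ₁ μ₂ + calJ1plus y₁ y₂ μ₂ μ₃ μ₁ := by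
  have him : ∀ {a b : ℂ}, a.re = 0 → b.re = 0 → a ≠ b →
      Complex.sin (Real.pi * (a - b)) ≠ 0 := fun ha hb hab =>
    sin_pi_mul_ne_zero_of_im_ne_zero fun h =>
      hab (Complex.ext (ha.trans hb.symm) (by simpa [sub_eq_zero] using h))
  have hdbl : ∀ a b : ℂ, Complex.sin (Real.pi * (a - b)) =
      2 * Complex.sin (Real.pi / 2 * a - Real.pi / 2 * b) *
        Complex.cos (Real.pi / 2 * a - Real.pi / 2 * b) := fun a b => by
    rw [← Complex.sin_two_mul]; congr 1; ring
  have hpi : (Real.pi : ℂ) ≠ 0 := Complex.ofReal_ne_zero.2 Real.pi_ne_zero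
  have hy : ((|y₁ * y₂| : ℝ) : ℂ) ≠ 0 :=
    Complex.ofReal_ne_zero.2 (abs_ne_zero.2 (mul_ne_zero hy₁.ne hy₂.ne))
  have hneg : ∀ a b : ℂ, Complex.sin (a - b) = -Complex.sin (b - a) := fun a b => by
    rw [← Complex.sin_neg, neg_sub]
  have hnegc : ∀ a b : ℂ, Complex.cos (a - b) = Complex.cos (b - a) := fun a b => by
    rw [← Complex.cos_neg, neg_sub]
  have n₁₂ := him hre₁ hre₂ h₁₂
  have n₁₃ := him hre₁ hre₃ h₁₃
  have n₂₃ := him hre₂ hre₃ h₂₃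
  obtain ⟨i1, i2, i3⟩ := sin_cubic_identities (a := Real.pi / 2 * μ₁) (b := Real.pi / 2 * μ₂)
    (c := Real.pi / 2 * μ₃) (by linear_combination (Real.pi / 2 : ℂ) * hsum)
  rw [calJ1plus_eq_weylSeries hsum hre₁ hre₂ hre₃ h₁₂ h₁₃ h₂₃ hy₁ hy₂,
    calJ1plus_eq_weylSeries (by linear_combination hsum) hre₃ hre₁ hre₂ h₁₃.symm h₂₃.symm h₁₂
      hy₁ hy₂,
    calJ1plus_eq_weylSeries (by linear_combination hsum) hre₂ hre₃ hre₁ h₂₃ h₁₂.symm h₁₃.symm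
      hy₁ hy₂]
  simp only [K1wl, Jsign, Jwl_eq_weylSeries hy₁.ne hy₂.ne, Real.sign_of_neg hy₁,
    Real.sign_of_neg hy₂]
  push_cast
  simp only [hdbl] at n₁₂ n₁₃ n₂₃ ⊢
  simp only [mul_sub, mul_left_comm _ (3 : ℂ)]
  rw [hneg (Real.pi / 2 * μ₂) (Real.pi / 2 * μ₁), hnegc (Real.pi / 2 * μ₂) (Real.pi / 2 * μ₁),
    hneg (Real.pi / 2 * μ₃) (Real.pi / 2 * μ₁), hnegc (Real.pi / 2 * μ₃) (Real.pi / 2 * μ₁),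
    hneg (Real.pi / 2 * μ₃) (Real.pi / 2 * μ₂), hnegc (Real.pi / 2 * μ₃) (Real.pi / 2 * μ₂)]
  rw [hneg (Real.pi / 2 * μ₃) (Real.pi / 2 * μ₁)] at i1 i2 i3
  generalize Complex.sin (Real.pi / 2 * μ₁ - Real.pi / 2 * μ₂) = s₁₂ at *
  generalize Complex.sin (Real.pi / 2 * μ₁ - Real.pi / 2 * μ₃) = s₁₃ at *
  generalize Complex.sin (Real.pi / 2 * μ₂ - Real.pi / 2 * μ₃) = s₂₃ at *
  generalize Complex.cos (Real.pi / 2 * μ₁ - Real.pi / 2 * μ₂) = c₁₂ at *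
  generalize Complex.cos (Real.pi / 2 * μ₁ - Real.pi / 2 * μ₃) = c₁₃ at *
  generalize Complex.cos (Real.pi / 2 * μ₂ - Real.pi / 2 * μ₃) = c₂₃ at *
  generalize Complex.sin (3 * (Real.pi / 2 * μ₁)) = t₁ at *
  generalize Complex.sin (3 * (Real.pi / 2 * μ₂)) = t₂ at *
  generalize Complex.sin (3 * (Real.pi / 2 * μ₃)) = t₃ at *
  generalize weylSeries y₁ y₂ μ₁ μ₂ μ₃ = w₁₂₃
  generalize weylSeries y₁ y₂ μ₁ μ₃ μ₂ = w₁₃₂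
  generalize weylSeries y₁ y₂ μ₂ μ₁ μ₃ = w₂₁₃
  generalize weylSeries y₁ y₂ μ₂ μ₃ μ₁ = w₂₃₁
  generalize weylSeries y₁ y₂ μ₃ μ₁ μ₂ = w₃₁₂
  generalize weylSeries y₁ y₂ μ₃ μ₂ μ₁ = w₃₂₁
  generalize ((|y₁ * y₂| : ℝ) : ℂ) = Y at *
  simp only [mul_ne_zero_iff] at n₁₂ n₁₃ n₂₃
  obtain ⟨⟨-, a1⟩, a2⟩ := n₁₂
  obtain ⟨⟨-, b1⟩, b2⟩ := n₁₃
  obtain ⟨⟨-, d1⟩, d2⟩ := n₂₃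
  field_simp
  linear_combination (-8 * (w₁₂₃ - w₃₂₁)) * i1 - 8 * (w₃₁₂ - w₂₁₃) * i2 + 8 * (w₂₃₁ - w₁₃₂) * i3

theorem continuous_inv_Gamma_comp {ν : ℝ → ℂ} (hν : Continuous ν) :
    Continuous fun t => (Complex.Gamma (ν t))⁻¹ :=
  Complex.differentiable_one_div_Gamma.continuous.comp hν

theorem continuous_besselSeries_comp {ν : ℝ → ℂ} (hν : Continuous ν) (hre : ∀ t, (ν t).re = 0)
    (z : ℂ) : Continuous fun t => besselSeries (ν t) z := by
  refine continuous_iff_continuousAt.2 fun t₀ => ?_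
  have hG : Continuous fun t => ‖(Complex.Gamma (ν t + 1))⁻¹‖ :=
    (continuous_inv_Gamma_comp (hν.add continuous_const)).norm
  have hev := (hG.tendsto t₀).eventually_le_const (lt_add_one _)
  set M := ‖(Complex.Gamma (ν t₀ + 1))⁻¹‖ + 1
  refine tendsto_tsum_of_dominated_convergence
    (bound := fun m : ℕ => M * (‖z‖ ^ m / (Nat.factorial m))) ?_ ?_ ?_
  · exact (Real.summable_pow_div_factorial ‖z‖).mul_left M
  · intro m
    exact (((continuous_inv_Gamma_comp (by fun_prop)).const_mul _).const_mul _).tendsto t₀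
  · filter_upwards [hev] with t ht m
    have h1 := norm_inv_Gamma_add_nat_le (hre t) m
    have h2 : (1 : ℝ) ≤ Nat.factorial m := by exact_mod_cast Nat.factorial_pos m
    have h3 : ‖(Complex.Gamma (ν t + m + 1))⁻¹‖ ≤ M :=
      h1.trans ((div_le_self (norm_nonneg _) h2).trans ht)
    rw [norm_mul, norm_mul, norm_pow, norm_inv, Complex.norm_natCast]
    calc ‖z‖ ^ m * ((Nat.factorial m : ℝ)⁻¹ * ‖(Complex.Gamma (ν t + m + 1))⁻¹‖)
        ≤ ‖z‖ ^ m * ((Nat.factorial m : ℝ)⁻¹ * M) := by gcongr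
      _ = _ := by ring

theorem continuous_dblSeries_comp {p q : ℝ → ℂ} (hp : Continuous p) (hq : Continuous q)
    (hpre : ∀ t, (p t).re = 0) (hqre : ∀ t, (q t).re = 0) (A B : ℂ) :
    Continuous fun t => dblSeries (p t) (q t) A B := by
  refine continuous_iff_continuousAt.2 fun t₀ => ?_
  have hG : Continuous fun t => ‖(Complex.Gamma (q t + 1))⁻¹‖ * ‖(Complex.Gamma (p t + 1))⁻¹‖ *
      ‖(Complex.Gamma (p t + q t + 1))⁻¹‖ ^ 2 :=
    ((continuous_inv_Gamma_comp (by fun_prop)).norm.mul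
      (continuous_inv_Gamma_comp (by fun_prop)).norm).mul
      ((continuous_inv_Gamma_comp (by fun_prop)).norm.pow 2)
  obtain ⟨M, hM⟩ := exists_gt (‖(Complex.Gamma (q t₀ + 1))⁻¹‖ * ‖(Complex.Gamma (p t₀ + 1))⁻¹‖ *
    ‖(Complex.Gamma (p t₀ + q t₀ + 1))⁻¹‖ ^ 2)
  have hev := (hG.tendsto t₀).eventually_le_const hM
  refine tendsto_tsum_of_dominated_convergence
    ((summable_dblSeries_bound ‖A‖ ‖B‖).mul_left M) ?_ ?_
  · intro n
    have hg : Continuous fun t => Complex.Gamma (n.1 + n.2 + p t + q t + 1) := by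
      refine continuous_iff_continuousAt.2 fun t => ContinuousAt.comp (f := fun t =>
        (n.1 : ℂ) + n.2 + p t + q t + 1) ?_ (by fun_prop)
      refine (Complex.differentiableAt_Gamma _ fun m h => ?_).continuousAt
      have := congrArg Complex.re h
      simp [hpre, hqre] at this
      have h1 : (0 : ℝ) ≤ m := m.cast_nonneg
      have h2 : (0 : ℝ) ≤ n.1 := n.1.cast_nonneg
      have h3 : (0 : ℝ) ≤ n.2 := n.2.cast_nonneg
      linarith
    have hi : ∀ {f : ℝ → ℂ}, Continuous f → Continuous fun t => (Complex.Gamma (f t))⁻¹ :=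
      continuous_inv_Gamma_comp
    refine Continuous.tendsto ?_ t₀
    refine ((hg.mul_const _).mul_const _).mul ?_ |>.mul ?_
    · exact ((continuous_const.mul (hi (by fun_prop))).mul (hi (by fun_prop)))
    · exact ((continuous_const.mul (hi (by fun_prop))).mul (hi (by fun_prop)))
  · filter_upwards [hev] with t ht n
    refine (norm_dblSeries_term_le (hpre t) (hqre t) le_rfl le_rfl n).trans ?_
    gcongr

theorem continuous_Jwl_comp {m₁ m₂ m₃ : ℝ → ℂ} (h₁ : Continuous m₁) (h₂ : Continuous m₂)
    (h₃ : Continuous m₃) (hr₁ : ∀ t, (m₁ t).re = 0) (hr₂ : ∀ t, (m₂ t).re = 0)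
    (hr₃ : ∀ t, (m₃ t).re = 0) {y₁ y₂ : ℝ} (hy₁ : y₁ ≠ 0) (hy₂ : y₂ ≠ 0) :
    Continuous fun t => Jwl y₁ y₂ (m₁ t) (m₂ t) (m₃ t) := by
  have hpi := Real.pi_pos
  have e1 : ((|4 * Real.pi ^ 2 * y₁| : ℝ) : ℂ) ≠ 0 := Complex.ofReal_ne_zero.2 (by positivity)
  have e2 : ((|4 * Real.pi ^ 2 * y₂| : ℝ) : ℂ) ≠ 0 := Complex.ofReal_ne_zero.2 (by positivity)
  simp only [Jwl_eq_weylSeries hy₁ hy₂, weylSeries]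
  exact continuous_const.mul (((h₃.neg.const_cpow (Or.inl e1)).mul (h₁.const_cpow (Or.inl e2))).mul
    (continuous_dblSeries_comp (h₁.sub h₂) (h₂.sub h₃) (by simp [hr₁, hr₂])
      (by simp [hr₂, hr₃]) _ _))

theorem cos_pi_mul_div_two_ne_zero {ν : ℂ} (hν : ν.re = 0) : Complex.cos (Real.pi * ν / 2) ≠ 0 := by
  have h : (Real.pi : ℂ) * ν / 2 = ((Real.pi * ν.im / 2 : ℝ) : ℂ) * Complex.I :=
    Complex.ext (by simp [hν]) (by simp [hν])
  rw [h, Complex.cos_mul_I, ← Complex.ofReal_cosh]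
  exact Complex.ofReal_ne_zero.2 (Real.cosh_pos _).ne'

theorem continuous_Jplus_comp {ν : ℝ → ℂ} (hν : Continuous ν) (hre : ∀ t, (ν t).re = 0) {x : ℝ}
    (hx : 0 < x) : Continuous fun t => Jplus (ν t) x := by
  have hx' : (x : ℂ) ≠ 0 := Complex.ofReal_ne_zero.2 hx.ne'
  simp only [Jplus, besselJ_two_mul _ hx]
  refine Continuous.div₀ (continuous_const.mul (Continuous.add ?_ ?_))
    (Complex.continuous_cos.comp (by fun_prop)) fun t => cos_pi_mul_div_two_ne_zero (hre t)
  · exact (hν.const_cpow (Or.inl hx')).mul (continuous_besselSeries_comp hν hre _)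
  · exact (hν.neg.const_cpow (Or.inl hx')).mul
      (continuous_besselSeries_comp hν.neg (by simp [hre]) _)

theorem continuousOn_Jplus (ν : ℂ) : ContinuousOn (Jplus ν) (Set.Ioi 0) := by
  have h : ∀ s : ℂ, ContinuousOn (fun x : ℝ => besselJ s (2 * x)) (Set.Ioi 0) := fun s => by
    refine ContinuousOn.congr (f := fun x : ℝ => (x : ℂ) ^ s * besselSeries s (-((x : ℂ) * x)))
      (fun x hx => ?_) fun x hx => besselJ_two_mul s hx
    have hx : 0 < x := hx
    have h1 := (differentiable_besselSeries s).continuous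
    refine ((Complex.continuousAt_ofReal_cpow_const _ _ (Or.inr hx.ne')).mul
      (Continuous.continuousAt (by fun_prop))).continuousWithinAt
  exact (continuousOn_const.mul ((h ν).add (h (-ν)))).div_const _

theorem norm_Jplus_le {ν : ℂ} (hν : ν.re = 0) {x : ℝ} (hx : 0 < x) :
    ‖Jplus ν x‖ ≤ 2 * (‖ν‖ + 5) / √x := by
  have hgen : ∀ {ν : ℂ}, ν.re = 0 → ν.im ≠ 0 → ‖Jplus ν x‖ ≤ 2 * (‖ν‖ + 5) / √x := by
    intro ν hν hν'
    have hk : ∀ η : ℝ, |η| = 1 →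
        ‖kernelExt ν x (η * ((Real.pi / 2 : ℝ) * Complex.I))‖ ≤ 2 * (‖ν‖ + 5) / √x := by
      intro η hη
      have h := norm_kernelExt_le hx (ζ := η * ((Real.pi / 2 : ℝ) * Complex.I))
        (by simp [abs_mul, hη, abs_of_pos (half_pos Real.pi_pos)]) hν hν'
      simpa using h
    rw [Jplus_eq_kernelExt hν' hx, norm_mul]
    have h1 := norm_sub_le (kernelExt ν x ((1 : ℝ) * ((Real.pi / 2 : ℝ) * Complex.I)))
      (kernelExt ν x ((-1 : ℝ) * ((Real.pi / 2 : ℝ) * Complex.I)))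
    have h2 := hk 1 (by simp)
    have h3 := hk (-1) (by simp)
    have h4 : ‖Complex.I / 2‖ = 1 / 2 := by simp
    rw [h4]
    linarith
  have hcl : IsClosed {t : ℝ | ‖Jplus (t * Complex.I) x‖ ≤ 2 * (‖(t : ℂ) * Complex.I‖ + 5) / √x} :=
    isClosed_le (continuous_Jplus_comp (by fun_prop) (by simp) hx).norm (by fun_prop)
  have hsub : ({0}ᶜ : Set ℝ) ⊆
      {t : ℝ | ‖Jplus (t * Complex.I) x‖ ≤ 2 * (‖(t : ℂ) * Complex.I‖ + 5) / √x} :=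
    fun t ht => hgen (by simp) (by simpa using ht)
  have h := hcl.closure_subset_iff.2 hsub
    ((dense_compl_singleton (0 : ℝ)).closure_eq ▸ Set.mem_univ ν.im)
  have he : (ν.im : ℂ) * Complex.I = ν := Complex.ext (by simp [hν]) (by simp)
  rwa [Set.mem_ofPred_eq, he] at h

theorem continuous_calJ1plus_comp {m₁ m₂ m₃ : ℝ → ℂ} (h₁ : Continuous m₁) (h₂ : Continuous m₂)
    (h₃ : Continuous m₃) (hr₁ : ∀ t, (m₁ t).re = 0) (hr₂ : ∀ t, (m₂ t).re = 0)
    (hr₃ : ∀ t, (m₃ t).re = 0) {y₁ y₂ : ℝ} (hy₁ : y₁ ≠ 0) (hy₂ : y₂ ≠ 0) :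
    Continuous fun t => calJ1plus y₁ y₂ (m₁ t) (m₂ t) (m₃ t) := by
  have hpi := Real.pi_pos
  have hy : ((|y₁ / y₂| : ℝ) : ℂ) ≠ 0 := Complex.ofReal_ne_zero.2 (by positivity)
  simp only [calJ1plus_eq_integral]
  refine ((h₂.div_const 2).const_cpow (Or.inl hy)).mul (continuous_const.mul ?_)
  obtain ⟨r₁, hr₁'⟩ : ∃ r, r = 2 * Real.pi * √|y₁| := ⟨_, rfl⟩
  obtain ⟨r₂, hr₂'⟩ : ∃ r, r = 2 * Real.pi * √|y₂| := ⟨_, rfl⟩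
  have k₁ : 0 < r₁ := by rw [hr₁']; positivity
  have k₂ : 0 < r₂ := by rw [hr₂']; positivity
  rw [← hr₁', ← hr₂']
  have hν : ∀ t, (m₃ t - m₁ t).re = 0 := fun t => by simp [hr₁, hr₃]
  refine continuous_iff_continuousAt.2 fun t₀ => ?_
  have hc : Continuous fun t => ‖m₃ t - m₁ t‖ := (h₃.sub h₁).norm
  have hev := (hc.tendsto t₀).eventually_le_const (lt_add_one _)
  set M := ‖m₃ t₀ - m₁ t₀‖ + 1
  have key : ∀ {ν : ℂ} {r x : ℝ}, ν.re = 0 → ‖ν‖ ≤ M → 0 < r → 0 < x →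
      ‖Jplus ν (r * √x)‖ ≤ 2 * (M + 5) / √r * (√(√x))⁻¹ := by
    intro ν r x hν hM hr hx
    have hx' : 0 < √x := Real.sqrt_pos.2 hx
    refine (norm_Jplus_le hν (by positivity)).trans ?_
    rw [← div_eq_mul_inv, div_div, ← Real.sqrt_mul hr.le]
    gcongr
  refine continuousAt_of_dominated
    (bound := fun v => (2 * (M + 5) / √r₁) * (2 * (M + 5) / √r₂) *
      (v⁻¹ * ((√(√(1 + v)))⁻¹ * (√(√(1 + 1 / v)))⁻¹))) ?_ ?_
    (integrableOn_kernelMellin_bound.const_mul _) ?_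
  · refine Filter.Eventually.of_forall fun t =>
      ContinuousOn.aestronglyMeasurable (fun v hv => ?_) measurableSet_Ioi
    have hv : 0 < v := hv
    have c1 : ContinuousAt (fun v : ℝ => r₁ * √(1 + v)) v := by fun_prop
    have c2 : ContinuousAt (fun v : ℝ => r₂ * √(1 + 1 / v)) v := by
      have := hv.ne'
      fun_prop (disch := assumption)
    have d1 := ((continuousOn_Jplus (m₃ t - m₁ t)).continuousAt
      (Ioi_mem_nhds (show 0 < r₁ * √(1 + v) by positivity))).comp
      (f := fun v : ℝ => r₁ * √(1 + v)) c1
    have d2 := ((continuousOn_Jplus (m₃ t - m₁ t)).continuousAt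
      (Ioi_mem_nhds (show 0 < r₂ * √(1 + 1 / v) by positivity))).comp
      (f := fun v : ℝ => r₂ * √(1 + 1 / v)) c2
    exact ((Complex.continuousAt_ofReal_cpow_const _ _ (Or.inr hv.ne')).mul
      (d1.mul d2)).continuousWithinAt
  · filter_upwards [hev] with t ht
    filter_upwards [ae_restrict_mem measurableSet_Ioi] with v hv
    have hv : 0 < v := hv
    rw [norm_mul, norm_mul, Complex.norm_cpow_eq_rpow_re_of_pos hv]
    have q1 := key (hν t) ht k₁ (show 0 < 1 + v by positivity)
    have q2 := key (hν t) ht k₂ (show 0 < 1 + 1 / v by positivity)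
    have q3 : v ^ (3 * m₂ t / 2 - 1).re = v⁻¹ := by
      rw [← Real.rpow_neg_one]; congr 1; simp [hr₂]
    rw [q3]
    calc _ ≤ v⁻¹ * ((2 * (M + 5) / √r₁ * (√(√(1 + v)))⁻¹) *
          (2 * (M + 5) / √r₂ * (√(√(1 + 1 / v)))⁻¹)) := by gcongr
      _ = _ := by ring
  · filter_upwards [ae_restrict_mem measurableSet_Ioi] with v hv
    have hv : 0 < v := hv
    have hv' : (v : ℂ) ≠ 0 := Complex.ofReal_ne_zero.2 hv.ne'
    exact ((Continuous.const_cpow (by fun_prop) (Or.inl hv')).mul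
      ((continuous_Jplus_comp (h₃.sub h₁) hν (by positivity)).mul
        (continuous_Jplus_comp (h₃.sub h₁) hν (by positivity)))).continuousAt

theorem eventually_add_mul_ne_zero (d : ℂ) {k : ℂ} (hk : k ≠ 0) :
    ∀ᶠ t : ℝ in nhdsWithin 0 {0}ᶜ, d + k * t ≠ 0 := by
  by_cases hd : d = 0
  · filter_upwards [self_mem_nhdsWithin] with t ht
    simpa [hd, hk] using ht
  · refine Filter.Eventually.filter_mono nhdsWithin_le_nhds ?_
    have hc : ContinuousAt (fun t : ℝ => d + k * t) 0 := by fun_prop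
    exact hc.eventually_ne (by simpa using hd)

/-- The double-Bessel integral representation of `K¹_{w_l}` in the sign case `(−,−)`. -/
theorem stmt14 (μ₁ μ₂ μ₃ : ℂ) (hsum : μ₁ + μ₂ + μ₃ = 0)
    (hre₁ : μ₁.re = 0) (hre₂ : μ₂.re = 0) (hre₃ : μ₃.re = 0) (hne : μ₁ ≠ μ₂)
    (y₁ y₂ : ℝ) (hy₁ : y₁ < 0) (hy₂ : y₂ < 0) :
    K1wl y₁ y₂ μ₁ μ₂ μ₃ / ((8 * |y₁ * y₂| : ℝ) : ℂ) =
      -calJ1plus y₁ y₂ μ₁ μ₂ μ₃ - calJ1plus y₁ y₂ μ₃ μ₁ μ₂ + calJ1plus y₁ y₂ μ₂ μ₃ μ₁ := by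
  set m₁ : ℝ → ℂ := fun t => μ₁ + t * Complex.I with hm₁
  set m₂ : ℝ → ℂ := fun t => μ₂ + 2 * t * Complex.I with hm₂
  set m₃ : ℝ → ℂ := fun t => μ₃ - 3 * t * Complex.I with hm₃
  have c₁ : Continuous m₁ := by fun_prop
  have c₂ : Continuous m₂ := by fun_prop
  have c₃ : Continuous m₃ := by fun_prop
  have r₁ : ∀ t, (m₁ t).re = 0 := by simp [hm₁, hre₁]
  have r₂ : ∀ t, (m₂ t).re = 0 := by simp [hm₂, hre₂]
  have r₃ : ∀ t, (m₃ t).re = 0 := by simp [hm₃, hre₃]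
  have z₁ : m₁ 0 = μ₁ := by simp [hm₁]
  have z₂ : m₂ 0 = μ₂ := by simp [hm₂]
  have z₃ : m₃ 0 = μ₃ := by simp [hm₃]
  have hcos : ∀ {a b : ℂ}, a.re = 0 → b.re = 0 → Complex.cos (Real.pi / 2 * (a - b)) ≠ 0 := by
    intro a b ha hb
    rw [div_mul_eq_mul_div]
    exact cos_pi_mul_div_two_ne_zero (by simp [ha, hb])
  have hsin : Complex.sin (Real.pi / 2 * (μ₁ - μ₂)) ≠ 0 := by
    rw [show (Real.pi : ℂ) / 2 * (μ₁ - μ₂) = Real.pi * ((μ₁ - μ₂) / 2) by ring]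
    refine sin_pi_mul_ne_zero_of_im_ne_zero fun h => hne (Complex.ext (hre₁.trans hre₂.symm) ?_)
    simpa [sub_eq_zero] using h
  have hK : ContinuousAt (fun t => K1wl y₁ y₂ (m₁ t) (m₂ t) (m₃ t)) 0 := by
    unfold K1wl Jsign
    have hJ : ∀ {a b c : ℝ → ℂ}, Continuous a → Continuous b → Continuous c →
        (∀ t, (a t).re = 0) → (∀ t, (b t).re = 0) → (∀ t, (c t).re = 0) →
        ContinuousAt (fun t => Jwl y₁ y₂ (a t) (b t) (c t)) 0 := fun ha hb hc ha' hb' hc' =>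
      (continuous_Jwl_comp ha hb hc ha' hb' hc' hy₁.ne hy₂.ne).continuousAt
    have j1 := hJ c₁ c₂ c₃ r₁ r₂ r₃
    have j2 := hJ c₃ c₁ c₂ r₃ r₁ r₂
    have j3 := hJ c₂ c₃ c₁ r₂ r₃ r₁
    have j4 := hJ c₂ c₁ c₃ r₂ r₁ r₃
    have j5 := hJ c₃ c₂ c₁ r₃ r₂ r₁
    have j6 := hJ c₁ c₃ c₂ r₁ r₃ r₂
    refine continuousAt_const.mul (ContinuousAt.div₀ (by fun_prop) (by fun_prop) ?_)
    rw [z₁, z₂, z₃]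
    exact mul_ne_zero (mul_ne_zero (hcos hre₁ hre₃) (hcos hre₂ hre₃)) hsin
  have hR : Continuous fun t => -calJ1plus y₁ y₂ (m₁ t) (m₂ t) (m₃ t) -
      calJ1plus y₁ y₂ (m₃ t) (m₁ t) (m₂ t) + calJ1plus y₁ y₂ (m₂ t) (m₃ t) (m₁ t) :=
    ((continuous_calJ1plus_comp c₁ c₂ c₃ r₁ r₂ r₃ hy₁.ne hy₂.ne).neg.sub
      (continuous_calJ1plus_comp c₃ c₁ c₂ r₃ r₁ r₂ hy₁.ne hy₂.ne)).add
      (continuous_calJ1plus_comp c₂ c₃ c₁ r₂ r₃ r₁ hy₁.ne hy₂.ne)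
  have hev : ∀ᶠ t in nhdsWithin (0 : ℝ) {0}ᶜ,
      K1wl y₁ y₂ (m₁ t) (m₂ t) (m₃ t) / ((8 * |y₁ * y₂| : ℝ) : ℂ) =
        -calJ1plus y₁ y₂ (m₁ t) (m₂ t) (m₃ t) - calJ1plus y₁ y₂ (m₃ t) (m₁ t) (m₂ t) +
          calJ1plus y₁ y₂ (m₂ t) (m₃ t) (m₁ t) := by
    filter_upwards [eventually_add_mul_ne_zero (μ₁ - μ₂) (k := -Complex.I) (by simp),
      eventually_add_mul_ne_zero (μ₁ - μ₃) (k := 4 * Complex.I) (by simp),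
      eventually_add_mul_ne_zero (μ₂ - μ₃) (k := 5 * Complex.I) (by simp)] with t h₁₂ h₁₃ h₂₃
    refine K1wl_div_eq_of_pairwise_ne ?_ (r₁ t) (r₂ t) (r₃ t) (fun h => h₁₂ ?_) (fun h => h₁₃ ?_)
      (fun h => h₂₃ ?_) hy₁ hy₂
    · simp only [hm₁, hm₂, hm₃]; linear_combination hsum
    · simp only [hm₁, hm₂] at h; linear_combination h
    · simp only [hm₁, hm₃] at h; linear_combination h
    · simp only [hm₂, hm₃] at h; linear_combination h
  have h := tendsto_nhds_unique_of_eventuallyEq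
    ((hK.div_const ((8 * |y₁ * y₂| : ℝ) : ℂ)).tendsto.mono_left nhdsWithin_le_nhds)
    ((hR.tendsto 0).mono_left nhdsWithin_le_nhds) hev
  rwa [z₁, z₂, z₃] at h
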